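/- arXiv:1906.03719 — 4 statements merged into one kernel-verified Lean document; each statement's English description precedes it below -/
import Mathlib

section
/- Let C₁,…,C_s be centrally symmetric convex bodies of volume 1 in ℝⁿ and let K be a centrally symmetric convex body in ℝⁿ. Then for every s ≥ 1 and every t = (t₁,…,t_s) ∈ ℝˢ one has ∫_{C₁}⋯∫_{C_s} ‖∑_{j=1}^s t_j x_j‖_K dx₁⋯dx_s ≥ (n/(e(n+1))) · vol_n(K)^{-1/n} · ‖t‖₂. In particular, if vol_n(K) = 1 then ‖t‖_{𝒞,K} ≥ (n/(e(n+1))) ‖t‖₂. -/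
open MeasureTheory Real
open scoped ENNReal RealInnerProductSpace

noncomputable section

/-- A centrally symmetric convex body: compact, convex, non-empty interior, `C = -C`. -/
def IsSymmConvexBody {n : ℕ} (C : Set (EuclideanSpace ℝ (Fin n))) : Prop :=
  Convex ℝ C ∧ IsCompact C ∧ (interior C).Nonempty ∧ C = -C

/-- The multi-integral `∫_{C₁}⋯∫_{C_s} ‖∑ t_j x_j‖_K dx₁⋯dx_s`, the norm `‖x‖_K`
being the gauge (Minkowski functional) of `K`. -/
def multiNorm {n s : ℕ} (C : Fin s → Set (EuclideanSpace ℝ (Fin n)))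
    (K : Set (EuclideanSpace ℝ (Fin n))) (t : Fin s → ℝ) : ℝ :=
  ∫ x in Set.univ.pi C, gauge K (∑ j, t j • x j)

/-- The Euclidean norm of `t ∈ ℝˢ`. -/
def euclNorm {s : ℕ} (t : Fin s → ℝ) : ℝ := Real.sqrt (∑ j, t j ^ 2)

open Set Filter Topology in
lemma hasDerivAt_integral_Iic {g : ℝ → ℝ} (hg : Integrable g) {x : ℝ}
    (h : HasDerivAt (fun y => ∫ s in (0 : ℝ)..y, g s) (g x) x) :
    HasDerivAt (fun y => ∫ s in Iic y, g s) (g x) x := by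
  have : (fun y => ∫ s in Iic y, g s) =
      fun y => (∫ s in Iic (0 : ℝ), g s) + ∫ s in (0 : ℝ)..y, g s := by
    funext y
    rw [← intervalIntegral.integral_Iic_sub_Iic hg.integrableOn hg.integrableOn]
    ring
  rw [this]
  exact h.const_add _

open Set Filter Topology in
lemma tendsto_integral_Iic_atTop {g : ℝ → ℝ} (hg : Integrable g) :
    Tendsto (fun y => ∫ s in Iic y, g s) atTop (𝓝 (∫ s, g s)) :=
  (aecover_Iic
    tendsto_id).integral_tendsto_of_countably_generated hg

open Set Filter Topology in
lemma tendsto_integral_Iic_atBot {g : ℝ → ℝ} (hg : Integrable g) :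
    Tendsto (fun y => ∫ s in Iic y, g s) atBot (𝓝 0) := by
  have h := (aecover_Ioi (μ := (volume : Measure ℝ))
    tendsto_id).integral_tendsto_of_countably_generated hg
  have h2 : (fun y => ∫ s in Iic y, g s) = fun y => (∫ s, g s) - ∫ s in Ioi y, g s := by
    funext y
    rw [← intervalIntegral.integral_Iic_add_Ioi (b := y) hg.integrableOn hg.integrableOn]
    ring
  rw [h2]
  simpa using h.const_sub (∫ s, g s)

open Set Filter Topology in
lemma monotone_integral_Iic {g : ℝ → ℝ} (hg : Integrable g) (h0 : ∀ x, 0 ≤ g x) :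
    Monotone fun y => ∫ s in Iic y, g s := fun _ _ hab =>
  setIntegral_mono_set hg.integrableOn (ae_of_all _ h0) (Iic_subset_Iic.2 hab).eventuallyLE

open Set Filter Topology in
lemma HasDerivAt.exists_lt_lt_of_pos {F : ℝ → ℝ} {a x : ℝ} (h : HasDerivAt F a x) (ha : 0 < a) :
    (∀ y < x, ∃ z ∈ Ioo y x, F z < F x) ∧ ∀ y > x, ∃ z ∈ Ioo x y, F x < F z := by
  have h1 := (hasDerivAt_iff_tendsto_slope.1 h).eventually (lt_mem_nhds ha)
  constructor
  · intro y hy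
    have h2 : ∀ᶠ z in 𝓝[<] x, 0 < slope F x z :=
      h1.filter_mono (nhdsWithin_mono _ fun z hz => ne_of_lt hz)
    obtain ⟨z, hz, hz'⟩ := (h2.and (Ioo_mem_nhdsLT hy)).exists
    refine ⟨z, hz', ?_⟩
    rw [slope_comm, slope_def_field, div_pos_iff_of_pos_right (by linarith [hz'.2])] at hz
    linarith
  · intro y hy
    have h2 : ∀ᶠ z in 𝓝[>] x, 0 < slope F x z :=
      h1.filter_mono (nhdsWithin_mono _ fun z hz => ne_of_gt hz)
    obtain ⟨z, hz, hz'⟩ := (h2.and (Ioo_mem_nhdsGT hy)).exists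
    refine ⟨z, hz', ?_⟩
    rw [slope_def_field, div_pos_iff_of_pos_right (by linarith [hz'.1])] at hz
    linarith

open Set Filter Topology in
/-- Existence of the quantile function of a continuous positive probability density. -/
lemma exists_quantile {γ : ℝ → ℝ} (hc : Continuous γ) (hpos : ∀ u, 0 < γ u)
    (hintegral : ∫ u, γ u = 1) :
    ∃ Q : ℝ → ℝ, ∀ p ∈ Ioo (0 : ℝ) 1, HasDerivAt Q (γ (Q p))⁻¹ p := by
  have hi : Integrable γ := by
    by_contra h
    rw [integral_undef h] at hintegral
    exact zero_ne_one hintegral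
  set Φ : ℝ → ℝ := fun y => ∫ s in Iic y, γ s with hΦ
  have hd : ∀ u, HasDerivAt Φ (γ u) u := fun u => hasDerivAt_integral_Iic hi
    (hc.integral_hasStrictDerivAt 0 u).hasDerivAt
  have hm : StrictMono Φ := strictMono_of_hasDerivAt_pos hd hpos
  have hcont : Continuous Φ := continuous_iff_continuousAt.2 fun u => (hd u).continuousAt
  have htop : Tendsto Φ atTop (𝓝 1) := hintegral ▸ tendsto_integral_Iic_atTop hi
  have hbot : Tendsto Φ atBot (𝓝 0) := tendsto_integral_Iic_atBot hi
  have hmem : ∀ u, Φ u ∈ Ioo (0 : ℝ) 1 := fun u =>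
    ⟨(hm.monotone.le_of_tendsto hbot (u - 1)).trans_lt (hm (by linarith)),
      (hm (by linarith : u < u + 1)).trans_le (hm.monotone.ge_of_tendsto htop (u + 1))⟩
  have hsurj : ∀ p ∈ Ioo (0 : ℝ) 1, ∃ u, Φ u = p := by
    intro p hp
    exact mem_range_of_exists_le_of_exists_ge hcont
      ((hbot.eventually (gt_mem_nhds hp.1)).exists.imp fun _ h => h.le)
      ((htop.eventually (lt_mem_nhds hp.2)).exists.imp fun _ h => h.le)
  choose! Q hQ using hsurj
  have hQm : StrictMonoOn Q (Ioo 0 1) := fun a ha b hb hab => by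
    rw [← hm.lt_iff_lt, hQ a ha, hQ b hb]; exact hab
  refine ⟨Q, fun p hp => ?_⟩
  have hn : Ioo (0 : ℝ) 1 ∈ 𝓝 p := Ioo_mem_nhds hp.1 hp.2
  refine HasDerivAt.of_local_left_inverse ?_ (hd (Q p)) (hpos _).ne' ?_
  · refine hQm.continuousAt_of_image_mem_nhds hn ?_
    have : Q '' Ioo 0 1 = univ := eq_univ_of_forall fun u =>
      ⟨Φ u, hmem u, hm.injective (hQ _ (hmem u))⟩
    rw [this]
    exact univ_mem
  · filter_upwards [hn] with y hy using hQ y hy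

open Set Filter Topology in
/-- Monotone transport of a finite measure with density `f` on the line to a probability measure
with continuous positive density `γ`. -/
lemma exists_transport {γ : ℝ → ℝ} (hc : Continuous γ) (hpos : ∀ u, 0 < γ u)
    (hintegral : ∫ u, γ u = 1) {f : ℝ → ℝ≥0∞} (hf : Measurable f) (h0 : ∫⁻ x, f x ≠ 0)
    (htop : ∫⁻ x, f x ≠ ∞) :
    ∃ (D : Set ℝ) (U a : ℝ → ℝ), MeasurableSet D ∧ StrictMonoOn U D ∧
      (∀ x ∈ D, HasDerivAt U (a x) x ∧ 0 < a x ∧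
        f x = (∫⁻ y, f y) * ENNReal.ofReal (a x * γ (U x))) ∧
      ∀ᵐ x, x ∉ D → f x = 0 := by
  obtain ⟨Q, hQ⟩ := exists_quantile hc hpos hintegral
  set m := (∫⁻ y, f y).toReal with hm
  have hm0 : 0 < m := ENNReal.toReal_pos h0 htop
  set g : ℝ → ℝ := fun x => (f x).toReal / m with hg
  have hg0 : ∀ x, 0 ≤ g x := fun x => by positivity
  have hgi : Integrable g := (integrable_toReal_of_lintegral_ne_top hf.aemeasurable htop).div_const _
  have hfin : ∀ᵐ x, f x < ∞ := ae_lt_top hf htop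
  have hg1 : ∫ x, g x = 1 := by
    rw [integral_div, integral_toReal hf.aemeasurable hfin, ← hm, div_self hm0.ne']
  set F : ℝ → ℝ := fun y => ∫ s in Iic y, g s with hF
  have hFm : Monotone F := monotone_integral_Iic hgi hg0
  have hFtop : Tendsto F atTop (𝓝 1) := hg1 ▸ tendsto_integral_Iic_atTop hgi
  have hFbot : Tendsto F atBot (𝓝 0) := tendsto_integral_Iic_atBot hgi
  have hd : ∀ᵐ x, HasDerivAt F (g x) x ∧ f x < ∞ := by
    filter_upwards [_root_.LocallyIntegrable.ae_hasDerivAt_integral hgi.locallyIntegrable,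
      hfin] with x hx hx'
    exact ⟨hasDerivAt_integral_Iic hgi (hx 0), hx'⟩
  obtain ⟨T, hT, hTm, hTd⟩ := hd.exists_measurable_mem
  have hgm : Measurable g := hf.ennreal_toReal.div_const _
  have key : ∀ x ∈ T ∩ {x | 0 < g x}, F x ∈ Ioo (0 : ℝ) 1 ∧ ∀ y > x, F x < F y := by
    rintro x ⟨hxT, hx⟩
    obtain ⟨h1, h2⟩ := (hTd x hxT).1.exists_lt_lt_of_pos hx
    refine ⟨⟨?_, ?_⟩, fun y hy => ?_⟩
    · obtain ⟨z, -, hz⟩ := h1 (x - 1) (by linarith)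
      exact (hFm.le_of_tendsto hFbot z).trans_lt hz
    · obtain ⟨z, -, hz⟩ := h2 (x + 1) (by linarith)
      exact hz.trans_le (hFm.ge_of_tendsto hFtop z)
    · obtain ⟨z, hz', hz⟩ := h2 y hy
      exact hz.trans_le (hFm hz'.2.le)
  have hQm : StrictMonoOn Q (Ioo 0 1) := by
    refine strictMonoOn_of_deriv_pos (convex_Ioo 0 1)
      (fun p hp => (hQ p hp).continuousAt.continuousWithinAt) fun p hp => ?_
    rw [interior_Ioo] at hp
    rw [(hQ p hp).deriv]
    exact inv_pos.2 (hpos _)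
  refine ⟨T ∩ {x | 0 < g x}, Q ∘ F, fun x => (γ (Q (F x)))⁻¹ * g x,
    hTm.inter (measurableSet_lt measurable_const hgm), ?_, ?_, ?_⟩
  · intro x hx y hy hxy
    exact hQm (key x hx).1 (key y hy).1 ((key x hx).2 y hxy)
  · intro x hx
    have hγ := hpos (Q (F x))
    refine ⟨(hQ _ (key x hx).1).comp x (hTd x hx.1).1, mul_pos (inv_pos.2 hγ) hx.2, ?_⟩
    have e : (γ (Q (F x)))⁻¹ * g x * γ ((Q ∘ F) x) = (f x).toReal / m := by
      simp only [Function.comp]; field_simp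
      simp only [hg]; field_simp
    rw [e, ← ENNReal.ofReal_toReal htop, ← ENNReal.ofReal_mul ENNReal.toReal_nonneg, ← hm,
      mul_div_cancel₀ _ hm0.ne', ENNReal.ofReal_toReal (hTd x hx.1).2.ne]
  · filter_upwards [hT] with x hxT hx
    have : ¬ 0 < g x := fun h => hx ⟨hxT, h⟩
    by_contra hne
    exact this (div_pos (ENNReal.toReal_pos hne (hTd x hxT).2.ne) hm0)

/-- The centred Gaussian density proportional to `exp (-π u² / c)`. -/
def gaussDensity (c u : ℝ) : ℝ := (√c)⁻¹ * exp (-(π / c) * u ^ 2)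

lemma continuous_gaussDensity (c : ℝ) : Continuous (gaussDensity c) := by
  unfold gaussDensity; fun_prop

lemma gaussDensity_pos {c : ℝ} (hc : 0 < c) (u : ℝ) : 0 < gaussDensity c u := by
  unfold gaussDensity; positivity

lemma integral_gaussDensity {c : ℝ} (hc : 0 < c) : ∫ u, gaussDensity c u = 1 := by
  unfold gaussDensity
  rw [integral_const_mul, integral_gaussian]
  have : π / (π / c) = c := by field_simp
  rw [this, inv_mul_cancel₀ (by positivity)]

lemma lintegral_exp_neg_pi_sq : ∫⁻ r : ℝ, ENNReal.ofReal (exp (-π * r ^ 2)) = 1 := by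
  rw [← ofReal_integral_eq_lintegral_ofReal (integrable_exp_neg_mul_sq pi_pos)
    (ae_of_all _ fun _ => (exp_pos _).le), integral_gaussian, div_self pi_ne_zero, sqrt_one,
    ENNReal.ofReal_one]

lemma lintegral_exp_neg_pi_sum_sq {ι : Type*} [Fintype ι] :
    ∫⁻ y : ι → ℝ, ENNReal.ofReal (exp (-π * ∑ j, y j ^ 2)) = 1 := by
  have h : ∀ y : ι → ℝ, exp (-π * ∑ j, y j ^ 2) = ∏ j, exp (-π * y j ^ 2) := fun y => by
    rw [← exp_sum, Finset.mul_sum]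
  simp_rw [h]
  have hi : Integrable (fun y : ι → ℝ => ∏ j, exp (-π * y j ^ 2)) :=
    Integrable.fintype_prod fun _ => integrable_exp_neg_mul_sq pi_pos
  rw [← ofReal_integral_eq_lintegral_ofReal hi
      (ae_of_all _ fun _ => Finset.prod_nonneg fun _ _ => (exp_pos _).le),
    integral_fintype_prod_volume_eq_prod (fun (_ : ι) r => exp (-π * r ^ 2))]
  simp only [integral_gaussian, div_self pi_ne_zero, sqrt_one, Finset.prod_const_one,
    ENNReal.ofReal_one]

/-- Integrating a function of the coordinate along a unit vector `t` against the Gaussian weight on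
the orthogonal complement of `t`. -/
lemma lintegral_mul_gaussian_orthogonal {ι : Type*} [Fintype ι] {t : ι → ℝ}
    (ht : ∑ j, t j ^ 2 = 1) {W : ℝ → ℝ≥0∞} (hW : Measurable W) :
    ∫⁻ y : ι → ℝ, W (∑ j, t j * y j) *
      ENNReal.ofReal (exp (-π * (∑ j, y j ^ 2 - (∑ j, t j * y j) ^ 2))) = ∫⁻ r, W r := by
  have hmul : ∀ a b : ℝ, ENNReal.ofReal (exp (-π * a)) * ENNReal.ofReal (exp (-π * b)) =
      ENNReal.ofReal (exp (-π * (a + b))) := fun a b => by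
    rw [← ENNReal.ofReal_mul (exp_pos _).le, ← exp_add]; ring_nf
  have ht' : ∑ j, t j * t j = 1 := by simpa [sq] using ht
  calc
    _ = ∫⁻ y : ι → ℝ, ∫⁻ r : ℝ, W (∑ j, t j * y j) *
        ENNReal.ofReal (exp (-π * (∑ j, y j ^ 2 - (∑ j, t j * y j) ^ 2))) *
          ENNReal.ofReal (exp (-π * (r - ∑ j, t j * y j) ^ 2)) := by
      refine lintegral_congr fun y => ?_
      rw [lintegral_const_mul _ (by fun_prop),
        lintegral_sub_right_eq_self (fun r : ℝ => ENNReal.ofReal (exp (-π * r ^ 2))),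
        lintegral_exp_neg_pi_sq, mul_one]
    _ = ∫⁻ r : ℝ, ∫⁻ y : ι → ℝ, W (∑ j, t j * y j) *
        ENNReal.ofReal (exp (-π * (∑ j, y j ^ 2 - (∑ j, t j * y j) ^ 2))) *
          ENNReal.ofReal (exp (-π * (r - ∑ j, t j * y j) ^ 2)) :=
      lintegral_lintegral_swap (by fun_prop)
    _ = ∫⁻ r : ℝ, ∫⁻ y : ι → ℝ, W (r + ∑ j, t j * y j) *
        ENNReal.ofReal (exp (-π * ∑ j, y j ^ 2)) := by
      refine lintegral_congr fun r => ?_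
      rw [← lintegral_add_right_eq_self _ (r • t)]
      refine lintegral_congr fun y => ?_
      have h1 : ∑ j, t j * (y + r • t) j = r + ∑ j, t j * y j := by
        simp only [Pi.add_apply, Pi.smul_apply, smul_eq_mul, mul_add, Finset.sum_add_distrib,
          mul_left_comm _ r, ← Finset.mul_sum, ht']
        ring
      have h2 : ∑ j, (y + r • t) j ^ 2 = ∑ j, y j ^ 2 + 2 * r * ∑ j, t j * y j + r ^ 2 := by
        have : ∀ j, (y + r • t) j ^ 2 = y j ^ 2 + 2 * r * (t j * y j) + r ^ 2 * t j ^ 2 :=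
          fun j => by simp only [Pi.add_apply, Pi.smul_apply, smul_eq_mul]; ring
        simp only [this, Finset.sum_add_distrib, ← Finset.mul_sum, ht, mul_one]
      rw [h1, h2, mul_assoc, hmul]
      congr 4
      ring
    _ = ∫⁻ y : ι → ℝ, ∫⁻ r : ℝ, W (r + ∑ j, t j * y j) *
        ENNReal.ofReal (exp (-π * ∑ j, y j ^ 2)) :=
      lintegral_lintegral_swap (by fun_prop)
    _ = ∫⁻ y : ι → ℝ, (∫⁻ r, W r) * ENNReal.ofReal (exp (-π * ∑ j, y j ^ 2)) := by
      refine lintegral_congr fun y => ?_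
      rw [lintegral_mul_const _ (by fun_prop), lintegral_add_right_eq_self]
    _ = ∫⁻ r, W r := by
      rw [lintegral_const_mul _ (by fun_prop), lintegral_exp_neg_pi_sum_sq, mul_one]

open Matrix in
lemma det_diagonal_add_vecMulVec {ι : Type*} [Fintype ι] [DecidableEq ι] {a t : ι → ℝ}
    (ha : ∀ j, 0 < a j) (ht : ∑ j, t j ^ 2 = 1) :
    (diagonal a + vecMulVec t fun j => t j * (1 - a j)).det = (∏ j, a j) * ∑ j, t j ^ 2 / a j := by
  have hu : IsUnit (diagonal a).det := by
    rw [det_diagonal]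
    exact (Finset.prod_pos fun j _ => ha j).ne'.isUnit
  rw [vecMulVec_eq Unit, det_add_replicateCol_mul_replicateRow hu, det_diagonal, det_unique]
  congr 1
  have : (diagonal a)⁻¹ = diagonal fun j => (a j)⁻¹ := by
    refine inv_eq_left_inv ?_
    rw [diagonal_mul_diagonal, ← diagonal_one]
    congr 1; funext j
    exact inv_mul_cancel₀ (ha j).ne'
  rw [this, Matrix.add_apply, one_apply_eq, mul_apply]
  simp only [mul_diagonal, replicateRow_apply, replicateCol_apply]
  have hsum : ∑ j, t j ^ 2 / a j = ∑ j, t j ^ 2 + ∑ j, t j * (1 - a j) * (a j)⁻¹ * t j := by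
    rw [← Finset.sum_add_distrib]
    refine Finset.sum_congr rfl fun j _ => ?_
    have := (ha j).ne'
    field_simp
    ring
  rw [hsum, ht]

lemma prod_rpow_le_prod_mul_sum {ι : Type*} [Fintype ι] {a t : ι → ℝ}
    (ha : ∀ j, 0 < a j) (ht : ∑ j, t j ^ 2 = 1) :
    ∏ j, a j ^ (1 - t j ^ 2) ≤ (∏ j, a j) * ∑ j, t j ^ 2 / a j := by
  have h := Real.geom_mean_le_arith_mean_weighted Finset.univ (fun j => t j ^ 2)
    (fun j => (a j)⁻¹) (fun _ _ => sq_nonneg _) ht fun j _ => (inv_pos.2 (ha j)).le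
  have e : ∏ j, a j ^ (1 - t j ^ 2) = (∏ j, a j) * ∏ j, (a j)⁻¹ ^ t j ^ 2 := by
    rw [← Finset.prod_mul_distrib]
    refine Finset.prod_congr rfl fun j _ => ?_
    rw [rpow_sub (ha j), rpow_one, inv_rpow (ha j).le, div_eq_mul_inv]
  rw [e]
  exact mul_le_mul_of_nonneg_left h (Finset.prod_nonneg fun j _ => (ha j).le)

lemma prod_gaussDensity_rpow_le {ι : Type*} [Fintype ι] {t : ι → ℝ}
    (ht : ∑ j, t j ^ 2 = 1) (hlt : ∀ j, t j ^ 2 < 1) (u : ι → ℝ) :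
    ∏ j, gaussDensity (1 - t j ^ 2) (u j) ^ (1 - t j ^ 2) ≤
      exp 1 * exp (-π * (∑ j, u j ^ 2 - (∑ j, t j * u j) ^ 2)) := by
  have h : ∀ j, gaussDensity (1 - t j ^ 2) (u j) ^ (1 - t j ^ 2) ≤
      exp (t j ^ 2 + -π * u j ^ 2) := by
    intro j
    have hc : 0 < 1 - t j ^ 2 := sub_pos.2 (hlt j)
    set c := 1 - t j ^ 2 with hcdef
    unfold gaussDensity
    rw [mul_rpow (by positivity) (exp_pos _).le, ← exp_mul, exp_add]
    have e : -(π / c) * u j ^ 2 * c = -π * u j ^ 2 := by field_simp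
    rw [e]
    refine mul_le_mul_of_nonneg_right ?_ (exp_pos _).le
    rw [rpow_def_of_pos (by positivity), exp_le_exp, log_inv, log_sqrt hc.le]
    have h1 := one_sub_inv_le_log_of_pos hc
    have h2 : c * (1 - c⁻¹) ≤ c * log c := mul_le_mul_of_nonneg_left h1 hc.le
    have h3 : c * (1 - c⁻¹) = - t j ^ 2 := by field_simp; rw [hcdef]; ring
    nlinarith [sq_nonneg (t j)]
  calc _ ≤ ∏ j, exp (t j ^ 2 + -π * u j ^ 2) :=
        Finset.prod_le_prod (fun j _ => rpow_nonneg (gaussDensity_pos (sub_pos.2 (hlt j)) _).le _)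
          fun j _ => h j
    _ = exp 1 * exp (-π * ∑ j, u j ^ 2) := by
        rw [← exp_sum, Finset.sum_add_distrib, ht, ← Finset.mul_sum, exp_add]
    _ ≤ _ := by
        gcongr exp 1 * exp ?_
        nlinarith [pi_pos, sq_nonneg (∑ j, t j * u j),
          mul_nonneg pi_pos.le (sq_nonneg (∑ j, t j * u j))]

open Matrix in
lemma hasFDerivAt_rankOne_perturbation {ι : Type*} [Fintype ι] [DecidableEq ι] {U : ι → ℝ → ℝ}
    {a t x : ι → ℝ} (h : ∀ j, HasDerivAt (U j) (a j) (x j)) :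
    HasFDerivAt (fun x : ι → ℝ => fun i => U i (x i) + t i * ∑ j, t j * (x j - U j (x j)))
      (LinearMap.toContinuousLinearMap
        (toLin' (diagonal a + vecMulVec t fun j => t j * (1 - a j)))) x := by
  have hU : ∀ j, HasFDerivAt (fun x : ι → ℝ => U j (x j))
      (a j • (ContinuousLinearMap.proj j : (ι → ℝ) →L[ℝ] ℝ)) x := fun j =>
    (h j).comp_hasFDerivAt x (ContinuousLinearMap.proj j : (ι → ℝ) →L[ℝ] ℝ).hasFDerivAt
  have hP : ∀ j, HasFDerivAt (fun x : ι → ℝ => x j)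
      (ContinuousLinearMap.proj j : (ι → ℝ) →L[ℝ] ℝ) x := fun j =>
    (ContinuousLinearMap.proj j : (ι → ℝ) →L[ℝ] ℝ).hasFDerivAt
  refine hasFDerivAt_pi'' fun i => ?_
  refine ((hU i).add ((HasFDerivAt.fun_sum fun j (_ : j ∈ Finset.univ) =>
    ((hP j).sub (hU j)).const_mul (t j)).const_mul (t i))).congr_fderiv ?_
  ext v
  simp only [_root_.add_apply, _root_.smul_apply,
    _root_.sum_apply, _root_.sub_apply, ContinuousLinearMap.proj_apply,
    ContinuousLinearMap.comp_apply, LinearMap.coe_toContinuousLinearMap', toLin'_apply,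
    add_mulVec, Pi.add_apply, mulVec, dotProduct, vecMulVec_apply, smul_eq_mul,
    diagonal_apply, ite_mul, zero_mul, Finset.sum_ite_eq, Finset.mem_univ, if_true]
  congr 1
  rw [Finset.mul_sum]
  refine Finset.sum_congr rfl fun j _ => ?_
  ring

lemma injOn_rankOne_perturbation {ι : Type*} [Fintype ι] {U : ι → ℝ → ℝ} {D : ι → Set ℝ}
    {t : ι → ℝ} (ht : ∑ j, t j ^ 2 = 1) (hU : ∀ j, StrictMonoOn (U j) (D j)) :
    Set.InjOn (fun x : ι → ℝ => fun i => U i (x i) + t i * ∑ j, t j * (x j - U j (x j)))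
      (Set.univ.pi D) := by
  intro x hx y hy hxy
  have ht' : ∑ j, t j * t j = 1 := by simpa [sq] using ht
  set l := ∑ j, t j * (y j - U j (y j)) - ∑ j, t j * (x j - U j (x j)) with hl
  have h1 : ∀ i, U i (x i) - U i (y i) = t i * l := fun i => by
    have := congrFun hxy i
    simp only at this
    rw [hl]; linarith
  have h2 : ∑ j, t j * (x j - y j) = 0 := by
    have e : l = ∑ j, (t j * (U j (x j) - U j (y j)) - t j * (x j - y j)) := by
      rw [hl, ← Finset.sum_sub_distrib]
      exact Finset.sum_congr rfl fun j _ => by ring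
    simp only [h1, Finset.sum_sub_distrib, ← mul_assoc, ← Finset.sum_mul, ht'] at e
    linarith
  have h3 : ∑ j, (U j (x j) - U j (y j)) * (x j - y j) = 0 := by
    calc _ = l * ∑ j, t j * (x j - y j) := by
          rw [Finset.mul_sum]
          exact Finset.sum_congr rfl fun j _ => by rw [h1]; ring
      _ = 0 := by rw [h2, mul_zero]
  have h4 : ∀ j, x j ≠ y j → 0 < (U j (x j) - U j (y j)) * (x j - y j) := by
    intro j hj
    rcases lt_or_gt_of_ne hj with h | h
    · exact mul_pos_of_neg_of_neg
        (sub_neg.2 (hU j (hx j trivial) (hy j trivial) h)) (sub_neg.2 h)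
    · exact mul_pos (sub_pos.2 (hU j (hy j trivial) (hx j trivial) h)) (sub_pos.2 h)
  have h5 := (Finset.sum_eq_zero_iff_of_nonneg fun j _ => by
    by_cases hj : x j = y j
    · simp [hj]
    · exact (h4 j hj).le).1 h3
  funext j
  by_contra hj
  exact (h4 j hj).ne' (h5 j (Finset.mem_univ j))

open Matrix in
lemma lintegral_mul_prod_rpow_le_of_ne_top {ι : Type*} [Fintype ι] {t : ι → ℝ}
    (ht : ∑ j, t j ^ 2 = 1) (hlt : ∀ j, t j ^ 2 < 1) {W : ℝ → ℝ≥0∞} (hW : Measurable W)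
    {f : ι → ℝ → ℝ≥0∞} (hf : ∀ j, Measurable (f j)) (h0 : ∀ j, ∫⁻ x, f j x ≠ 0)
    (htop : ∀ j, ∫⁻ x, f j x ≠ ∞) :
    ∫⁻ x : ι → ℝ, W (∑ j, t j * x j) * ∏ j, f j (x j) ^ (1 - t j ^ 2) ≤
      ENNReal.ofReal (exp 1) * (∫⁻ r, W r) * ∏ j, (∫⁻ r, f j r) ^ (1 - t j ^ 2) := by
  classical
  have hc : ∀ j, 0 < 1 - t j ^ 2 := fun j => sub_pos.2 (hlt j)
  have ht' : ∑ j, t j * t j = 1 := by simpa [sq] using ht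
  choose D U a hD hU hDx hDae using fun j => exists_transport
    (continuous_gaussDensity (1 - t j ^ 2)) (gaussDensity_pos (hc j))
    (integral_gaussDensity (hc j)) (hf j) (h0 j) (htop j)
  set S := Set.univ.pi D with hS
  have hSm : MeasurableSet S := MeasurableSet.univ_pi hD
  set Θ : (ι → ℝ) → ι → ℝ := fun x i => U i (x i) + t i * ∑ j, t j * (x j - U j (x j)) with hΘ
  set L : (ι → ℝ) → (ι → ℝ) →L[ℝ] (ι → ℝ) := fun x => LinearMap.toContinuousLinearMap
    (toLin' (diagonal (fun j => a j (x j)) + vecMulVec t fun j => t j * (1 - a j (x j)))) with hL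
  have hΘL : ∀ x ∈ S, HasFDerivWithinAt Θ (L x) S x := fun x hx =>
    (hasFDerivAt_rankOne_perturbation fun j => (hDx j _ (hx j trivial)).1).hasFDerivWithinAt
  set M := ∏ j, (∫⁻ r, f j r) ^ (1 - t j ^ 2) with hM
  set h : (ι → ℝ) → ℝ≥0∞ := fun y => W (∑ j, t j * y j) *
      ENNReal.ofReal (exp (-π * (∑ j, y j ^ 2 - (∑ j, t j * y j) ^ 2))) with hh
  have hhm : Measurable h := by fun_prop
  have htΘ : ∀ x, ∑ j, t j * Θ x j = ∑ j, t j * x j := by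
    intro x
    simp only [hΘ, mul_add, Finset.sum_add_distrib, ← mul_assoc, ← Finset.sum_mul, ht', one_mul]
    rw [← Finset.sum_add_distrib]
    exact Finset.sum_congr rfl fun j _ => by ring
  have hqΘ : ∀ x, ∑ j, Θ x j ^ 2 - (∑ j, t j * Θ x j) ^ 2 =
      ∑ j, U j (x j) ^ 2 - (∑ j, t j * U j (x j)) ^ 2 := by
    intro x
    set l := ∑ j, t j * (x j - U j (x j)) with hl
    have e1 : ∑ j, Θ x j ^ 2 =
        ∑ j, U j (x j) ^ 2 + 2 * l * ∑ j, t j * U j (x j) + l ^ 2 := by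
      have : ∀ j, Θ x j ^ 2 = U j (x j) ^ 2 + 2 * l * (t j * U j (x j)) + l ^ 2 * t j ^ 2 :=
        fun j => by simp only [hΘ, ← hl]; ring
      simp only [this, Finset.sum_add_distrib, ← Finset.mul_sum, ht, mul_one]
    have e2 : ∑ j, t j * Θ x j = ∑ j, t j * U j (x j) + l := by
      simp only [hΘ, ← hl, mul_add, Finset.sum_add_distrib, ← mul_assoc, ← Finset.sum_mul, ht',
        one_mul]
    rw [e1, e2]; ring
  have hpt : ∀ x ∈ S, W (∑ j, t j * x j) * ∏ j, f j (x j) ^ (1 - t j ^ 2) ≤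
      ENNReal.ofReal |(L x).det| * (ENNReal.ofReal (exp 1) * M * h (Θ x)) := by
    intro x hx
    have ha : ∀ j, 0 < a j (x j) := fun j => (hDx j _ (hx j trivial)).2.1
    have hγ : ∀ j, 0 < gaussDensity (1 - t j ^ 2) (U j (x j)) := fun j => gaussDensity_pos (hc j) _
    have hdet : (L x).det = (∏ j, a j (x j)) * ∑ j, t j ^ 2 / a j (x j) := by
      rw [← det_diagonal_add_vecMulVec ha ht, ← LinearMap.det_toLin']
      rfl
    have hreal : ∏ j, (a j (x j) * gaussDensity (1 - t j ^ 2) (U j (x j))) ^ (1 - t j ^ 2) ≤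
        |(L x).det| * (exp 1 * exp (-π * (∑ j, Θ x j ^ 2 - (∑ j, t j * Θ x j) ^ 2))) := by
      simp only [mul_rpow (ha _).le (hγ _).le, Finset.prod_mul_distrib]
      rw [hqΘ]
      exact mul_le_mul ((prod_rpow_le_prod_mul_sum ha ht).trans (hdet ▸ le_abs_self _))
        (prod_gaussDensity_rpow_le ht hlt _)
        (Finset.prod_nonneg fun j _ => rpow_nonneg (hγ j).le _) (abs_nonneg _)
    have hprod : ∏ j, f j (x j) ^ (1 - t j ^ 2) = M * ENNReal.ofReal
        (∏ j, (a j (x j) * gaussDensity (1 - t j ^ 2) (U j (x j))) ^ (1 - t j ^ 2)) := by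
      rw [ENNReal.ofReal_prod_of_nonneg fun j _ => rpow_nonneg (mul_pos (ha j) (hγ j)).le _, hM,
        ← Finset.prod_mul_distrib]
      refine Finset.prod_congr rfl fun j _ => ?_
      rw [(hDx j _ (hx j trivial)).2.2, ENNReal.mul_rpow_of_nonneg _ _ (hc j).le,
        ENNReal.ofReal_rpow_of_pos (mul_pos (ha j) (hγ j))]
    rw [hprod]
    calc _ ≤ W (∑ j, t j * x j) * (M * ENNReal.ofReal (|(L x).det| * (exp 1 *
          exp (-π * (∑ j, Θ x j ^ 2 - (∑ j, t j * Θ x j) ^ 2))))) := by gcongr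
      _ = _ := by
        rw [ENNReal.ofReal_mul (abs_nonneg _), ENNReal.ofReal_mul (exp_pos _).le, hh]
        simp only [htΘ]
        ring
  calc
    _ = ∫⁻ x in S, W (∑ j, t j * x j) * ∏ j, f j (x j) ^ (1 - t j ^ 2) := by
      rw [← lintegral_indicator hSm]
      refine lintegral_congr_ae ?_
      have : ∀ᵐ x : ι → ℝ, ∀ j, x j ∉ D j → f j (x j) = 0 := ae_all_iff.2 fun j =>
        (Measure.quasiMeasurePreserving_eval (fun _ : ι => (volume : Measure ℝ)) j).ae (hDae j)
      filter_upwards [this] with x hx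
      by_cases hxS : x ∈ S
      · rw [Set.indicator_of_mem hxS]
      · rw [Set.indicator_of_notMem hxS]
        obtain ⟨j, hj⟩ : ∃ j, x j ∉ D j := by
          by_contra hcon
          push Not at hcon
          exact hxS fun j _ => hcon j
        rw [Finset.prod_eq_zero (Finset.mem_univ j), mul_zero]
        rw [hx j hj, ENNReal.zero_rpow_of_pos (hc j)]
    _ ≤ ∫⁻ x in S, ENNReal.ofReal |(L x).det| * (ENNReal.ofReal (exp 1) * M * h (Θ x)) :=
      setLIntegral_mono' hSm hpt
    _ = ∫⁻ y in Θ '' S, ENNReal.ofReal (exp 1) * M * h y :=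
      (lintegral_image_eq_lintegral_abs_det_fderiv_mul volume hSm hΘL
        (injOn_rankOne_perturbation ht hU)
        fun y => ENNReal.ofReal (exp 1) * M * h y).symm
    _ ≤ ∫⁻ y, ENNReal.ofReal (exp 1) * M * h y := setLIntegral_le_lintegral _ _
    _ = _ := by
      rw [lintegral_const_mul _ hhm, lintegral_mul_gaussian_orthogonal ht hW]
      ring

/-- The one-dimensional geometric Brascamp–Lieb inequality on the hyperplane sections orthogonal
to `t`, tested against a function `W` of the coordinate along `t`. -/
lemma lintegral_mul_prod_rpow_le_real {ι : Type*} [Fintype ι] {t : ι → ℝ}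
    (ht : ∑ j, t j ^ 2 = 1) (hlt : ∀ j, t j ^ 2 < 1) {W : ℝ → ℝ≥0∞} (hW : Measurable W)
    {f : ι → ℝ → ℝ≥0∞} (hf : ∀ j, Measurable (f j)) :
    ∫⁻ x : ι → ℝ, W (∑ j, t j * x j) * ∏ j, f j (x j) ^ (1 - t j ^ 2) ≤
      ENNReal.ofReal (exp 1) * (∫⁻ r, W r) * ∏ j, (∫⁻ r, f j r) ^ (1 - t j ^ 2) := by
  classical
  have hc : ∀ j, 0 < 1 - t j ^ 2 := fun j => sub_pos.2 (hlt j)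
  by_cases h0 : ∃ j, ∫⁻ x, f j x = 0
  · obtain ⟨j, hj⟩ := h0
    rw [lintegral_eq_zero_iff (hf j)] at hj
    refine le_of_eq_of_le ?_ zero_le
    rw [← lintegral_zero (μ := (volume : Measure (ι → ℝ)))]
    refine lintegral_congr_ae ?_
    filter_upwards [(Measure.quasiMeasurePreserving_eval
      (fun _ : ι => (volume : Measure ℝ)) j).ae hj] with x hx
    rw [Finset.prod_eq_zero (Finset.mem_univ j), mul_zero]
    rw [show f j (x j) = 0 from hx, ENNReal.zero_rpow_of_pos (hc j)]
  push Not at h0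
  by_cases htop : ∀ j, ∫⁻ x, f j x ≠ ∞
  · exact lintegral_mul_prod_rpow_le_of_ne_top ht hlt hW hf h0 htop
  push Not at htop
  obtain ⟨j, hj⟩ := htop
  have hM : ∏ j, (∫⁻ r, f j r) ^ (1 - t j ^ 2) = ∞ := by
    rw [← Finset.mul_prod_erase _ _ (Finset.mem_univ j), hj, ENNReal.top_rpow_of_pos (hc j)]
    refine ENNReal.top_mul (Finset.prod_ne_zero_iff.2 fun i _ => ?_)
    rw [Ne, ENNReal.rpow_eq_zero_iff_of_pos (hc i)]
    exact h0 i
  by_cases hW0 : ∫⁻ r, W r = 0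
  · rw [lintegral_eq_zero_iff hW] at hW0
    refine le_of_eq_of_le ?_ zero_le
    rw [← lintegral_zero (μ := (volume : Measure (ι → ℝ)))]
    refine lintegral_congr_ae ?_
    set ℓ : (ι → ℝ) →ₗ[ℝ] ℝ := Fintype.linearCombination ℝ t with hℓ
    have hℓx : ∀ x, ℓ x = ∑ j, t j * x j := fun x => by
      simp [hℓ, Fintype.linearCombination_apply, mul_comm]
    have hsurj : Function.Surjective ℓ := fun r => ⟨r • t, by
      rw [map_smul, hℓx, smul_eq_mul]
      simp [← sq, ht]⟩
    obtain ⟨c, -, hmap⟩ := ℓ.exists_map_addHaar_eq_smul_addHaar volume volume hsurj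
    have hae : ∀ᵐ r ∂((volume : Measure (ι → ℝ)).map ℓ), W r = 0 := by
      rw [hmap]
      exact Measure.ae_smul_measure hW0 c
    filter_upwards [ae_of_ae_map ℓ.continuous_of_finiteDimensional.aemeasurable hae] with x hx
    rw [← hℓx, hx, zero_mul]
  · rw [hM, ENNReal.mul_top]
    · exact le_top
    · exact mul_ne_zero (ENNReal.ofReal_pos.2 (exp_pos 1)).ne' hW0

/-- The Brascamp–Lieb type inequality with constant `A` on the space `E`, for the linear map
`x ↦ ∑ j, t j • x j` together with the coordinate maps. -/
def HasBrascampLieb {ι : Type*} [Fintype ι] (t : ι → ℝ) (E : Type*) [AddCommGroup E] [Module ℝ E]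
    [MeasureSpace E] (A : ℝ≥0∞) : Prop :=
  ∀ (W : E → ℝ≥0∞) (f : ι → E → ℝ≥0∞), Measurable W → (∀ j, Measurable (f j)) →
    ∫⁻ x : ι → E, W (∑ j, t j • x j) * ∏ j, f j (x j) ^ (1 - t j ^ 2) ≤
      A * (∫⁻ r, W r) * ∏ j, (∫⁻ r, f j r) ^ (1 - t j ^ 2)

namespace HasBrascampLieb

variable {ι : Type*} [Fintype ι] {t : ι → ℝ} {E F : Type*} [AddCommGroup E] [Module ℝ E]
  [MeasureSpace E] [AddCommGroup F] [Module ℝ F] [MeasureSpace F] {A B : ℝ≥0∞}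

lemma prod [MeasurableAdd₂ E] [MeasurableConstSMul ℝ E] [MeasurableAdd₂ F]
    [MeasurableConstSMul ℝ F] [SigmaFinite (volume : Measure E)] [SigmaFinite (volume : Measure F)]
    (hE : HasBrascampLieb t E A) (hF : HasBrascampLieb t F B) :
    HasBrascampLieb t (E × F) (A * B) := by
  intro W f hW hf
  have hsum : ∀ (x : ι → E) (y : ι → F),
      ∑ j, t j • (x j, y j) = (∑ j, t j • x j, ∑ j, t j • y j) := fun x y => by
    ext <;> simp [Prod.fst_sum, Prod.snd_sum]
  calc
    _ = ∫⁻ p : (ι → E) × (ι → F), W (∑ j, t j • (p.1 j, p.2 j)) *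
        ∏ j, f j (p.1 j, p.2 j) ^ (1 - t j ^ 2) :=
      ((volume_measurePreserving_arrowProdEquivProdArrow E F ι).symm.lintegral_map_equiv _ _)
    _ = ∫⁻ x : ι → E, ∫⁻ y : ι → F, W (∑ j, t j • x j, ∑ j, t j • y j) *
        ∏ j, f j (x j, y j) ^ (1 - t j ^ 2) := by
      simp only [hsum]
      exact lintegral_prod _ (by fun_prop)
    _ ≤ ∫⁻ x : ι → E, B * (∫⁻ v, W (∑ j, t j • x j, v)) *
        ∏ j, (∫⁻ v, f j (x j, v)) ^ (1 - t j ^ 2) :=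
      lintegral_mono fun x => hF (fun v => W (∑ j, t j • x j, v)) (fun j v => f j (x j, v))
        (by fun_prop) (by fun_prop)
    _ = B * ∫⁻ x : ι → E, (∫⁻ v, W (∑ j, t j • x j, v)) *
        ∏ j, (∫⁻ v, f j (x j, v)) ^ (1 - t j ^ 2) := by
      simp only [mul_assoc]
      have hW' : Measurable fun u => ∫⁻ v, W (u, v) := hW.lintegral_prod_right'
      have hf' : ∀ j, Measurable fun u => ∫⁻ v, f j (u, v) := fun j =>
        (hf j).lintegral_prod_right'
      refine lintegral_const_mul _ (Measurable.mul (hW'.comp (by fun_prop)) ?_)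
      exact Finset.measurable_prod _ fun j _ =>
        ((hf' j).comp (measurable_pi_apply j)).pow_const _
    _ ≤ B * (A * (∫⁻ u, ∫⁻ v, W (u, v)) * ∏ j, (∫⁻ u, ∫⁻ v, f j (u, v)) ^ (1 - t j ^ 2)) := by
      gcongr
      exact hE (fun u => ∫⁻ v, W (u, v)) (fun j u => ∫⁻ v, f j (u, v)) hW.lintegral_prod_right'
        fun j => (hf j).lintegral_prod_right'
    _ = _ := by
      simp only [Measure.volume_eq_prod]
      rw [lintegral_prod _ hW.aemeasurable]
      simp only [lintegral_prod _ (hf _).aemeasurable]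
      ring

lemma of_measurePreserving [MeasurableAdd₂ E] [MeasurableConstSMul ℝ E]
    [SigmaFinite (volume : Measure E)] (hF : HasBrascampLieb t F A) (e : F →ₗ[ℝ] E)
    (he : MeasurePreserving e) : HasBrascampLieb t E A := by
  intro W f hW hf
  have h := hF (W ∘ e) (fun j => f j ∘ e) (hW.comp he.measurable)
    fun j => (hf j).comp he.measurable
  have h1 : ∫⁻ x : ι → E, W (∑ j, t j • x j) * ∏ j, f j (x j) ^ (1 - t j ^ 2) =
      ∫⁻ y : ι → F, W (∑ j, t j • e (y j)) * ∏ j, f j (e (y j)) ^ (1 - t j ^ 2) :=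
    ((volume_preserving_pi fun _ : ι => he).lintegral_comp (by fun_prop)).symm
  rw [h1]
  simpa only [Function.comp_apply, map_sum, map_smul, he.lintegral_comp hW,
    he.lintegral_comp (hf _)] using h

lemma of_unique [Unique E] [IsProbabilityMeasure (volume : Measure E)] :
    HasBrascampLieb t E 1 := by
  intro W f _ _
  rw [volume_pi]
  simp only [lintegral_unique, measure_univ, mul_one, one_mul]
  exact le_of_eq (congrArg₂ _ (congrArg _ (Subsingleton.elim _ _)) rfl)

lemma pi_fin (ht : ∑ j, t j ^ 2 = 1) (hlt : ∀ j, t j ^ 2 < 1) (n : ℕ) :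
    HasBrascampLieb t (Fin n → ℝ) (ENNReal.ofReal (exp 1) ^ n) := by
  induction n with
  | zero =>
    have : IsProbabilityMeasure (volume : Measure (Fin 0 → ℝ)) := ⟨by simp [volume_pi]⟩
    rw [pow_zero]
    exact of_unique
  | succ n ih =>
    rw [pow_succ']
    have h1 : HasBrascampLieb t ℝ (ENNReal.ofReal (exp 1)) := fun W f hW hf =>
      lintegral_mul_prod_rpow_le_real ht hlt hW hf
    have he : ⇑(MeasurableEquiv.piFinSuccAbove (fun _ : Fin (n + 1) => ℝ) 0).symm =
        ⇑(Fin.consLinearEquiv ℝ fun _ : Fin (n + 1) => ℝ).toLinearMap := by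
      funext p
      exact Fin.insertNth_zero' p.1 p.2
    exact (h1.prod ih).of_measurePreserving _
      (he ▸ (volume_preserving_piFinSuccAbove (fun _ : Fin (n + 1) => ℝ) 0).symm)

lemma euclideanSpace (ht : ∑ j, t j ^ 2 = 1) (hlt : ∀ j, t j ^ 2 < 1) (n : ℕ) :
    HasBrascampLieb t (EuclideanSpace ℝ (Fin n)) (ENNReal.ofReal (exp 1) ^ n) :=
  (pi_fin ht hlt n).of_measurePreserving
    (WithLp.linearEquiv 2 ℝ (Fin n → ℝ)).symm.toLinearMap (PiLp.volume_preserving_toLp (Fin n))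

end HasBrascampLieb

lemma setLIntegral_univ_pi_le {ι : Type*} [Fintype ι] {t : ι → ℝ} (ht : ∑ j, t j ^ 2 = 1) {n : ℕ}
    {C : ι → Set (EuclideanSpace ℝ (Fin n))} (hC : ∀ j, MeasurableSet (C j))
    (hvol : ∀ j, volume (C j) = 1) {W : EuclideanSpace ℝ (Fin n) → ℝ≥0∞} (hW : Measurable W) :
    ∫⁻ x in Set.univ.pi C, W (∑ j, t j • x j) ≤ ENNReal.ofReal (exp 1) ^ n * ∫⁻ v, W v := by
  classical
  by_cases hlt : ∀ j, t j ^ 2 < 1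
  · have h := HasBrascampLieb.euclideanSpace ht hlt n W (fun j => (C j).indicator 1) hW
      fun j => measurable_one.indicator (hC j)
    simp only [lintegral_indicator_one (hC _), hvol, ENNReal.one_rpow, Finset.prod_const_one,
      mul_one] at h
    rw [← lintegral_indicator (MeasurableSet.univ_pi hC)]
    refine le_of_eq_of_le (lintegral_congr fun x => ?_) h
    by_cases hx : x ∈ Set.univ.pi C
    · rw [Set.indicator_of_mem hx, Finset.prod_eq_one, mul_one]
      intro j _
      rw [Set.indicator_of_mem (hx j trivial), Pi.one_apply, ENNReal.one_rpow]
    · rw [Set.indicator_of_notMem hx]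
      obtain ⟨j, hj⟩ : ∃ j, x j ∉ C j := by
        by_contra hcon
        push Not at hcon
        exact hx fun j _ => hcon j
      rw [Finset.prod_eq_zero (Finset.mem_univ j), mul_zero]
      rw [Set.indicator_of_notMem hj, ENNReal.zero_rpow_of_pos (sub_pos.2 (hlt j))]
  · push Not at hlt
    obtain ⟨k, hk⟩ := hlt
    rw [← Finset.add_sum_erase _ _ (Finset.mem_univ k)] at ht
    have hnn : ∀ j ∈ Finset.univ.erase k, 0 ≤ t j ^ 2 := fun j _ => sq_nonneg _
    have h0 := (Finset.sum_eq_zero_iff_of_nonneg hnn).1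
      (le_antisymm (by linarith) (Finset.sum_nonneg hnn))
    have hk1 : t k = 1 ∨ t k = -1 := sq_eq_one_iff.1 (by
      linarith [Finset.sum_nonneg hnn])
    have hsum : ∀ x : ι → EuclideanSpace ℝ (Fin n), ∑ j, t j • x j = t k • x k := fun x =>
      Finset.sum_eq_single k (fun j hj hjk => by
        rw [pow_eq_zero_iff two_ne_zero |>.1 (h0 j (Finset.mem_erase.2 ⟨hjk, Finset.mem_univ j⟩)),
          zero_smul]) (fun h => absurd (Finset.mem_univ k) h)
    have hprob : ∀ j, IsProbabilityMeasure (volume.restrict (C j)) := fun j =>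
      ⟨by rw [Measure.restrict_apply_univ, hvol]⟩
    simp only [hsum]
    calc
      _ = ∫⁻ v in C k, W (t k • v) := by
        rw [volume_pi, Measure.restrict_pi_pi]
        exact (measurePreserving_eval (fun j => volume.restrict (C j)) k).lintegral_comp
          (f := fun v => W (t k • v)) (by fun_prop)
      _ ≤ ∫⁻ v, W (t k • v) := setLIntegral_le_lintegral _ _
      _ = ∫⁻ v, W v := by
        rcases hk1 with h | h <;> rw [h]
        · simp only [one_smul]
        · simp only [neg_smul, one_smul]
          exact lintegral_neg_eq_self (μ := volume) W
      _ ≤ _ := le_mul_of_one_le_left zero_le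
        (one_le_pow₀ (ENNReal.one_le_ofReal.2 (one_le_exp zero_le_one)))

namespace IsSymmConvexBody

variable {n : ℕ} {K : Set (EuclideanSpace ℝ (Fin n))}

lemma mem_nhds_zero (hK : IsSymmConvexBody K) : K ∈ nhds 0 := by
  obtain ⟨hc, -, ⟨x, hx⟩, hs⟩ := hK
  rw [mem_nhds_iff]
  refine ⟨interior K, interior_subset, isOpen_interior, ?_⟩
  have hx' : -x ∈ interior K := by
    have : interior K = -interior K := by
      conv_lhs => rw [hs]
      exact ((Homeomorph.neg _).preimage_interior K).symm
    rw [this]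
    simpa using hx
  simpa using hc.interior.midpoint_mem hx hx'

open Pointwise in
lemma setOf_gauge_lt_subset (hK : IsSymmConvexBody K) {r : ℝ} (hr : 0 < r) :
    {x | gauge K x < r} ⊆ r • K := by
  intro x hx
  rw [Set.mem_smul_set_iff_inv_smul_mem₀ hr.ne']
  refine setOfPred_gauge_lt_one_subset_self hK.1 (mem_of_mem_nhds hK.mem_nhds_zero)
    (absorbent_nhds_zero hK.mem_nhds_zero) ?_
  have : gauge K (r⁻¹ • x) = r⁻¹ * gauge K x := gauge_smul_of_nonneg (inv_pos.2 hr).le x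
  change gauge K (r⁻¹ • x) < 1
  rw [this, inv_mul_lt_one₀ hr]
  exact hx

lemma lintegral_sub_gauge_le (hK : IsSymmConvexBody K) {r : ℝ} (hr : 0 < r) :
    ∫⁻ x, ENNReal.ofReal (r - gauge K x) ≤
      volume K * ENNReal.ofReal (r ^ (n + 1) / (n + 1)) := by
  have hg : Continuous (gauge K) := continuous_gauge hK.1 hK.mem_nhds_zero
  have hmax : ∀ x, ENNReal.ofReal (r - gauge K x) = ENNReal.ofReal (max (r - gauge K x) 0) :=
    fun x => by simp
  simp only [hmax]
  rw [lintegral_eq_lintegral_meas_lt (f := fun x => max (r - gauge K x) 0) _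
    (ae_of_all _ fun _ => le_max_right _ _)
    (by fun_prop)]
  calc
    _ ≤ ∫⁻ s in Set.Ioi 0, (Set.Ioc 0 r).indicator
        (fun s => volume K * ENNReal.ofReal ((r - s) ^ n)) s := by
      refine setLIntegral_mono' measurableSet_Ioi fun s hs => ?_
      have hset : {x | s < max (r - gauge K x) 0} ⊆ {x | gauge K x < r - s} := fun x hx => by
        rcases lt_max_iff.1 (show s < max (r - gauge K x) 0 from hx) with h | h
        · exact lt_sub_comm.1 h
        · exact absurd h (not_lt.2 (le_of_lt hs))
      refine (measure_mono hset).trans ?_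
      by_cases hsr : s < r
      · have hsm : s ∈ Set.Ioc 0 r := ⟨hs, hsr.le⟩
        rw [Set.indicator_of_mem hsm]
        refine (measure_mono (hK.setOf_gauge_lt_subset (sub_pos.2 hsr))).trans ?_
        rw [Measure.addHaar_smul, finrank_euclideanSpace_fin,
          abs_of_nonneg (pow_nonneg (sub_pos.2 hsr).le _), mul_comm]
      · have : {x | gauge K x < r - s} = ∅ := Set.eq_empty_of_forall_notMem fun x hx =>
          absurd (gauge_nonneg x) (not_le.2 (lt_of_lt_of_le hx (by linarith)))
        rw [this, measure_empty]
        exact zero_le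
    _ ≤ ∫⁻ s in Set.Ioc 0 r, volume K * ENNReal.ofReal ((r - s) ^ n) := by
      rw [← lintegral_indicator measurableSet_Ioc]
      exact setLIntegral_le_lintegral _ _
    _ = _ := by
      rw [lintegral_const_mul _ (by fun_prop), ← ofReal_integral_eq_lintegral_ofReal,
        ← intervalIntegral.integral_of_le hr.le,
        intervalIntegral.integral_comp_sub_left (fun s => s ^ n), integral_pow]
      · simp
      · exact (Continuous.integrableOn_Icc (by fun_prop)).mono_set Set.Ioc_subset_Icc_self
      · exact (ae_restrict_mem measurableSet_Ioc).mono fun s hs =>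
          pow_nonneg (sub_nonneg.2 hs.2) n

end IsSymmConvexBody

lemma integral_le_toReal_lintegral_ofReal {α : Type*} [MeasurableSpace α] {μ : Measure α}
    {f : α → ℝ} (hf : Integrable f μ) : ∫ x, f x ∂μ ≤ (∫⁻ x, ENNReal.ofReal (f x) ∂μ).toReal := by
  rw [integral_eq_lintegral_pos_part_sub_lintegral_neg_part hf]
  exact sub_le_self _ ENNReal.toReal_nonneg

lemma le_multiNorm_of_sum_sq_eq_one {n s : ℕ} (hn : n ≠ 0)
    {C : Fin s → Set (EuclideanSpace ℝ (Fin n))} (hC : ∀ j, IsSymmConvexBody (C j))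
    (hCvol : ∀ j, volume (C j) = 1) {K : Set (EuclideanSpace ℝ (Fin n))}
    (hK : IsSymmConvexBody K) {t : Fin s → ℝ} (ht : ∑ j, t j ^ 2 = 1) :
    (n / (Real.exp 1 * (n + 1))) * (volume K).toReal ^ (-(1 : ℝ) / n) ≤ multiNorm C K t := by
  have hg : Continuous (gauge K) := continuous_gauge hK.1 hK.mem_nhds_zero
  have hKtop : volume K ≠ ∞ := hK.2.1.measure_lt_top.ne
  have hKpos : 0 < (volume K).toReal :=
    ENNReal.toReal_pos (Measure.measure_pos_of_mem_nhds _ hK.mem_nhds_zero).ne' hKtop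
  have hn' : (0 : ℝ) < n := by positivity
  set r := (exp 1)⁻¹ * (volume K).toReal ^ (-(1 : ℝ) / n) with hr
  have hr0 : 0 < r := by positivity
  have hrn : exp 1 ^ n * (volume K).toReal * r ^ n = 1 := by
    rw [hr, mul_pow, ← rpow_mul_natCast hKpos.le, div_mul_cancel₀ _ hn'.ne', rpow_neg_one, inv_pow]
    field_simp
  have hCm : ∀ j, MeasurableSet (C j) := fun j => (hC j).2.1.measurableSet
  have hprob : volume.real (Set.univ.pi C) = 1 := by
    rw [measureReal_def, volume_pi_pi]
    simp [hCvol]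
  have hintegral : IntegrableOn (fun x : Fin s → EuclideanSpace ℝ (Fin n) => gauge K (∑ j, t j • x j))
      (Set.univ.pi C) := ContinuousOn.integrableOn_compact
    (isCompact_univ_pi fun j => (hC j).2.1) (by fun_prop)
  have hconst : IntegrableOn (fun _ : Fin s → EuclideanSpace ℝ (Fin n) => r)
      (Set.univ.pi C) := ContinuousOn.integrableOn_compact
    (isCompact_univ_pi fun j => (hC j).2.1) (by fun_prop)
  have hlin : ∫⁻ x in Set.univ.pi C, ENNReal.ofReal (r - gauge K (∑ j, t j • x j)) ≤
      ENNReal.ofReal (r / (n + 1)) := by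
    refine (setLIntegral_univ_pi_le ht hCm hCvol (W := fun v => ENNReal.ofReal (r - gauge K v))
      (by fun_prop)).trans ?_
    refine (mul_le_mul_right (hK.lintegral_sub_gauge_le hr0) _).trans (le_of_eq ?_)
    rw [← ENNReal.ofReal_toReal hKtop, ← ENNReal.ofReal_pow (exp_pos 1).le,
      ← ENNReal.ofReal_mul hKpos.le, ← ENNReal.ofReal_mul (by positivity)]
    congr 1
    calc _ = (exp 1 ^ n * (volume K).toReal * r ^ n) * (r / (n + 1)) := by ring
      _ = _ := by rw [hrn, one_mul]
  have hle : r - multiNorm C K t ≤ r / (n + 1) := by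
    calc
      _ = ∫ x in Set.univ.pi C, (r - gauge K (∑ j, t j • x j)) := by
        rw [integral_sub hconst hintegral, setIntegral_const, hprob, one_smul]
        rfl
      _ ≤ (∫⁻ x in Set.univ.pi C, ENNReal.ofReal (r - gauge K (∑ j, t j • x j))).toReal :=
        integral_le_toReal_lintegral_ofReal (hconst.sub hintegral)
      _ ≤ _ := ENNReal.toReal_le_of_le_ofReal (by positivity) hlin
  have : (n / (Real.exp 1 * (n + 1))) * (volume K).toReal ^ (-(1 : ℝ) / n) = r - r / (n + 1) := by
    rw [hr]
    field_simp
    ring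
  linarith

lemma multiNorm_smul {n s : ℕ} (C : Fin s → Set (EuclideanSpace ℝ (Fin n)))
    (K : Set (EuclideanSpace ℝ (Fin n))) {c : ℝ} (hc : 0 ≤ c) (t : Fin s → ℝ) :
    multiNorm C K (c • t) = c * multiNorm C K t := by
  unfold multiNorm
  rw [← integral_const_mul]
  refine integral_congr_ae (ae_of_all _ fun x => ?_)
  simp only [Pi.smul_apply, smul_assoc, ← Finset.smul_sum]
  exact gauge_smul_of_nonneg hc _

lemma multiNorm_nonneg {n s : ℕ} (C : Fin s → Set (EuclideanSpace ℝ (Fin n)))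
    (K : Set (EuclideanSpace ℝ (Fin n))) (t : Fin s → ℝ) : 0 ≤ multiNorm C K t :=
  integral_nonneg fun _ => gauge_nonneg _

/-- for centrally symmetric convex bodies `C₁,…,C_s` of volume 1 and a
centrally symmetric convex body `K` in `ℝⁿ`, for every `s ≥ 1` and `t ∈ ℝˢ`,
`∫_{C₁}⋯∫_{C_s} ‖∑ t_j x_j‖_K ≥ (n/(e(n+1))) · vol(K)^{-1/n} · ‖t‖₂`. -/
theorem stmt0 {n s : ℕ} (hs : 1 ≤ s)
    (C : Fin s → Set (EuclideanSpace ℝ (Fin n)))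
    (hC : ∀ j, IsSymmConvexBody (C j)) (hCvol : ∀ j, volume (C j) = 1)
    (K : Set (EuclideanSpace ℝ (Fin n))) (hK : IsSymmConvexBody K)
    (t : Fin s → ℝ) :
    (n / (Real.exp 1 * (n + 1))) * (volume K).toReal ^ (-(1 : ℝ) / n) * euclNorm t
      ≤ multiNorm C K t := by
  rcases eq_or_ne n 0 with rfl | hn
  · simpa using multiNorm_nonneg C K t
  rcases (show 0 ≤ euclNorm t from sqrt_nonneg _).eq_or_lt with h0 | hpos
  · rw [← h0, mul_zero]
    exact multiNorm_nonneg C K t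
  have hsq : ∑ j, t j ^ 2 = euclNorm t ^ 2 :=
    (sq_sqrt (Finset.sum_nonneg fun _ _ => sq_nonneg _)).symm
  have hu : ∑ j, ((euclNorm t)⁻¹ • t) j ^ 2 = 1 := by
    simp only [Pi.smul_apply, smul_eq_mul, mul_pow, ← Finset.mul_sum, hsq]
    field_simp
  calc _ ≤ multiNorm C K ((euclNorm t)⁻¹ • t) * euclNorm t :=
        mul_le_mul_of_nonneg_right (le_multiNorm_of_sum_sq_eq_one hn hC hCvol hK hu) hpos.le
    _ = multiNorm C K t := by
        rw [mul_comm, ← multiNorm_smul C K hpos.le, smul_inv_smul₀ hpos.ne']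
end
end

section
/- Let C₁,…,C_s be convex bodies of volume 1 in ℝⁿ and K a centrally symmetric convex body in ℝⁿ. There is an absolute constant c > 0 such that for every q ≥ 1 and every t ∈ ℝˢ, ( ∫_{C₁}⋯∫_{C_s} ‖∑_{j=1}^s t_j x_j‖_K^q dx₁⋯dx_s )^{1/q} ≤ c q · ∫_{C₁}⋯∫_{C_s} ‖∑_{j=1}^s t_j x_j‖_K dx₁⋯dx_s. -/
open MeasureTheory Real
open scoped ENNReal RealInnerProductSpace

noncomputable section

/-- A convex body: compact, convex, with non-empty interior. -/
def IsConvexBody {n : ℕ} (C : Set (EuclideanSpace ℝ (Fin n))) : Prop :=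
  Convex ℝ C ∧ IsCompact C ∧ (interior C).Nonempty

open scoped Pointwise in
theorem Real.volume_add_volume_le_of_isCompact {A B C : Set ℝ} (hA : IsCompact A) (hB : IsCompact B)
    (hA' : A.Nonempty) (hB' : B.Nonempty)
    (h : ∀ x ∈ A, ∀ y ∈ B, (2⁻¹ : ℝ) • (x + y) ∈ C) :
    volume A + volume B ≤ 2 * volume C := by
  have hα := hA.sSup_mem hA'
  have hβ := hB.sInf_mem hB'
  set α := sSup A
  set β := sInf B
  have hsub : ((fun x => x + β) '' A) ∪ ((fun y => α + y) '' B) ⊆ (2 : ℝ) • C := by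
    rintro _ (⟨x, hx, rfl⟩ | ⟨y, hy, rfl⟩)
    · exact ⟨_, h x hx β hβ, by simp⟩
    · exact ⟨_, h α hα y hy, by simp⟩
  have hdisj : AEDisjoint volume ((fun x => x + β) '' A) ((fun y => α + y) '' B) := by
    refine measure_mono_null (t := {α + β}) ?_ (by simp)
    rintro z ⟨⟨x, hx, rfl⟩, ⟨y, hy, hxy⟩⟩
    have h1 : x ≤ α := le_csSup hA.bddAbove hx
    have h2 : β ≤ y := csInf_le hB.bddBelow hy
    simp only [Set.mem_singleton_iff] at hxy ⊢
    linarith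
  have hBm : MeasurableSet ((fun y => α + y) '' B) :=
    (hB.image (by fun_prop)).isClosed.measurableSet
  calc volume A + volume B
      = volume (((fun x => x + β) '' A) ∪ ((fun y => α + y) '' B)) := by
        rw [measure_union₀ hBm.nullMeasurableSet hdisj]
        simp
    _ ≤ volume ((2 : ℝ) • C) := measure_mono hsub
    _ = 2 * volume C := by simp [Measure.addHaar_smul]

theorem Real.volume_add_volume_le {A B C : Set ℝ} (hA : MeasurableSet A) (hB : MeasurableSet B)
    (hA' : A.Nonempty) (hB' : B.Nonempty)
    (h : ∀ x ∈ A, ∀ y ∈ B, (2⁻¹ : ℝ) • (x + y) ∈ C) :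
    volume A + volume B ≤ 2 * volume C := by
  obtain ⟨a, ha⟩ := hA'
  obtain ⟨b, hb⟩ := hB'
  rw [hA.measure_eq_iSup_isCompact, hB.measure_eq_iSup_isCompact]
  simp only [iSup_and']
  refine ENNReal.biSup_add_biSup_le' ⟨∅, by simp⟩ ⟨∅, by simp⟩ fun K hK L hL => ?_
  calc volume K + volume L ≤ volume (insert a K) + volume (insert b L) := by
        gcongr <;> exact Set.subset_insert _ _
    _ ≤ 2 * volume C := Real.volume_add_volume_le_of_isCompact (hK.2.insert a) (hL.2.insert b)
        (Set.insert_nonempty _ _) (Set.insert_nonempty _ _) fun x hx y hy =>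
          h x (Set.insert_subset ha hK.1 hx) y (Set.insert_subset hb hL.1 hy)

theorem ENNReal.four_mul_le_sq_add (a b : ℝ≥0∞) : 4 * (a * b) ≤ (a + b) ^ 2 := by
  induction a with
  | top => simp
  | coe a =>
    induction b with
    | top => simp
    | coe b =>
      have := _root_.four_mul_le_sq_add a b
      rw [← mul_assoc]
      exact_mod_cast this

theorem ENNReal.lintegral_Ioo_volume_lt {u : ℝ → ℝ≥0∞} (hu : Measurable u) (hu1 : ∀ x, u x ≤ 1) :
    ∫⁻ x, u x = ∫⁻ r in Set.Ioo (0 : ℝ) 1, volume {x | ENNReal.ofReal r < u x} := by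
  have hfin : ∀ x, u x ≠ ∞ := fun x => ne_top_of_le_ne_top (by simp) (hu1 x)
  have hlt : ∀ r : ℝ, 0 < r → {x | r < (u x).toReal} = {x | ENNReal.ofReal r < u x} := by
    intro r hr
    ext x
    simp only [Set.mem_ofPred_eq]
    rw [ENNReal.ofReal_lt_iff_lt_toReal hr.le (hfin x)]
  have h := lintegral_eq_lintegral_meas_lt volume (f := fun x => (u x).toReal)
    (Filter.Eventually.of_forall fun x => ENNReal.toReal_nonneg) hu.ennreal_toReal.aemeasurable
  simp only [ENNReal.ofReal_toReal (hfin _)] at h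
  rw [h]
  have hI : Set.Ioi (0 : ℝ) = Set.Ioo 0 1 ∪ Set.Ici 1 := (Set.Ioo_union_Ici_eq_Ioi one_pos).symm
  rw [hI, lintegral_union measurableSet_Ici]
  · have h0 : ∫⁻ r in Set.Ici (1 : ℝ), volume {x | r < (u x).toReal} = 0 := by
      rw [setLIntegral_congr_fun (g := fun _ => 0) measurableSet_Ici, lintegral_zero]
      intro r hr
      have : {x | r < (u x).toReal} = ∅ := by
        ext x
        simp only [Set.mem_ofPred_eq, Set.mem_empty_iff_false, iff_false, not_lt]
        refine le_trans ?_ hr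
        exact ENNReal.toReal_le_of_le_ofReal zero_le_one (by simpa using hu1 x)
      simp [this]
    rw [h0, add_zero]
    exact setLIntegral_congr_fun measurableSet_Ioo fun r hr => by simp only [hlt r hr.1]
  · exact Set.disjoint_left.2 fun x hx hx' => absurd hx.2 (not_lt.2 hx')

/-- The midpoint form of the Prékopa–Leindler inequality for a measure `μ`. -/
def PrekopaLeindler {E : Type*} [AddCommGroup E] [Module ℝ E] [MeasurableSpace E]
    (μ : Measure E) : Prop :=
  ∀ f g h : E → ℝ≥0∞, Measurable f → Measurable g → Measurable h →
    (∀ x y, f x * g y ≤ h ((2⁻¹ : ℝ) • (x + y)) ^ 2) →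
    (∫⁻ x, f x ∂μ) * (∫⁻ x, g x ∂μ) ≤ (∫⁻ x, h x ∂μ) ^ 2

theorem lintegral_add_le_of_iSup_eq_one {f g h : ℝ → ℝ≥0∞} (hf : Measurable f) (hg : Measurable g)
    (hh : Measurable h) (hf1 : ⨆ x, f x = 1) (hg1 : ⨆ x, g x = 1)
    (hfgh : ∀ x y, min (f x) (g y) ≤ h ((2⁻¹ : ℝ) • (x + y))) :
    (∫⁻ x, f x) + (∫⁻ x, g x) ≤ 2 * ∫⁻ x, h x := by
  have key : (∫⁻ x, f x) + (∫⁻ x, g x) ≤ 2 * ∫⁻ x, min (h x) 1 := by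
    rw [ENNReal.lintegral_Ioo_volume_lt hf (fun x => hf1 ▸ le_iSup f x),
      ENNReal.lintegral_Ioo_volume_lt hg (fun x => hg1 ▸ le_iSup g x),
      ENNReal.lintegral_Ioo_volume_lt (hh.min measurable_const) (fun x => min_le_right _ _),
      ← lintegral_const_mul' _ _ (by simp), ← lintegral_add_left]
    · refine setLIntegral_mono' measurableSet_Ioo fun r hr => ?_
      have hr1 : ENNReal.ofReal r < 1 := by simpa using hr.2
      refine Real.volume_add_volume_le (measurableSet_lt measurable_const hf)
        (measurableSet_lt measurable_const hg) ?_ ?_ fun x hx y hy => ?_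
      · exact lt_iSup_iff.1 (hf1 ▸ hr1)
      · exact lt_iSup_iff.1 (hg1 ▸ hr1)
      · exact lt_min ((lt_min hx hy).trans_le (hfgh x y)) hr1
    · refine Antitone.measurable fun r s hrs => measure_mono fun x hx => ?_
      exact (ENNReal.ofReal_le_ofReal hrs).trans_lt hx
  refine key.trans ?_
  gcongr
  exact min_le_left _ _

theorem prekopaLeindler_volume_of_bounded {f g h : ℝ → ℝ≥0∞} (hf : Measurable f) (hg : Measurable g)
    (hh : Measurable h) (hf' : ⨆ x, f x ≠ ∞) (hg' : ⨆ x, g x ≠ ∞)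
    (hfgh : ∀ x y, f x * g y ≤ h ((2⁻¹ : ℝ) • (x + y)) ^ 2) :
    (∫⁻ x, f x) * (∫⁻ x, g x) ≤ (∫⁻ x, h x) ^ 2 := by
  set a := ⨆ x, f x with ha
  set b := ⨆ x, g x with hb
  by_cases ha0 : a = 0
  · simp [ENNReal.iSup_eq_zero.1 (ha.symm.trans ha0)]
  by_cases hb0 : b = 0
  · simp [ENNReal.iSup_eq_zero.1 (hb.symm.trans hb0)]
  obtain ⟨c, hc⟩ : ∃ c : ℝ≥0∞, c ^ 2 = a * b :=
    ⟨(a * b) ^ (2⁻¹ : ℝ), by rw [← ENNReal.rpow_natCast, ← ENNReal.rpow_mul]; simp⟩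
  have hinv : (c⁻¹) ^ 2 = a⁻¹ * b⁻¹ := by
    rw [← ENNReal.inv_pow, hc, ENNReal.mul_inv (Or.inl ha0) (Or.inl hf')]
  have hab0 : a⁻¹ * b⁻¹ ≠ 0 := by simp [hf', hg']
  have habt : a⁻¹ * b⁻¹ ≠ ∞ := ENNReal.mul_ne_top (by simpa) (by simpa)
  have hct : c⁻¹ ≠ ∞ := by
    intro h
    rw [h] at hinv
    exact habt (by simpa using hinv.symm)
  have main := lintegral_add_le_of_iSup_eq_one (hf.const_mul a⁻¹) (hg.const_mul b⁻¹)
    (hh.const_mul c⁻¹) (by rw [← ENNReal.mul_iSup, ENNReal.inv_mul_cancel ha0 hf'])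
    (by rw [← ENNReal.mul_iSup, ENNReal.inv_mul_cancel hb0 hg']) fun x y => by
      refine (ENNReal.pow_le_pow_left_iff two_ne_zero).1 ?_
      calc min (a⁻¹ * f x) (b⁻¹ * g y) ^ 2
          ≤ (a⁻¹ * f x) * (b⁻¹ * g y) := by
            rw [sq]
            exact mul_le_mul' (min_le_left _ _) (min_le_right _ _)
        _ = (a⁻¹ * b⁻¹) * (f x * g y) := by ring
        _ ≤ (a⁻¹ * b⁻¹) * h ((2⁻¹ : ℝ) • (x + y)) ^ 2 := by gcongr; exact hfgh x y
        _ = (c⁻¹ * h ((2⁻¹ : ℝ) • (x + y))) ^ 2 := by rw [mul_pow, hinv]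
  rw [lintegral_const_mul _ hf, lintegral_const_mul _ hg, lintegral_const_mul _ hh] at main
  have h4 := (ENNReal.four_mul_le_sq_add _ _).trans (pow_le_pow_left' main 2)
  have h5 : (4 * (a⁻¹ * b⁻¹)) * ((∫⁻ x, f x) * (∫⁻ x, g x))
      ≤ (4 * (a⁻¹ * b⁻¹)) * (∫⁻ x, h x) ^ 2 := by
    calc _ = 4 * ((a⁻¹ * ∫⁻ x, f x) * (b⁻¹ * ∫⁻ x, g x)) := by ring
      _ ≤ _ := h4
      _ = 4 * (c⁻¹ ^ 2) * (∫⁻ x, h x) ^ 2 := by ring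
      _ = _ := by rw [hinv]
  exact (ENNReal.mul_le_mul_iff_right (mul_ne_zero (by simp) hab0)
    (ENNReal.mul_ne_top (by simp) habt)).1 h5

theorem lintegral_mul_le_of_forall_min {E : Type*} [MeasurableSpace E] {μ : Measure E}
    {f : E → ℝ≥0∞} (hf : Measurable f) {c d : ℝ≥0∞}
    (h : ∀ n : ℕ, (∫⁻ x, min (f x) n ∂μ) * c ≤ d) : (∫⁻ x, f x ∂μ) * c ≤ d := by
  have hsup : ∀ x, f x = ⨆ n : ℕ, min (f x) n := fun x => by
    rw [← inf_iSup_eq, ENNReal.iSup_natCast, inf_top_eq]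
  rw [lintegral_congr hsup, lintegral_iSup (fun n => hf.min measurable_const), ENNReal.iSup_mul]
  · exact iSup_le h
  · intro m n hmn x
    exact min_le_min_left _ (by exact_mod_cast hmn)

theorem prekopaLeindler_volume_real : PrekopaLeindler (volume : Measure ℝ) := by
  intro f g h hf hg hh hfgh
  have hbdd : ∀ (u : ℝ → ℝ≥0∞) (n : ℕ), ⨆ x, min (u x) n ≠ ∞ := fun u n =>
    ne_top_of_le_ne_top (ENNReal.natCast_ne_top n) (iSup_le fun x => min_le_right _ _)
  refine lintegral_mul_le_of_forall_min hf fun m => ?_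
  rw [mul_comm]
  refine lintegral_mul_le_of_forall_min hg fun n => ?_
  rw [mul_comm]
  exact prekopaLeindler_volume_of_bounded (hf.min measurable_const) (hg.min measurable_const) hh
    (hbdd f m) (hbdd g n)
    fun x y => (mul_le_mul' (min_le_left _ _) (min_le_left _ _)).trans (hfgh x y)

section
variable {E F : Type*} [AddCommGroup E] [Module ℝ E] [MeasurableSpace E]
  [AddCommGroup F] [Module ℝ F] [MeasurableSpace F]

theorem PrekopaLeindler.prod {μ : Measure E} {ν : Measure F} [SFinite ν]
    (hμ : PrekopaLeindler μ) (hν : PrekopaLeindler ν) : PrekopaLeindler (μ.prod ν) := by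
  intro f g h hf hg hh hfgh
  rw [lintegral_prod _ hf.aemeasurable, lintegral_prod _ hg.aemeasurable,
    lintegral_prod _ hh.aemeasurable]
  exact hμ _ _ _ hf.lintegral_prod_right' hg.lintegral_prod_right' hh.lintegral_prod_right'
    fun x y => hν _ _ _ (hf.comp measurable_prodMk_left) (hg.comp measurable_prodMk_left)
      (hh.comp measurable_prodMk_left) fun x' y' => hfgh (x, x') (y, y')

theorem PrekopaLeindler.of_measurePreserving {μ : Measure E} {ν : Measure F}
    (hν : PrekopaLeindler ν) (e : E ≃ᵐ F) (he : MeasurePreserving e μ ν)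
    (hmid : ∀ x y, e.symm ((2⁻¹ : ℝ) • (x + y)) = (2⁻¹ : ℝ) • (e.symm x + e.symm y)) :
    PrekopaLeindler μ := by
  intro f g h hf hg hh hfgh
  have hlint : ∀ u : E → ℝ≥0∞, ∫⁻ x, u x ∂μ = ∫⁻ y, u (e.symm y) ∂ν := fun u => by
    rw [← he.lintegral_comp_emb e.measurableEmbedding]
    simp
  simp only [hlint]
  refine hν _ _ _ (hf.comp e.symm.measurable) (hg.comp e.symm.measurable)
    (hh.comp e.symm.measurable) fun x y => ?_
  simpa only [Function.comp_apply, hmid] using hfgh (e.symm x) (e.symm y)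

theorem PrekopaLeindler.pi {μ : Measure E} [SigmaFinite μ] (hμ : PrekopaLeindler μ) (n : ℕ) :
    PrekopaLeindler (Measure.pi fun _ : Fin n => μ) := by
  induction n with
  | zero =>
    intro f g h hf hg hh hfgh
    rw [Measure.pi_of_empty _ 0]
    simp only [lintegral_dirac' _ hf, lintegral_dirac' _ hg, lintegral_dirac' _ hh]
    simpa using hfgh 0 0
  | succ n ih =>
    refine (hμ.prod ih).of_measurePreserving _ (measurePreserving_piFinSuccAbove _ 0) fun x y => ?_
    ext i
    refine Fin.cases ?_ (fun j => ?_) i <;> simp [MeasurableEquiv.piFinSuccAbove]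

theorem PrekopaLeindler.restrict {μ : Measure E} (hμ : PrekopaLeindler μ) {D : Set E}
    (hD : Convex ℝ D) (hDm : MeasurableSet D) : PrekopaLeindler (μ.restrict D) := by
  intro f g h hf hg hh hfgh
  simp only [← lintegral_indicator hDm]
  refine hμ _ _ _ (hf.indicator hDm) (hg.indicator hDm) (hh.indicator hDm) fun x y => ?_
  by_cases hx : x ∈ D
  · by_cases hy : y ∈ D
    · have : (2⁻¹ : ℝ) • (x + y) ∈ D := by
        rw [smul_add]
        exact hD hx hy (by norm_num) (by norm_num) (by norm_num)
      simpa only [Set.indicator_of_mem, hx, hy, this] using hfgh x y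
    · simp [hy]
  · simp [hx]

end

theorem prekopaLeindler_volume_euclideanSpace (n : ℕ) :
    PrekopaLeindler (volume : Measure (EuclideanSpace ℝ (Fin n))) := by
  refine (prekopaLeindler_volume_real.pi n).of_measurePreserving _
    (EuclideanSpace.volume_preserving_symm_measurableEquiv_toLp (Fin n)) fun x y => ?_
  rfl

theorem PrekopaLeindler.lintegral_pow_mul_le {E : Type*} [AddCommGroup E] [Module ℝ E]
    [MeasurableSpace E] {μ : Measure E} (hμ : PrekopaLeindler μ) {p : E → ℝ≥0∞} (hp : Measurable p)
    (hmid : ∀ x y, p x ≤ 2 * p ((2⁻¹ : ℝ) • (x + y)) + p y) (a : ℝ≥0∞) (m : ℕ) :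
    (∫⁻ x, p x ^ (2 * m) ∂μ) * μ {x | p x ≤ a} ≤ (∫⁻ x, (2 * p x + a) ^ m ∂μ) ^ 2 := by
  have hS : MeasurableSet {x | p x ≤ a} := measurableSet_le hp measurable_const
  rw [← lintegral_indicator_one hS]
  refine hμ _ _ _ (hp.pow_const _) (measurable_one.indicator hS)
    (((hp.const_mul 2).add_const a).pow_const m) fun x y => ?_
  by_cases hy : p y ≤ a
  · have : y ∈ {x | p x ≤ a} := hy
    rw [Set.indicator_of_mem this, Pi.one_apply, mul_one, ← pow_mul, mul_comm m 2, pow_mul, pow_mul]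
    gcongr
    exact (hmid x y).trans (by gcongr)
  · have : y ∉ {x | p x ≤ a} := hy
    simp [Set.indicator_of_notMem this]

theorem two_inv_le_measure_le_two_mul_lintegral {E : Type*} [MeasurableSpace E] {μ : Measure E}
    [IsProbabilityMeasure μ] {p : E → ℝ≥0∞} (hp : Measurable p) :
    2⁻¹ ≤ μ {x | p x ≤ 2 * ∫⁻ y, p y ∂μ} := by
  set I := ∫⁻ y, p y ∂μ with hI
  by_cases h0 : I = 0
  · have h1 : μ {x | p x ≤ 2 * I} = 1 := by
      rw [prob_compl_eq_zero_iff (measurableSet_le hp measurable_const) |>.symm]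
      have := (lintegral_eq_zero_iff hp).1 h0
      refine measure_mono_null (fun x hx => ?_) this
      simp only [Set.mem_compl_iff, Set.mem_ofPred_eq, h0, mul_zero, nonpos_iff_eq_zero] at hx ⊢
      exact hx
    rw [h1]
    simp
  by_cases ht : I = ∞
  · simp [ht]
  have hcompl : {x | p x ≤ 2 * I}ᶜ ⊆ {x | 2 * I ≤ p x} := fun x hx => by
    simp only [Set.mem_compl_iff, Set.mem_ofPred_eq, not_le] at hx ⊢
    exact hx.le
  have hmarkov : (2 * I) * μ {x | 2 * I ≤ p x} ≤ I := mul_meas_ge_le_lintegral hp _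
  have hle : μ {x | p x ≤ 2 * I}ᶜ ≤ 2⁻¹ := by
    refine (measure_mono hcompl).trans ?_
    rw [← ENNReal.mul_le_mul_iff_right (mul_ne_zero two_ne_zero h0)
      (ENNReal.mul_ne_top (by simp) ht)]
    refine hmarkov.trans_eq ?_
    rw [mul_right_comm, ENNReal.mul_inv_cancel (by simp) (by simp), one_mul]
  have hsum := measure_add_measure_compl (μ := μ) (measurableSet_le hp measurable_const :
    MeasurableSet {x | p x ≤ 2 * I})
  rw [measure_univ] at hsum
  by_contra! hlt
  have : (1 : ℝ≥0∞) < 1 := by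
    calc (1 : ℝ≥0∞) = μ {x | p x ≤ 2 * I} + μ {x | p x ≤ 2 * I}ᶜ := hsum.symm
      _ < 2⁻¹ + 2⁻¹ := ENNReal.add_lt_add_of_lt_of_le (by finiteness) hlt hle
      _ = 1 := ENNReal.inv_two_add_inv_two
  exact lt_irrefl _ this

theorem PrekopaLeindler.eLpNorm'_two_mul_le {E : Type*} [AddCommGroup E] [Module ℝ E]
    [MeasurableSpace E] {μ : Measure E} [IsProbabilityMeasure μ] (hμ : PrekopaLeindler μ)
    {p : E → ℝ≥0∞} (hp : Measurable p)
    (hmid : ∀ x y, p x ≤ 2 * p ((2⁻¹ : ℝ) • (x + y)) + p y) {m : ℕ} (hm : 1 ≤ m) :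
    eLpNorm' p (2 * m) μ ≤
      2 ^ (1 / (2 * m) : ℝ) * (2 * eLpNorm' p m μ + 2 * ∫⁻ x, p x ∂μ) := by
  set a := 2 * ∫⁻ x, p x ∂μ with ha
  have hm0 : (0 : ℝ) < m := by exact_mod_cast hm
  have h1 : ∫⁻ x, p x ^ (2 * m) ∂μ ≤ 2 * (∫⁻ x, (2 * p x + a) ^ m ∂μ) ^ 2 := by
    have h := (mul_le_mul_right (two_inv_le_measure_le_two_mul_lintegral hp (μ := μ))
      (∫⁻ x, p x ^ (2 * m) ∂μ)).trans (hμ.lintegral_pow_mul_le hp hmid a m)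
    rw [← div_eq_mul_inv] at h
    rw [mul_comm 2 ((∫⁻ x, (2 * p x + a) ^ m ∂μ) ^ 2)]
    exact (ENNReal.div_le_iff_le_mul (by simp) (by simp)).1 h
  have h2 : (∫⁻ x, (2 * p x + a) ^ m ∂μ) ^ (1 / m : ℝ) ≤ 2 * eLpNorm' p m μ + a := by
    have h := ENNReal.lintegral_Lp_add_le (μ := μ) (p := m) (hp.const_mul 2).aemeasurable
      (measurable_const (a := a)).aemeasurable (by exact_mod_cast hm)
    simp only [Pi.add_apply, ENNReal.rpow_natCast] at h
    refine h.trans_eq ?_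
    simp only [mul_pow, lintegral_const, measure_univ, mul_one]
    rw [lintegral_const_mul _ (hp.pow_const m), ENNReal.mul_rpow_of_nonneg _ _ (by positivity)]
    simp only [← ENNReal.rpow_natCast, ← ENNReal.rpow_mul, mul_one_div_cancel hm0.ne',
      ENNReal.rpow_one]
    simp [eLpNorm']
  calc eLpNorm' p (2 * m) μ = (∫⁻ x, p x ^ (2 * m) ∂μ) ^ (1 / (2 * m) : ℝ) := by
        simp only [eLpNorm', enorm_eq_self, ← ENNReal.rpow_natCast]
        push_cast
        rfl
    _ ≤ (2 * (∫⁻ x, (2 * p x + a) ^ m ∂μ) ^ 2) ^ (1 / (2 * m) : ℝ) := by gcongr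
    _ = 2 ^ (1 / (2 * m) : ℝ) * (∫⁻ x, (2 * p x + a) ^ m ∂μ) ^ (1 / m : ℝ) := by
        rw [ENNReal.mul_rpow_of_nonneg _ _ (by positivity), ← ENNReal.rpow_natCast,
          ← ENNReal.rpow_mul]
        congr 2
        push_cast
        field_simp
    _ ≤ _ := by gcongr

theorem two_rpow_mul_add_le {u : ℝ} (hu : 0 < u) (hu1 : u ≤ 1) :
    (2 : ℝ) ^ (u / 2) * (2 * (u⁻¹ * 2 ^ (1 - u) * (3 - 2 * u)) + 2)
      ≤ (u / 2)⁻¹ * 2 ^ (1 - u / 2) * (3 - 2 * (u / 2)) := by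
  have h1 : (1 : ℝ) ≤ 2 ^ (1 - u) := Real.one_le_rpow (by norm_num) (by linarith)
  have h2 : (2 : ℝ) ^ (1 - u / 2) = 2 ^ (u / 2) * 2 ^ (1 - u) := by
    rw [← Real.rpow_add two_pos]
    ring_nf
  have h3 : 2 * (u⁻¹ * 2 ^ (1 - u) * (3 - 2 * u)) + 2 ≤ (u / 2)⁻¹ * 2 ^ (1 - u) * (3 - u) := by
    have : (u / 2)⁻¹ * (2 : ℝ) ^ (1 - u) * (3 - u)
        - (2 * (u⁻¹ * 2 ^ (1 - u) * (3 - 2 * u)) + 2) = 2 * (2 ^ (1 - u) - 1) := by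
      field_simp
      ring
    linarith
  calc _ ≤ (2 : ℝ) ^ (u / 2) * ((u / 2)⁻¹ * 2 ^ (1 - u) * (3 - u)) := by gcongr
    _ = _ := by rw [h2]; ring

theorem PrekopaLeindler.eLpNorm'_two_pow_le {E : Type*} [AddCommGroup E] [Module ℝ E]
    [MeasurableSpace E] {μ : Measure E} [IsProbabilityMeasure μ] (hμ : PrekopaLeindler μ)
    {p : E → ℝ≥0∞} (hp : Measurable p)
    (hmid : ∀ x y, p x ≤ 2 * p ((2⁻¹ : ℝ) • (x + y)) + p y) (k : ℕ) :
    eLpNorm' p (2 ^ k) μ ≤ ENNReal.ofReal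
      (((2 ^ k)⁻¹ : ℝ)⁻¹ * 2 ^ (1 - (2 ^ k)⁻¹ : ℝ) * (3 - 2 * (2 ^ k)⁻¹)) * ∫⁻ x, p x ∂μ := by
  induction k with
  | zero => norm_num [eLpNorm']
  | succ k ih =>
    set u : ℝ := (2 ^ k)⁻¹ with hu
    have hu0 : 0 < u := by positivity
    have hu1 : u ≤ 1 := inv_le_one_of_one_le₀ (one_le_pow₀ one_le_two)
    have hu2 : ((2 : ℝ) ^ (k + 1))⁻¹ = u / 2 := by rw [pow_succ, mul_inv, hu]; rfl
    have hstep := hμ.eLpNorm'_two_mul_le hp hmid (m := 2 ^ k) Nat.one_le_two_pow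
    have hexp : (1 / (2 * ((2 ^ k : ℕ) : ℝ)) : ℝ) = u / 2 := by
      rw [hu]; push_cast; field_simp
    rw [hexp] at hstep
    push_cast at hstep
    rw [hu2, pow_succ']
    have hb : 0 ≤ u⁻¹ * 2 ^ (1 - u) * (3 - 2 * u) :=
      mul_nonneg (by positivity) (by linarith)
    have hnum := ENNReal.ofReal_le_ofReal (two_rpow_mul_add_le hu0 hu1)
    refine hstep.trans ?_
    set b := u⁻¹ * 2 ^ (1 - u) * (3 - 2 * u)
    calc _ ≤ 2 ^ (u / 2) * (2 * (ENNReal.ofReal b * ∫⁻ x, p x ∂μ)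
            + 2 * ∫⁻ x, p x ∂μ) := by gcongr
      _ = ENNReal.ofReal (2 ^ (u / 2) * (2 * b + 2))
            * ∫⁻ x, p x ∂μ := by
          rw [ENNReal.ofReal_mul (p := 2 ^ (u / 2)) (by positivity),
            ENNReal.ofReal_add (by positivity) (by norm_num),
            ENNReal.ofReal_mul (p := 2) (by norm_num),
            ← ENNReal.ofReal_rpow_of_pos two_pos, ENNReal.ofReal_ofNat]
          ring
      _ ≤ _ := mul_le_mul_left hnum _

theorem PrekopaLeindler.eLpNorm'_le {E : Type*} [AddCommGroup E] [Module ℝ E]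
    [MeasurableSpace E] {μ : Measure E} [IsProbabilityMeasure μ] (hμ : PrekopaLeindler μ)
    {p : E → ℝ≥0∞} (hp : Measurable p)
    (hmid : ∀ x y, p x ≤ 2 * p ((2⁻¹ : ℝ) • (x + y)) + p y) {q : ℝ} (hq : 1 ≤ q) :
    eLpNorm' p q μ ≤ ENNReal.ofReal (12 * q) * ∫⁻ x, p x ∂μ := by
  obtain ⟨k, hk, hk'⟩ := exists_nat_pow_near hq one_lt_two
  refine (eLpNorm'_le_eLpNorm'_of_exponent_le (by linarith) hk'.le μ
    hp.aestronglyMeasurable).trans ((hμ.eLpNorm'_two_pow_le hp hmid (k + 1)).trans ?_)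
  refine mul_le_mul_left (ENNReal.ofReal_le_ofReal ?_) _
  set u : ℝ := (2 ^ (k + 1))⁻¹ with hu
  have hu0 : 0 < u := by positivity
  have hinv : u⁻¹ ≤ 2 * q := by rw [hu, inv_inv, pow_succ]; linarith
  have hu1 : u ≤ 1 := inv_le_one_of_one_le₀ (one_le_pow₀ one_le_two)
  have hpow : (2 : ℝ) ^ (1 - u) ≤ 2 := by
    simpa using Real.rpow_le_rpow_of_exponent_le one_le_two (by linarith : 1 - u ≤ 1)
  calc u⁻¹ * 2 ^ (1 - u) * (3 - 2 * u) ≤ (2 * q) * 2 * 3 := by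
        gcongr
        · linarith
        · linarith
    _ = 12 * q := by ring

theorem IsSymmConvexBody.mem_nhds_zero_s1 {n : ℕ} {K : Set (EuclideanSpace ℝ (Fin n))}
    (hK : IsSymmConvexBody K) : K ∈ nhds 0 := by
  obtain ⟨hconv, -, ⟨x, hx⟩, hsymm⟩ := hK
  have hx' : -x ∈ interior K := by
    rw [mem_interior_iff_mem_nhds] at hx ⊢
    rw [hsymm]
    exact continuous_neg.continuousAt.preimage_mem_nhds (by simpa using hx)
  have h0 := hconv.interior hx hx' (by norm_num : (0 : ℝ) ≤ 2⁻¹) (by norm_num : (0 : ℝ) ≤ 2⁻¹)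
    (by norm_num)
  rw [smul_neg, add_neg_cancel] at h0
  exact mem_interior_iff_mem_nhds.1 h0

/-- A reverse Hölder inequality for real functions with a midpoint triangle inequality. -/
theorem PrekopaLeindler.integral_rpow_le {E : Type*} [AddCommGroup E] [Module ℝ E]
    [MeasurableSpace E] {μ : Measure E} [IsProbabilityMeasure μ] (hμ : PrekopaLeindler μ)
    {p : E → ℝ} (hp : Measurable p) (hp0 : ∀ x, 0 ≤ p x) (hpi : Integrable p μ)
    (hmid : ∀ x y, p x ≤ 2 * p ((2⁻¹ : ℝ) • (x + y)) + p y) {q : ℝ} (hq : 1 ≤ q) :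
    (∫ x, p x ^ q ∂μ) ^ (1 / q) ≤ 12 * q * ∫ x, p x ∂μ := by
  have h := hμ.eLpNorm'_le hp.ennreal_ofReal (fun x y => by
    rw [← ENNReal.ofReal_ofNat 2, ← ENNReal.ofReal_mul zero_le_two,
      ← ENNReal.ofReal_add (mul_nonneg zero_le_two (hp0 _)) (hp0 y)]
    exact ENNReal.ofReal_le_ofReal (hmid x y)) hq
  have hlint : ∫⁻ x, ENNReal.ofReal (p x) ∂μ = ENNReal.ofReal (∫ x, p x ∂μ) :=
    (ofReal_integral_eq_lintegral_ofReal hpi (Filter.Eventually.of_forall hp0)).symm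
  have hI0 : 0 ≤ ∫ x, p x ∂μ := integral_nonneg hp0
  rw [hlint, ← ENNReal.ofReal_mul (by positivity)] at h
  have h' := ENNReal.toReal_le_of_le_ofReal (by positivity) h
  refine le_trans (le_of_eq ?_) h'
  rw [integral_eq_lintegral_of_nonneg_ae
    (Filter.Eventually.of_forall fun x => Real.rpow_nonneg (hp0 x) q)
    (hp.pow_const q).aestronglyMeasurable, ENNReal.toReal_rpow]
  simp only [eLpNorm', enorm_eq_self]
  simp only [ENNReal.ofReal_rpow_of_nonneg (hp0 _) (zero_le_one.trans hq)]

/-- there is an absolute constant `c > 0` such that for all convex bodies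
`C₁,…,C_s` of volume 1 in `ℝⁿ`, every centrally symmetric convex body `K`, every `q ≥ 1`
and every `t ∈ ℝˢ`,
`(∫_{C₁}⋯∫_{C_s} ‖∑ t_j x_j‖_K^q)^{1/q} ≤ c q ∫_{C₁}⋯∫_{C_s} ‖∑ t_j x_j‖_K`. -/
theorem stmt1 :
    ∃ c : ℝ, 0 < c ∧
      ∀ (n s : ℕ) (C : Fin s → Set (EuclideanSpace ℝ (Fin n)))
        (_hC : ∀ j, IsConvexBody (C j)) (_hCvol : ∀ j, volume (C j) = 1)
        (K : Set (EuclideanSpace ℝ (Fin n))) (_hK : IsSymmConvexBody K)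
        (q : ℝ) (_hq : 1 ≤ q) (t : Fin s → ℝ),
        (∫ x in Set.univ.pi C, gauge K (∑ j, t j • x j) ^ q) ^ (1 / q)
          ≤ c * q * ∫ x in Set.univ.pi C, gauge K (∑ j, t j • x j) := by
  refine ⟨12, by norm_num, fun n s C hC hCvol K hK q hq t => ?_⟩
  have hDconv : Convex ℝ (Set.univ.pi C) := convex_pi fun j _ => (hC j).1
  have hDcomp : IsCompact (Set.univ.pi C) := isCompact_univ_pi fun j => (hC j).2.1
  have hprob : IsProbabilityMeasure (volume.restrict (Set.univ.pi C)) := by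
    refine ⟨?_⟩
    rw [Measure.restrict_apply_univ, volume_pi, Measure.pi_pi]
    simp [hCvol]
  have hcont : Continuous fun x : Fin s → EuclideanSpace ℝ (Fin n) => gauge K (∑ j, t j • x j) :=
    (continuous_gauge hK.1 hK.mem_nhds_zero_s1).comp (by fun_prop)
  refine (((prekopaLeindler_volume_euclideanSpace n).pi s).restrict hDconv
    hDcomp.isClosed.measurableSet).integral_rpow_le hcont.measurable (fun x => gauge_nonneg _)
    (hcont.continuousOn.integrableOn_compact hDcomp) (fun x y => ?_) hq
  have hneg : ∀ z, gauge K (-z) = gauge K z :=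
    gauge_neg fun z hz => by rw [hK.2.2.2]; simpa using hz
  have hsum : ∑ j, t j • x j
      = (2 : ℝ) • (∑ j, t j • ((2⁻¹ : ℝ) • (x + y)) j) + -∑ j, t j • y j := by
    rw [Finset.smul_sum, ← Finset.sum_neg_distrib, ← Finset.sum_add_distrib]
    refine Finset.sum_congr rfl fun j _ => ?_
    simp only [Pi.smul_apply, Pi.add_apply]
    module
  calc gauge K (∑ j, t j • x j) ≤ gauge K ((2 : ℝ) • (∑ j, t j • ((2⁻¹ : ℝ) • (x + y)) j))
        + gauge K (-∑ j, t j • y j) := by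
        rw [hsum]
        exact gauge_add_le hK.1 (absorbent_nhds_zero hK.mem_nhds_zero_s1) _ _
    _ = _ := by rw [hneg, gauge_smul_of_nonneg zero_le_two, smul_eq_mul]
end
end

section
/- Let X₁,…,X_s be independent random vectors uniformly distributed on centrally symmetric convex bodies C₁,…,C_s of volume 1 in ℝⁿ, let t = (t₁,…,t_s) ∈ ℝˢ with ‖t‖₂ = 1, and let g_t denote the (log-concave) density of the random vector t₁X₁ + ⋯ + t_sX_s. Then ‖g_t‖_∞ ≤ eⁿ. -/
open MeasureTheory Real
open scoped ENNReal RealInnerProductSpace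

noncomputable section

section

open ProbabilityTheory

lemma pi_withDensity_ofReal {ι : Type*} [Fintype ι] {f : ι → ℝ → ℝ} (hf : ∀ i, Integrable (f i))
    (h0 : ∀ i x, 0 ≤ f i x) :
    Measure.pi (fun i => (volume : Measure ℝ).withDensity fun x => ENNReal.ofReal (f i x)) =
      (volume : Measure (ι → ℝ)).withDensity fun v => ENNReal.ofReal (∏ i, f i (v i)) := by
  have : ∀ i, IsFiniteMeasure ((volume : Measure ℝ).withDensity fun x => ENNReal.ofReal (f i x)) :=
    fun i => isFiniteMeasure_withDensity_ofReal (hf i).2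
  refine Measure.pi_eq fun s hs => ?_
  rw [withDensity_apply _ (MeasurableSet.univ_pi hs), ← lintegral_indicator (MeasurableSet.univ_pi hs)]
  have key : ∀ v : ι → ℝ, (Set.univ.pi s).indicator
      (fun v => ENNReal.ofReal (∏ i, f i (v i))) v =
      ENNReal.ofReal (∏ i, (s i).indicator (f i) (v i)) := by
    intro v
    by_cases hv : v ∈ Set.univ.pi s
    · rw [Set.indicator_of_mem hv]
      congr 1
      refine Finset.prod_congr rfl fun i _ => ?_
      rw [Set.indicator_of_mem (hv i (Set.mem_univ i))]
    · rw [Set.indicator_of_notMem hv]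
      simp only [Set.mem_pi, Set.mem_univ, true_implies, not_forall] at hv
      obtain ⟨i, hi⟩ := hv
      rw [Finset.prod_eq_zero (Finset.mem_univ i) (Set.indicator_of_notMem hi _), ENNReal.ofReal_zero]
  have hI : ∀ i, Integrable ((s i).indicator (f i)) := fun i => (hf i).indicator (hs i)
  simp_rw [key]
  rw [volume_pi, ← ofReal_integral_eq_lintegral_ofReal (Integrable.fintype_prod hI)
    (ae_of_all _ fun v => Finset.prod_nonneg fun i _ => Set.indicator_nonneg (fun x _ => h0 i x) _),
    integral_fintype_prod_eq_prod, ENNReal.ofReal_prod_of_nonneg]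
  · refine Finset.prod_congr rfl fun i _ => ?_
    rw [withDensity_apply _ (hs i), integral_indicator (hs i),
      ofReal_integral_eq_lintegral_ofReal (hf i).integrableOn (ae_of_all _ fun x => h0 i x)]
  · exact fun i _ => integral_nonneg fun x => Set.indicator_nonneg (fun x _ => h0 i x) _

lemma map_sum_mul_pi_gaussianReal {ι : Type*} [Fintype ι] (t : ι → ℝ) (ht : ∑ j, t j ^ 2 = 1) :
    (Measure.pi fun _ : ι => gaussianReal 0 1).map (fun v => ∑ j, t j * v j) =
      gaussianReal 0 1 := by
  have hI : iIndepFun (fun j (v : ι → ℝ) => t j * v j) (Measure.pi fun _ : ι => gaussianReal 0 1) :=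
    iIndepFun_pi (X := fun j x => t j * x) fun i =>
      (measurable_const_mul (t i)).aemeasurable (μ := gaussianReal 0 1)
  apply Measure.ext_of_charFun
  rw [hI.charFun_map_fun_sum_eq_prod
    fun i => ((measurable_pi_apply i).const_mul (t i)).aemeasurable]
  ext u
  have h1 : ∀ j, (Measure.pi fun _ : ι => gaussianReal 0 1).map (fun v => t j * v j) =
      gaussianReal 0 (NNReal.mk (t j ^ 2) (sq_nonneg _)) := by
    intro j
    have := gaussianReal_map_const_mul (μ := 0) (v := 1) (t j)
    rw [mul_zero, mul_one] at this
    rw [← (measurePreserving_eval (fun _ : ι => gaussianReal 0 1) j).map_eq,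
      Measure.map_map (by fun_prop) (by fun_prop)] at this
    exact this
  simp only [Finset.prod_apply, h1, charFun_gaussianReal]
  rw [← Complex.exp_sum]
  congr 1
  simp [Finset.sum_neg_distrib, ← Finset.sum_div, ← Finset.sum_mul]
  rw [show ((∑ j, (t j : ℂ)^2)) = ((∑ j, t j ^ 2 : ℝ) : ℂ) by push_cast; rfl, ht]
  simp

lemma lintegral_comp_sum_mul_gaussian {ι : Type*} [Fintype ι] (t : ι → ℝ) (ht : ∑ j, t j ^ 2 = 1)
    {ψ : ℝ → ℝ≥0∞} (hψ : Measurable ψ) :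
    ∫⁻ v : ι → ℝ, ENNReal.ofReal (∏ i, gaussianPDFReal 0 1 (v i)) * ψ (∑ j, t j * v j) =
      ∫⁻ u, ENNReal.ofReal (gaussianPDFReal 0 1 u) * ψ u := by
  have h := map_sum_mul_pi_gaussianReal t ht
  have h2 : gaussianReal 0 1 = volume.withDensity fun x => ENNReal.ofReal (gaussianPDFReal 0 1 x) := by
    rw [gaussianReal_of_var_ne_zero _ one_ne_zero]; rfl
  have h3 := pi_withDensity_ofReal (ι := ι) (f := fun _ => gaussianPDFReal 0 1)
    (fun _ => integrable_gaussianPDFReal _ _)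
    (fun _ _ => gaussianPDFReal_nonneg _ _ _)
  have hm := measurable_gaussianPDFReal 0 1
  have hm' : Measurable fun v : ι → ℝ => ∑ j, t j * v j := by fun_prop
  have := congrArg (fun μ => ∫⁻ u, ψ u ∂μ) h
  rw [lintegral_map hψ hm', h2, h3, lintegral_withDensity_eq_lintegral_mul _ (by fun_prop) (by fun_prop),
    lintegral_withDensity_eq_lintegral_mul _ (by fun_prop) hψ] at this
  exact this

open Matrix in
lemma det_diagonal_add_replicateCol_mul_replicateRow {ι : Type*} [Fintype ι] [DecidableEq ι]
    {t d : ι → ℝ} (ht : ∑ j, t j ^ 2 = 1) (hd : ∀ j, 0 < d j) :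
    (diagonal d + replicateCol Unit t * replicateRow Unit fun j => t j - t j * d j).det =
      (∏ j, d j) * ∑ j, t j ^ 2 * (d j)⁻¹ := by
  have h : diagonal d + replicateCol Unit t * replicateRow Unit (fun j => t j - t j * d j) =
      diagonal d * (1 + replicateCol Unit (fun j => (d j)⁻¹ * t j) *
        replicateRow Unit fun j => t j - t j * d j) := by
    rw [mul_add, mul_one]
    congr 1
    ext i j
    simp only [diagonal_mul]
    simp only [mul_apply, replicateCol_apply, replicateRow_apply]
    have := (hd i).ne'
    simp
    field_simp
  rw [h, det_mul, det_diagonal, det_one_add_replicateCol_mul_replicateRow, dotProduct, ← ht,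
    ← Finset.sum_add_distrib]
  congr 1
  refine Finset.sum_congr rfl fun j _ => ?_
  have := (hd j).ne'
  field_simp
  ring

lemma prod_rpow_le_prod_mul_sum_inv {ι : Type*} [Fintype ι]
    {t d : ι → ℝ} (ht : ∑ j, t j ^ 2 = 1) (hd : ∀ j, 0 < d j) :
    ∏ j, d j ^ (1 - t j ^ 2) ≤ (∏ j, d j) * ∑ j, t j ^ 2 * (d j)⁻¹ := by
  have h := geom_mean_le_arith_mean_weighted Finset.univ (fun j => t j ^ 2) (fun j => (d j)⁻¹)
    (fun _ _ => sq_nonneg _) ht (fun j _ => (inv_pos.2 (hd j)).le)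
  refine le_trans (le_of_eq ?_)
    (mul_le_mul_of_nonneg_left h (Finset.prod_nonneg fun j _ => (hd j).le))
  rw [← Finset.prod_mul_distrib]
  refine Finset.prod_congr rfl fun j _ => ?_
  rw [rpow_sub (hd j), rpow_one, inv_rpow (hd j).le, div_eq_mul_inv]

/-- The orthogonal projection of `T x` along `t`, corrected to have the same component along `t`
as `x`. -/
def twist {ι : Type*} [Fintype ι] (t : ι → ℝ) (T : ι → ℝ → ℝ) (x : ι → ℝ) (i : ι) : ℝ :=
  T i (x i) + t i * (∑ j, t j * x j - ∑ j, t j * T j (x j))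

lemma sum_mul_twist {ι : Type*} [Fintype ι] {t : ι → ℝ} (ht : ∑ j, t j ^ 2 = 1) (T : ι → ℝ → ℝ)
    (x : ι → ℝ) : ∑ j, t j * twist t T x j = ∑ j, t j * x j := by
  simp only [twist, mul_add, Finset.sum_add_distrib, ← mul_assoc, ← Finset.sum_mul, ← pow_two, ht]
  ring

lemma sum_twist_sq {ι : Type*} [Fintype ι] {t : ι → ℝ} (ht : ∑ j, t j ^ 2 = 1) (T : ι → ℝ → ℝ)
    (x : ι → ℝ) : ∑ j, twist t T x j ^ 2 =
      ∑ j, T j (x j) ^ 2 - (∑ j, t j * T j (x j)) ^ 2 + (∑ j, t j * x j) ^ 2 := by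
  have h : ∀ a : ℝ, ∑ j, (T j (x j) + t j * a) ^ 2 =
      ∑ j, T j (x j) ^ 2 + 2 * a * (∑ j, t j * T j (x j)) + a ^ 2 * ∑ j, t j ^ 2 := by
    intro a
    rw [Finset.mul_sum, Finset.mul_sum, ← Finset.sum_add_distrib, ← Finset.sum_add_distrib]
    exact Finset.sum_congr rfl fun j _ => by ring
  simp only [twist]
  rw [h, ht]
  ring

lemma twist_injective {ι : Type*} [Fintype ι] {t : ι → ℝ} (ht : ∑ j, t j ^ 2 = 1) {T : ι → ℝ → ℝ}
    (hT : ∀ j, StrictMono (T j)) : Function.Injective (twist t T) := by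
  intro x y hxy
  have h1 : ∑ j, t j * x j = ∑ j, t j * y j := by
    rw [← sum_mul_twist ht T x, hxy, sum_mul_twist ht T y]
  have h2 : ∀ j, T j (x j) - T j (y j) =
      t j * (∑ j, t j * T j (x j) - ∑ j, t j * T j (y j)) := by
    intro j
    have := congrFun hxy j
    simp only [twist] at this
    rw [h1] at this
    linarith
  have h3 : ∑ j, (x j - y j) * (T j (x j) - T j (y j)) = 0 := by
    simp only [h2]
    have : ∀ j, (x j - y j) * (t j * (∑ j, t j * T j (x j) - ∑ j, t j * T j (y j))) =
      (t j * x j - t j * y j) * (∑ j, t j * T j (x j) - ∑ j, t j * T j (y j)) := fun j => by ring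
    simp only [this, ← Finset.sum_mul, Finset.sum_sub_distrib, h1, sub_self, zero_mul]
  have h4 : ∀ a b j, a ≠ b → 0 < (a - b) * (T j a - T j b) := by
    intro a b j hab
    rcases lt_or_gt_of_ne hab with h | h
    · exact mul_pos_of_neg_of_neg (sub_neg.2 h) (sub_neg.2 (hT j h))
    · exact mul_pos (sub_pos.2 h) (sub_pos.2 (hT j h))
  have h5 : ∀ j, 0 ≤ (x j - y j) * (T j (x j) - T j (y j)) := by
    intro j
    rcases eq_or_ne (x j) (y j) with h | h
    · simp [h]
    · exact (h4 _ _ j h).le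
  ext j
  by_contra h
  exact (h4 _ _ j h).ne' ((Finset.sum_eq_zero_iff_of_nonneg fun j _ => h5 j).1 h3 j
    (Finset.mem_univ j))

lemma lintegral_comp_twist_le {ι : Type*} [Fintype ι] {t : ι → ℝ}
    (ht : ∑ j, t j ^ 2 = 1) {T d : ι → ℝ → ℝ} (hT : ∀ j x, HasDerivAt (T j) (d j x) x)
    (hd : ∀ j x, 0 < d j x) (G : (ι → ℝ) → ℝ≥0∞) :
    ∫⁻ x : ι → ℝ, ENNReal.ofReal (∏ j, d j (x j) ^ (1 - t j ^ 2)) * G (twist t T x) ≤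
      ∫⁻ v, G v := by
  classical
  have hmono : ∀ j, StrictMono (T j) := fun j =>
    strictMono_of_hasDerivAt_pos (hT j) (hd j)
  let M : (ι → ℝ) → Matrix ι ι ℝ := fun x => Matrix.diagonal (fun j => d j (x j)) +
    Matrix.replicateCol Unit t * Matrix.replicateRow Unit fun j => t j - t j * d j (x j)
  let f' : (ι → ℝ) → ((ι → ℝ) →L[ℝ] (ι → ℝ)) := fun x =>
    LinearMap.toContinuousLinearMap (Matrix.toLin' (M x))
  have hdet : ∀ x, (f' x).det = (∏ j, d j (x j)) * ∑ j, t j ^ 2 * (d j (x j))⁻¹ := by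
    intro x
    rw [LinearMap.det_toContinuousLinearMap, LinearMap.det_toLin']
    exact det_diagonal_add_replicateCol_mul_replicateRow ht fun j => hd j (x j)
  have hf : ∀ x ∈ (Set.univ : Set (ι → ℝ)), HasFDerivWithinAt (twist t T) (f' x) Set.univ x := by
    intro x _
    rw [hasFDerivWithinAt_univ, hasFDerivAt_pi']
    intro i
    have hx : ∀ j, HasFDerivAt (fun x : ι → ℝ => x j)
        (ContinuousLinearMap.proj (R := ℝ) (φ := fun _ : ι => ℝ) j) x := fun j => hasFDerivAt_apply j x
    have hTx : ∀ j, HasFDerivAt (fun x : ι → ℝ => T j (x j))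
        (d j (x j) • ContinuousLinearMap.proj (R := ℝ) (φ := fun _ : ι => ℝ) j) x := fun j =>
      (hT j (x j)).comp_hasFDerivAt x (hx j)
    have h := (hTx i).add (((HasFDerivAt.fun_sum fun j (_ : j ∈ Finset.univ) =>
      (hx j).const_mul (t j)).sub (HasFDerivAt.fun_sum fun j (_ : j ∈ Finset.univ) =>
        (hTx j).const_mul (t j))).const_mul (t i))
    refine h.congr_fderiv ?_
    ext v
    simp only [f', M, _root_.add_apply, _root_.smul_apply,
      _root_.sub_apply, _root_.sum_apply, ContinuousLinearMap.proj_apply,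
      ContinuousLinearMap.comp_apply, LinearMap.coe_toContinuousLinearMap', Matrix.toLin'_apply,
      Matrix.add_mulVec, Pi.add_apply, Matrix.mulVec_diagonal, smul_eq_mul]
    congr 1
    rw [← Finset.sum_sub_distrib, Finset.mul_sum, Matrix.mulVec, dotProduct]
    refine Finset.sum_congr rfl fun j _ => ?_
    simp [Matrix.mul_apply]
    ring
  have := lintegral_image_eq_lintegral_abs_det_fderiv_mul volume MeasurableSet.univ hf
    (twist_injective ht hmono).injOn G
  rw [Measure.restrict_univ] at this
  refine le_trans (lintegral_mono fun x => ?_) (this.symm.le.trans (setLIntegral_le_lintegral _ _))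
  gcongr
  rw [hdet]
  exact (prod_rpow_le_prod_mul_sum_inv ht fun j => hd j (x j)).trans (le_abs_self _)

lemma hasDerivAt_integral_Iic_s2 {f : ℝ → ℝ} (hf : Continuous f) (hi : Integrable f) (x : ℝ) :
    HasDerivAt (fun x => ∫ y in Set.Iic x, f y) (f x) x := by
  have h : (fun x => ∫ y in Set.Iic x, f y) =
      fun x => (∫ y in Set.Iic (0 : ℝ), f y) + ∫ y in (0 : ℝ)..x, f y := by
    ext x
    rw [← intervalIntegral.integral_Iic_sub_Iic hi.integrableOn hi.integrableOn]
    ring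
  rw [h]
  exact (hf.integral_hasStrictDerivAt 0 x).hasDerivAt.const_add _

lemma range_integral_Iic {f : ℝ → ℝ} (hf : Continuous f) (hi : Integrable f)
    (hpos : ∀ x, 0 < f x) :
    Set.range (fun x => ∫ y in Set.Iic x, f y) = Set.Ioo 0 (∫ y, f y) := by
  have hderiv := hasDerivAt_integral_Iic_s2 hf hi
  have hmono : StrictMono fun x => ∫ y in Set.Iic x, f y :=
    strictMono_of_hasDerivAt_pos hderiv hpos
  have hcont : Continuous fun x => ∫ y in Set.Iic x, f y :=
    continuous_iff_continuousAt.2 fun x => (hderiv x).continuousAt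
  have hbot : Filter.Tendsto (fun x => ∫ y in Set.Iic x, f y) Filter.atBot (nhds 0) := by
    have := hf.measurable
    have h : Filter.Tendsto (fun x => ∫ y, (Set.Iic x).indicator f y) Filter.atBot
        (nhds (∫ _ : ℝ, (0 : ℝ))) := by
      refine tendsto_integral_filter_of_dominated_convergence f ?_ ?_ hi ?_
      · exact Filter.Eventually.of_forall fun x =>
          (this.indicator measurableSet_Iic).aestronglyMeasurable
      · refine Filter.Eventually.of_forall fun x => ae_of_all _ fun y => ?_
        exact (norm_indicator_le_norm_self _ _).trans (le_of_eq (norm_of_nonneg (hpos y).le))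
      · refine ae_of_all _ fun y => tendsto_const_nhds.congr' ?_
        filter_upwards [Filter.eventually_lt_atBot y] with x hx
        rw [Set.indicator_of_notMem (by simpa using hx)]
    simpa [integral_indicator measurableSet_Iic] using h
  have htop : Filter.Tendsto (fun x => ∫ y in Set.Iic x, f y) Filter.atTop (nhds (∫ y, f y)) := by
    have := hf.measurable
    have h : Filter.Tendsto (fun x => ∫ y, (Set.Iic x).indicator f y) Filter.atTop
        (nhds (∫ y, f y)) := by
      refine tendsto_integral_filter_of_dominated_convergence f ?_ ?_ hi ?_
      · exact Filter.Eventually.of_forall fun x =>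
          (this.indicator measurableSet_Iic).aestronglyMeasurable
      · refine Filter.Eventually.of_forall fun x => ae_of_all _ fun y => ?_
        exact (norm_indicator_le_norm_self _ _).trans (le_of_eq (norm_of_nonneg (hpos y).le))
      · refine ae_of_all _ fun y => tendsto_const_nhds.congr' ?_
        filter_upwards [Filter.eventually_ge_atTop y] with x hx
        rw [Set.indicator_of_mem (by simpa using hx)]
    simpa [integral_indicator measurableSet_Iic] using h
  apply Set.Subset.antisymm
  · rintro _ ⟨x, rfl⟩
    exact ⟨(hmono.monotone.le_of_tendsto hbot (x - 1)).trans_lt (hmono (sub_one_lt x)),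
      (hmono (lt_add_one x)).trans_le (hmono.monotone.ge_of_tendsto htop (x + 1))⟩
  · rintro z ⟨h0, h1⟩
    obtain ⟨a, ha⟩ := (hbot.eventually (gt_mem_nhds h0)).exists
    obtain ⟨b, hb⟩ := (htop.eventually (lt_mem_nhds h1)).exists
    exact mem_range_of_exists_le_of_exists_ge hcont ⟨a, ha.le⟩ ⟨b, hb.le⟩

/-- Monotone transport on the line between two continuous positive integrable functions. -/
lemma exists_transport_s2 {f g : ℝ → ℝ} (hf : Continuous f) (hfi : Integrable f)
    (hfpos : ∀ x, 0 < f x) (hg : Continuous g) (hgi : Integrable g) (hgpos : ∀ x, 0 < g x)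
    (hg1 : ∫ x, g x = 1) :
    ∃ S S' : ℝ → ℝ, (∀ x, HasDerivAt S (S' x) x) ∧ (∀ x, 0 < S' x) ∧
      ∀ x, f x = (∫ y, f y) * (g (S x) * S' x) := by
  set I := ∫ y, f y
  set F : ℝ → ℝ := fun x => ∫ y in Set.Iic x, f y with hF
  set Γ : ℝ → ℝ := fun x => ∫ y in Set.Iic x, g y with hΓ
  have hFd : ∀ x, HasDerivAt F (f x) x := hasDerivAt_integral_Iic_s2 hf hfi
  have hΓd : ∀ x, HasDerivAt Γ (g x) x := hasDerivAt_integral_Iic_s2 hg hgi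
  have hFr : Set.range F = Set.Ioo 0 I := range_integral_Iic hf hfi hfpos
  have hΓr : Set.range Γ = Set.Ioo 0 1 := hg1 ▸ range_integral_Iic hg hgi hgpos
  have hFm : StrictMono F := strictMono_of_hasDerivAt_pos hFd hfpos
  have hΓm : StrictMono Γ := strictMono_of_hasDerivAt_pos hΓd hgpos
  have hI : 0 < I := by
    have h : F 0 ∈ Set.Ioo 0 I := hFr ▸ Set.mem_range_self 0
    exact h.1.trans h.2
  have hex : ∀ x, ∃ z, Γ z = F x / I := by
    intro x
    have h : F x ∈ Set.Ioo 0 I := hFr ▸ Set.mem_range_self x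
    have h2 : F x / I ∈ Set.range Γ := by
      rw [hΓr]
      exact ⟨div_pos h.1 hI, (div_lt_one hI).2 h.2⟩
    exact h2
  choose S hS using hex
  have hSm : StrictMono S := by
    intro x y hxy
    rw [← hΓm.lt_iff_lt, hS, hS]
    exact div_lt_div_of_pos_right (hFm hxy) hI
  have hSs : Function.Surjective S := by
    intro z
    have h : Γ z ∈ Set.Ioo (0 : ℝ) 1 := hΓr ▸ Set.mem_range_self z
    have h2 : I * Γ z ∈ Set.range F := by
      rw [hFr]
      exact ⟨mul_pos hI h.1, by nlinarith [h.2]⟩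
    obtain ⟨x, hx⟩ := h2
    refine ⟨x, hΓm.injective ?_⟩
    rw [hS, hx]
    field_simp
  have hSc : Continuous S := hSm.monotone.continuous_of_surjective hSs
  refine ⟨S, fun x => f x / I / g (S x), fun x => ?_, fun x => ?_, fun x => ?_⟩
  · refine HasDerivAt.of_comp_left hSc.continuousAt (hΓd (S x)) ((hFd x).div_const I)
      (hgpos _).ne' (Filter.Eventually.of_forall hS)
  · exact div_pos (div_pos (hfpos x) hI) (hgpos _)
  · have := (hgpos (S x)).ne'
    field_simp

/-- Scaling factors making the transport maps standard Gaussian; the value at `t ^ 2 = 1` is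
irrelevant as long as it is positive. -/
def scale (t : ℝ) : ℝ := if t ^ 2 = 1 then 1 else √(1 - t ^ 2)

lemma scale_pos {t : ℝ} (ht : t ^ 2 ≤ 1) : 0 < scale t := by
  unfold scale
  split_ifs with h
  · exact one_pos
  · exact sqrt_pos.2 (sub_pos.2 (lt_of_le_of_ne ht h))

lemma exp_neg_le_scale_rpow {t : ℝ} (ht : t ^ 2 ≤ 1) :
    exp (-(t ^ 2 / 2)) ≤ scale t ^ (1 - t ^ 2) := by
  unfold scale
  split_ifs with h
  · simp [h]
  · have hc : 0 < 1 - t ^ 2 := sub_pos.2 (lt_of_le_of_ne ht h)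
    rw [rpow_def_of_pos (sqrt_pos.2 hc), exp_le_exp, log_sqrt hc.le]
    have h1 := one_sub_inv_le_log_of_pos hc
    have h2 : (1 - t ^ 2) * (1 - (1 - t ^ 2)⁻¹) ≤ (1 - t ^ 2) * log (1 - t ^ 2) :=
      mul_le_mul_of_nonneg_left h1 hc.le
    rw [mul_sub, mul_inv_cancel₀ hc.ne'] at h2
    linarith

lemma sum_scale_mul_sq_sub_le {ι : Type*} [Fintype ι] {t : ι → ℝ} (ht : ∑ j, t j ^ 2 = 1)
    (z : ι → ℝ) :
    ∑ j, (scale (t j) * z j) ^ 2 - (∑ j, t j * (scale (t j) * z j)) ^ 2 ≤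
      ∑ j, (1 - t j ^ 2) * z j ^ 2 := by
  classical
  have hle : ∀ j, t j ^ 2 ≤ 1 := fun j =>
    ht ▸ Finset.single_le_sum (f := fun j => t j ^ 2) (fun i _ => sq_nonneg _) (Finset.mem_univ j)
  by_cases h : ∃ k, t k ^ 2 = 1
  · obtain ⟨k, hk⟩ := h
    have h0 : ∀ i, i ≠ k → t i = 0 := by
      intro i hi
      rw [← Finset.add_sum_erase _ _ (Finset.mem_univ k), hk, add_eq_left] at ht
      exact pow_eq_zero_iff two_ne_zero |>.1 ((Finset.sum_eq_zero_iff_of_nonneg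
        fun j _ => sq_nonneg (t j)).1 ht i (Finset.mem_erase.2 ⟨hi, Finset.mem_univ i⟩))
    have h1 : ∀ j, scale (t j) = 1 := by
      intro j
      unfold scale
      split_ifs with h
      · rfl
      · rw [h0 j (by rintro rfl; exact h hk)]
        simp
    have h2 : ∑ j, t j * (scale (t j) * z j) = t k * z k := by
      rw [Finset.sum_eq_single k (fun i _ hi => by simp [h0 i hi]) (by simp), h1, one_mul]
    have h3 : ∑ j, t j ^ 2 * z j ^ 2 = z k ^ 2 := by
      rw [Finset.sum_eq_single k (fun i _ hi => by simp [h0 i hi]) (by simp), hk, one_mul]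
    rw [h2, mul_pow, hk]
    simp only [h1, one_mul, sub_mul, Finset.sum_sub_distrib, h3, le_refl]
  · push Not at h
    have h1 : ∀ j, (scale (t j) * z j) ^ 2 = (1 - t j ^ 2) * z j ^ 2 := by
      intro j
      rw [mul_pow, scale, if_neg (h j), sq_sqrt (sub_nonneg.2 (hle j))]
    simp only [h1]
    linarith [sq_nonneg (∑ j, t j * (scale (t j) * z j))]

lemma prod_gaussianPDFReal_rpow_le {ι : Type*} [Fintype ι] {t : ι → ℝ} (ht : ∑ j, t j ^ 2 = 1)
    {v z : ι → ℝ} {u : ℝ} (h : ∑ j, v j ^ 2 - u ^ 2 ≤ ∑ j, (1 - t j ^ 2) * z j ^ 2) :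
    ∏ j, gaussianPDFReal 0 1 (z j) ^ (1 - t j ^ 2) ≤
      (∏ j, gaussianPDFReal 0 1 (v j)) * (gaussianPDFReal 0 1 u)⁻¹ := by
  set K : ℝ := log (√(2 * π))⁻¹ with hK
  have hpdf : ∀ x, gaussianPDFReal 0 1 x = exp (K - x ^ 2 / 2) := by
    intro x
    rw [sub_eq_add_neg, exp_add, hK, exp_log (by positivity)]
    simp [gaussianPDFReal, neg_div]
  simp only [hpdf, ← exp_mul, ← exp_sum, ← exp_neg, ← exp_add]
  rw [exp_le_exp]
  have h1 : ∑ j, (K - z j ^ 2 / 2) * (1 - t j ^ 2) =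
      ∑ _ : ι, K - K * ∑ j, t j ^ 2 - (∑ j, (1 - t j ^ 2) * z j ^ 2) / 2 := by
    rw [Finset.mul_sum, Finset.sum_div, ← Finset.sum_sub_distrib, ← Finset.sum_sub_distrib]
    exact Finset.sum_congr rfl fun j _ => by ring
  rw [h1, ht, Finset.sum_sub_distrib, ← Finset.sum_div]
  linarith

/-- A one-dimensional geometric Brascamp–Lieb inequality. -/
lemma lintegral_prod_rpow_mul_comp_sum_le {ι : Type*} [Fintype ι] {t : ι → ℝ}
    (ht : ∑ j, t j ^ 2 = 1) {f : ι → ℝ → ℝ} (hf : ∀ j, Continuous (f j))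
    (hfi : ∀ j, Integrable (f j)) (hfpos : ∀ j x, 0 < f j x) {φ : ℝ → ℝ≥0∞} (hφ : Measurable φ) :
    ∫⁻ x : ι → ℝ, ENNReal.ofReal (∏ j, f j (x j) ^ (1 - t j ^ 2)) * φ (∑ j, t j * x j) ≤
      ENNReal.ofReal (exp (1 / 2) * ∏ j, (∫ y, f j y) ^ (1 - t j ^ 2)) * ∫⁻ u, φ u := by
  have hle : ∀ j, t j ^ 2 ≤ 1 := fun j =>
    ht ▸ Finset.single_le_sum (f := fun j => t j ^ 2) (fun i _ => sq_nonneg _) (Finset.mem_univ j)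
  set γ := gaussianPDFReal 0 1 with hγ
  have hγpos : ∀ x, 0 < γ x := fun x => gaussianPDFReal_pos _ _ x one_ne_zero
  have hγc : Continuous γ := by
    rw [hγ, gaussianPDFReal_def]
    fun_prop
  have hex := fun j => exists_transport_s2 (hf j) (hfi j) (hfpos j) hγc
    (integrable_gaussianPDFReal 0 1) hγpos (integral_gaussianPDFReal_eq_one 0 one_ne_zero)
  choose S S' hS hS' hfS using hex
  have hIpos : ∀ j, 0 < ∫ y, f j y := by
    intro j
    have h1 := hfpos j 0
    rw [hfS j 0] at h1
    exact pos_of_mul_pos_left h1 (mul_pos (hγpos _) (hS' j 0)).le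
  set T : ι → ℝ → ℝ := fun j x => scale (t j) * S j x with hT
  set d : ι → ℝ → ℝ := fun j x => scale (t j) * S' j x with hd
  have hTd : ∀ j x, HasDerivAt (T j) (d j x) x := fun j x => (hS j x).const_mul _
  have hdpos : ∀ j x, 0 < d j x := fun j x => mul_pos (scale_pos (hle j)) (hS' j x)
  set C := exp (1 / 2) * ∏ j, (∫ y, f j y) ^ (1 - t j ^ 2)
  have hreal : ∀ x : ι → ℝ, ∏ j, f j (x j) ^ (1 - t j ^ 2) ≤
      C * ((∏ j, d j (x j) ^ (1 - t j ^ 2)) *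
        ((∏ j, γ (twist t T x j)) * (γ (∑ j, t j * x j))⁻¹)) := by
    intro x
    have h1 : ∏ j, γ (S j (x j)) ^ (1 - t j ^ 2) ≤
        (∏ j, γ (twist t T x j)) * (γ (∑ j, t j * x j))⁻¹ := by
      apply prod_gaussianPDFReal_rpow_le ht
      rw [sum_twist_sq ht]
      linarith [sum_scale_mul_sq_sub_le ht fun j => S j (x j)]
    have h2 : 1 ≤ exp (1 / 2) * ∏ j, scale (t j) ^ (1 - t j ^ 2) := by
      calc (1 : ℝ) = exp (1 / 2) * ∏ j, exp (-(t j ^ 2 / 2)) := by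
            rw [← exp_sum, Finset.sum_neg_distrib, ← Finset.sum_div, ht, ← exp_add]
            simp
        _ ≤ _ := by
            gcongr with j
            exact exp_neg_le_scale_rpow (hle j)
    have h3 : ∏ j, f j (x j) ^ (1 - t j ^ 2) = (∏ j, (∫ y, f j y) ^ (1 - t j ^ 2)) *
        ((∏ j, S' j (x j) ^ (1 - t j ^ 2)) * ∏ j, γ (S j (x j)) ^ (1 - t j ^ 2)) := by
      rw [← Finset.prod_mul_distrib, ← Finset.prod_mul_distrib]
      refine Finset.prod_congr rfl fun j _ => ?_
      rw [hfS j (x j), mul_rpow (hIpos j).le (mul_pos (hγpos _) (hS' j _)).le,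
        mul_rpow (hγpos _).le (hS' j _).le]
      ring
    have h4 : ∏ j, d j (x j) ^ (1 - t j ^ 2) =
        (∏ j, scale (t j) ^ (1 - t j ^ 2)) * ∏ j, S' j (x j) ^ (1 - t j ^ 2) := by
      rw [← Finset.prod_mul_distrib]
      exact Finset.prod_congr rfl fun j _ => mul_rpow (scale_pos (hle j)).le (hS' j _).le
    have hA : 0 ≤ ∏ j, (∫ y, f j y) ^ (1 - t j ^ 2) :=
      Finset.prod_nonneg fun j _ => rpow_nonneg (hIpos j).le _
    have hB : 0 ≤ ∏ j, S' j (x j) ^ (1 - t j ^ 2) :=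
      Finset.prod_nonneg fun j _ => rpow_nonneg (hS' j _).le _
    have hD : 0 ≤ ∏ j, γ (S j (x j)) ^ (1 - t j ^ 2) :=
      Finset.prod_nonneg fun j _ => rpow_nonneg (hγpos _).le _
    rw [h3, h4]
    calc (∏ j, (∫ y, f j y) ^ (1 - t j ^ 2)) *
          ((∏ j, S' j (x j) ^ (1 - t j ^ 2)) * ∏ j, γ (S j (x j)) ^ (1 - t j ^ 2))
        ≤ (∏ j, (∫ y, f j y) ^ (1 - t j ^ 2)) * ((∏ j, S' j (x j) ^ (1 - t j ^ 2)) *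
          ((∏ j, γ (twist t T x j)) * (γ (∑ j, t j * x j))⁻¹)) := by gcongr
      _ ≤ (exp (1 / 2) * ∏ j, scale (t j) ^ (1 - t j ^ 2)) *
          ((∏ j, (∫ y, f j y) ^ (1 - t j ^ 2)) * ((∏ j, S' j (x j) ^ (1 - t j ^ 2)) *
          ((∏ j, γ (twist t T x j)) * (γ (∑ j, t j * x j))⁻¹))) :=
        le_mul_of_one_le_left (mul_nonneg hA (mul_nonneg hB (hD.trans h1))) h2
      _ = _ := by ring
  have hC : 0 ≤ C := mul_nonneg (exp_nonneg _)
    (Finset.prod_nonneg fun j _ => rpow_nonneg (hIpos j).le _)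
  set G : (ι → ℝ) → ℝ≥0∞ := fun v => ENNReal.ofReal (∏ j, γ (v j)) *
    (ENNReal.ofReal (γ (∑ j, t j * v j))⁻¹ * φ (∑ j, t j * v j)) with hG
  have hGint : ∫⁻ v, G v = ∫⁻ u, φ u := by
    rw [lintegral_comp_sum_mul_gaussian t ht
      (ψ := fun u => ENNReal.ofReal (γ u)⁻¹ * φ u)
      ((hγc.measurable.inv.ennreal_ofReal).mul hφ)]
    refine lintegral_congr fun u => ?_
    rw [← mul_assoc, ← ENNReal.ofReal_mul (hγpos u).le, mul_inv_cancel₀ (hγpos u).ne',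
      ENNReal.ofReal_one, one_mul]
  calc ∫⁻ x : ι → ℝ, ENNReal.ofReal (∏ j, f j (x j) ^ (1 - t j ^ 2)) * φ (∑ j, t j * x j)
      ≤ ∫⁻ x : ι → ℝ, ENNReal.ofReal C *
        (ENNReal.ofReal (∏ j, d j (x j) ^ (1 - t j ^ 2)) * G (twist t T x)) := by
        refine lintegral_mono fun x => ?_
        have hP : 0 ≤ ∏ j, d j (x j) ^ (1 - t j ^ 2) :=
          Finset.prod_nonneg fun j _ => rpow_nonneg (hdpos j _).le _
        have hQ : 0 ≤ ∏ j, γ (twist t T x j) := Finset.prod_nonneg fun j _ => (hγpos _).le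
        simp only [hG]
        rw [sum_mul_twist ht, ← mul_assoc (ENNReal.ofReal (∏ j, γ (twist t T x j))),
          ← ENNReal.ofReal_mul hQ, ← mul_assoc, ← mul_assoc, ← ENNReal.ofReal_mul hC,
          ← ENNReal.ofReal_mul (mul_nonneg hC hP), mul_assoc C]
        gcongr
        exact hreal x
    _ = ENNReal.ofReal C * ∫⁻ x : ι → ℝ,
        (ENNReal.ofReal (∏ j, d j (x j) ^ (1 - t j ^ 2)) * G (twist t T x)) :=
        lintegral_const_mul' _ _ ENNReal.ofReal_ne_top
    _ ≤ ENNReal.ofReal C * ∫⁻ u, φ u := by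
        rw [← hGint]
        exact mul_le_mul' le_rfl (lintegral_comp_twist_le ht hTd hdpos G)

/-- Continuous positive functions decaying at least like a product of Cauchy densities. -/
structure IsCauchyDominated {n : ℕ} (f : (Fin n → ℝ) → ℝ) : Prop where
  continuous : Continuous f
  pos : ∀ x, 0 < f x
  bound : ∃ A, ∀ x, f x ≤ A * ∏ i, (1 + x i ^ 2)⁻¹

lemma integrable_prod_inv_one_add_sq (n : ℕ) :
    Integrable fun x : Fin n → ℝ => ∏ i, (1 + x i ^ 2)⁻¹ :=
  Integrable.fintype_prod (f := fun _ x => (1 + x ^ 2)⁻¹) fun _ => integrable_inv_one_add_sq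

lemma prod_inv_one_add_sq_pos {n : ℕ} (x : Fin n → ℝ) : 0 < ∏ i, (1 + x i ^ 2)⁻¹ :=
  Finset.prod_pos fun _ _ => by positivity

lemma prod_inv_one_add_sq_le_one {n : ℕ} (x : Fin n → ℝ) : ∏ i, (1 + x i ^ 2)⁻¹ ≤ 1 :=
  Finset.prod_le_one (fun _ _ => by positivity) fun i _ =>
    inv_le_one_of_one_le₀ (by nlinarith [sq_nonneg (x i)])

lemma piFinSuccAbove_zero_symm (n : ℕ) :
    ⇑(MeasurableEquiv.piFinSuccAbove (fun _ : Fin (n + 1) => ℝ) 0).symm =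
      fun p => Fin.cons p.1 p.2 := by
  ext p i
  refine Fin.cases ?_ (fun i => ?_) i <;> simp [MeasurableEquiv.piFinSuccAbove]

lemma continuous_finCons (n : ℕ) :
    Continuous fun p : ℝ × (Fin n → ℝ) => (Fin.cons p.1 p.2 : Fin (n + 1) → ℝ) :=
  Continuous.finCons (A := fun _ => ℝ) continuous_fst continuous_snd

namespace IsCauchyDominated

variable {n : ℕ}

lemma integrable {f : (Fin n → ℝ) → ℝ} (hf : IsCauchyDominated f) : Integrable f := by
  obtain ⟨A, hA⟩ := hf.bound
  refine ((integrable_prod_inv_one_add_sq n).const_mul A).mono'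
    hf.continuous.aestronglyMeasurable (ae_of_all _ fun x => ?_)
  rw [norm_of_nonneg (hf.pos x).le]
  exact hA x

lemma exists_cons_le {f : (Fin (n + 1) → ℝ) → ℝ} (hf : IsCauchyDominated f) :
    ∃ A, 0 ≤ A ∧ ∀ z y, f (Fin.cons z y) ≤ A * (∏ i, (1 + y i ^ 2)⁻¹) * (1 + z ^ 2)⁻¹ := by
  obtain ⟨A, hA⟩ := hf.bound
  refine ⟨A, ?_, fun z y => ?_⟩
  · have h := (hf.pos 0).trans_le (hA 0)
    exact (pos_of_mul_pos_left h (prod_inv_one_add_sq_pos _).le).le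
  · refine (hA _).trans_eq ?_
    rw [Fin.prod_univ_succ]
    simp only [Fin.cons_zero, Fin.cons_succ]
    ring

lemma continuous_cons {f : (Fin (n + 1) → ℝ) → ℝ} (hf : IsCauchyDominated f) :
    Continuous fun p : ℝ × (Fin n → ℝ) => f (Fin.cons p.1 p.2) :=
  hf.continuous.comp (continuous_finCons n)

lemma continuous_slice {f : (Fin (n + 1) → ℝ) → ℝ} (hf : IsCauchyDominated f) (y : Fin n → ℝ) :
    Continuous fun z => f (Fin.cons z y) :=
  hf.continuous_cons.comp (continuous_id.prodMk continuous_const)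

lemma integrable_slice {f : (Fin (n + 1) → ℝ) → ℝ} (hf : IsCauchyDominated f) (y : Fin n → ℝ) :
    Integrable fun z => f (Fin.cons z y) := by
  obtain ⟨A, -, hA⟩ := hf.exists_cons_le
  refine (integrable_inv_one_add_sq.const_mul (A * ∏ i, (1 + y i ^ 2)⁻¹)).mono'
    (hf.continuous_slice y).aestronglyMeasurable (ae_of_all _ fun z => ?_)
  rw [norm_of_nonneg (hf.pos _).le]
  exact hA z y

/-- Integrating out the first coordinate preserves domination. -/
lemma marginal {f : (Fin (n + 1) → ℝ) → ℝ} (hf : IsCauchyDominated f) :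
    IsCauchyDominated fun y : Fin n → ℝ => ∫ z, f (Fin.cons z y) := by
  obtain ⟨A, hA0, hA⟩ := hf.exists_cons_le
  refine ⟨?_, fun y => ?_, A * π, fun y => ?_⟩
  · refine continuous_of_dominated (bound := fun z => A * (1 + z ^ 2)⁻¹)
      (fun y => (hf.continuous_slice y).aestronglyMeasurable)
      (fun y => ae_of_all _ fun z => ?_) (integrable_inv_one_add_sq.const_mul A)
      (ae_of_all _ fun z => hf.continuous_cons.comp (continuous_const.prodMk continuous_id))
    rw [norm_of_nonneg (hf.pos _).le]
    refine (hA z y).trans ?_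
    gcongr
    exact mul_le_of_le_one_right hA0 (prod_inv_one_add_sq_le_one y)
  · refine (integral_pos_iff_support_of_nonneg (fun z => (hf.pos _).le)
      (hf.integrable_slice y)).2 ?_
    have : Function.support (fun z => f (Fin.cons z y)) = Set.univ :=
      Set.eq_univ_of_forall fun z => (hf.pos _).ne'
    rw [this]
    simp
  · calc ∫ z, f (Fin.cons z y) ≤ ∫ z, A * (∏ i, (1 + y i ^ 2)⁻¹) * (1 + z ^ 2)⁻¹ :=
          integral_mono (hf.integrable_slice y)
            (integrable_inv_one_add_sq.const_mul _) fun z => hA z y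
      _ = A * π * ∏ i, (1 + y i ^ 2)⁻¹ := by
          rw [integral_const_mul, integral_univ_inv_one_add_sq]
          ring

lemma integral_marginal {f : (Fin (n + 1) → ℝ) → ℝ} (hf : IsCauchyDominated f) :
    ∫ y : Fin n → ℝ, ∫ z, f (Fin.cons z y) = ∫ x, f x := by
  have hmp := (volume_preserving_piFinSuccAbove (fun _ : Fin (n + 1) => ℝ) 0).symm
  have h_int := (hmp.integrable_comp_emb (MeasurableEquiv.measurableEmbedding _) (g := f)).2
    hf.integrable
  rw [← hmp.integral_comp (MeasurableEquiv.measurableEmbedding _) f]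
  rw [piFinSuccAbove_zero_symm] at h_int ⊢
  exact (integral_prod_symm _ h_int).symm

end IsCauchyDominated

/-- The first coordinates together with the remaining coordinates of a family of vectors. -/
lemma measurePreserving_pi_cons (ι : Type*) [Fintype ι] (n : ℕ) :
    MeasurePreserving fun (p : (ι → ℝ) × (ι → Fin n → ℝ)) (j : ι) =>
      (Fin.cons (p.1 j) (p.2 j) : Fin (n + 1) → ℝ) := by
  have h1 := (volume_measurePreserving_arrowProdEquivProdArrow ℝ (Fin n → ℝ) ι).symm
  have h2 := volume_preserving_pi fun _ : ι =>
    (volume_preserving_piFinSuccAbove (fun _ : Fin (n + 1) => ℝ) 0).symm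
  rw [piFinSuccAbove_zero_symm] at h2
  exact h2.comp h1

/-- A geometric Brascamp–Lieb inequality for continuous densities with product decay. -/
theorem lintegral_prod_rpow_mul_comp_sum_smul_le {ι : Type*} [Fintype ι] {t : ι → ℝ}
    (ht : ∑ j, t j ^ 2 = 1) {n : ℕ} {f : ι → (Fin n → ℝ) → ℝ}
    (hf : ∀ j, IsCauchyDominated (f j)) {φ : (Fin n → ℝ) → ℝ≥0∞} (hφ : Measurable φ) :
    ∫⁻ x : ι → Fin n → ℝ,
        ENNReal.ofReal (∏ j, f j (x j) ^ (1 - t j ^ 2)) * φ (∑ j, t j • x j) ≤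
      ENNReal.ofReal (exp (1 / 2) ^ n * ∏ j, (∫ y, f j y) ^ (1 - t j ^ 2)) * ∫⁻ u, φ u := by
  induction n with
  | zero =>
    simp_rw [lintegral_unique, integral_unique]
    have h (x y : Fin 0 → ℝ) : φ x = φ y := congrArg φ (Subsingleton.elim _ _)
    have hu : volume (Set.univ : Set (Fin 0 → ℝ)) = 1 := by simp [volume_pi]
    have hu' : volume (Set.univ : Set (ι → Fin 0 → ℝ)) = 1 := by
      rw [volume_pi, Measure.pi_univ]
      simp [hu]
    rw [h _ default, hu', hu, measureReal_def, hu]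
    simp only [pow_zero, one_mul, ENNReal.toReal_one, one_smul, mul_one]
    apply le_of_eq
    congr!
  | succ n ih =>
    have hpre : ∀ p : (ι → ℝ) × (ι → Fin n → ℝ),
        ∑ j, t j • (Fin.cons (p.1 j) (p.2 j) : Fin (n + 1) → ℝ) =
          Fin.cons (∑ j, t j * p.1 j) (∑ j, t j • p.2 j) := by
      intro p
      ext i
      refine Fin.cases ?_ (fun i => ?_) i <;> simp [Finset.sum_apply]
    have hcons : Measurable fun p : ℝ × (Fin n → ℝ) => (Fin.cons p.1 p.2 : Fin (n + 1) → ℝ) :=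
      (continuous_finCons n).measurable
    have hφc : Measurable fun p : ℝ × (Fin n → ℝ) => φ (Fin.cons p.1 p.2) := hφ.comp hcons
    have hfm : ∀ j, Measurable (f j) := fun j => (hf j).continuous.measurable
    have hF : Measurable fun x : ι → Fin (n + 1) → ℝ =>
        ENNReal.ofReal (∏ j, f j (x j) ^ (1 - t j ^ 2)) * φ (∑ j, t j • x j) := by
      fun_prop
    rw [← (measurePreserving_pi_cons ι n).lintegral_comp hF]
    have hF' := hF.comp (measurePreserving_pi_cons ι n).measurable
    rw [Measure.volume_eq_prod]
    refine (lintegral_prod_symm _ hF'.aemeasurable).trans_le ?_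
    have hφ' : Measurable fun y : Fin n → ℝ => ∫⁻ u, φ (Fin.cons u y) :=
      hφc.lintegral_prod_left'
    calc ∫⁻ y : ι → Fin n → ℝ, ∫⁻ z : ι → ℝ,
          ENNReal.ofReal (∏ j, f j (Fin.cons (z j) (y j)) ^ (1 - t j ^ 2)) *
            φ (∑ j, t j • (Fin.cons (z j) (y j) : Fin (n + 1) → ℝ))
        ≤ ∫⁻ y : ι → Fin n → ℝ, ENNReal.ofReal (exp (1 / 2)) *
            (ENNReal.ofReal (∏ j, (∫ z, f j (Fin.cons z (y j))) ^ (1 - t j ^ 2)) *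
              ∫⁻ u, φ (Fin.cons u (∑ j, t j • y j))) := by
          refine lintegral_mono fun y => ?_
          rw [← mul_assoc, ← ENNReal.ofReal_mul (exp_pos _).le]
          refine le_trans (le_of_eq ?_) (lintegral_prod_rpow_mul_comp_sum_le ht
            (f := fun j z => f j (Fin.cons z (y j))) (fun j => (hf j).continuous_slice _)
            (fun j => (hf j).integrable_slice _) (fun j z => (hf j).pos _)
            (hφ.comp (hcons.comp (measurable_id.prodMk measurable_const)) :
              Measurable fun u => φ (Fin.cons u (∑ j, t j • y j))))
          exact lintegral_congr fun z => by rw [hpre (z, y)]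
      _ ≤ ENNReal.ofReal (exp (1 / 2)) *
            (ENNReal.ofReal (exp (1 / 2) ^ n *
              ∏ j, (∫ y : Fin n → ℝ, ∫ z, f j (Fin.cons z y)) ^ (1 - t j ^ 2)) *
              ∫⁻ y : Fin n → ℝ, ∫⁻ u, φ (Fin.cons u y)) := by
          rw [lintegral_const_mul' _ _ ENNReal.ofReal_ne_top]
          gcongr
          exact ih (fun j => (hf j).marginal) hφ'
      _ = _ := by
          have h := (volume_preserving_piFinSuccAbove (fun _ : Fin (n + 1) => ℝ) 0).symm
          rw [← h.lintegral_comp hφ, piFinSuccAbove_zero_symm, Measure.volume_eq_prod,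
            lintegral_prod_symm]
          · rw [← mul_assoc, ← ENNReal.ofReal_mul (exp_pos _).le, ← mul_assoc, ← pow_succ']
            simp_rw [(hf _).integral_marginal]
          · exact hφc.aemeasurable

lemma exists_isCauchyDominated_one_le {n : ℕ} {K : Set (Fin n → ℝ)} (hK : IsCompact K)
    (hKvol : volume K = 1) {ε : ℝ} (hε : 0 < ε) :
    ∃ f, IsCauchyDominated f ∧ (∀ x ∈ K, 1 ≤ f x) ∧ ∫ x, f x ≤ 1 + ε := by
  have hlt : volume K < ENNReal.ofReal (1 + ε / 2) := by
    rw [hKvol, ENNReal.one_lt_ofReal]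
    linarith
  rw [hK.measure_eq_biInf_integral_hasCompactSupport] at hlt
  simp only [iInf_lt_iff] at hlt
  obtain ⟨h, hcont, hsupp, hK1, h0, hlt⟩ := hlt
  have h_int : ∫ x, h x < 1 + ε / 2 := (ENNReal.ofReal_lt_ofReal_iff (by linarith)).1 hlt
  obtain ⟨A, hA⟩ := (hsupp.mul_right (f' := fun x => ∏ i, (1 + x i ^ 2))).exists_bound_of_continuous
    (hcont.mul (by fun_prop))
  set w : (Fin n → ℝ) → ℝ := fun x => ∏ i, (1 + x i ^ 2)⁻¹ with hw
  have hw0 : ∀ x, 0 < w x := prod_inv_one_add_sq_pos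
  have hwi : Integrable w := integrable_prod_inv_one_add_sq n
  have hwc : Continuous w := by
    refine continuous_finsetProd _ fun i _ => Continuous.inv₀ (by fun_prop) fun x => ?_
    positivity
  have hI : 0 ≤ ∫ x, w x := integral_nonneg fun x => (hw0 x).le
  set δ : ℝ := ε / 2 / (1 + ∫ x, w x) with hδ
  have hδ0 : 0 < δ := by positivity
  refine ⟨fun x => h x + δ * w x, ⟨by fun_prop, fun x => ?_, A + δ, fun x => ?_⟩,
    fun x hx => ?_, ?_⟩
  · exact add_pos_of_nonneg_of_pos (h0 x) (mul_pos hδ0 (hw0 x))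
  · rw [add_mul]
    gcongr
    have h1 := (le_abs_self _).trans (hA x)
    simp only [Pi.mul_apply] at h1
    rw [← div_le_iff₀ (hw0 x)]
    simpa [hw, Finset.prod_inv_distrib] using h1
  · have := hK1 hx
    simp only [Pi.one_apply] at this
    have := mul_pos hδ0 (hw0 x)
    linarith
  · rw [integral_add (hcont.integrable_of_hasCompactSupport hsupp) (hwi.const_mul δ),
      integral_const_mul]
    have : δ * ∫ x, w x ≤ ε / 2 := by
      rw [hδ, div_mul_eq_mul_div]
      refine div_le_of_le_mul₀ (by positivity) (by positivity) ?_
      gcongr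
      linarith
    linarith

lemma measurableSet_setOf_mem_and_sum_smul_mem {ι E : Type*} [Fintype ι] [AddCommMonoid E]
    [Module ℝ E] [MeasurableSpace E] [MeasurableAdd₂ E] [MeasurableConstSMul ℝ E] (t : ι → ℝ)
    {K : ι → Set E} (hK : ∀ j, MeasurableSet (K j)) {A : Set E} (hA : MeasurableSet A) :
    MeasurableSet {x : ι → E | (∀ j, x j ∈ K j) ∧ ∑ j, t j • x j ∈ A} := by
  have hsum : Measurable fun x : ι → E => ∑ j, t j • x j := by fun_prop
  have : {x : ι → E | (∀ j, x j ∈ K j) ∧ ∑ j, t j • x j ∈ A} =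
      Set.univ.pi K ∩ (fun x : ι → E => ∑ j, t j • x j) ⁻¹' A := by
    ext
    simp
  rw [this]
  exact (MeasurableSet.univ_pi hK).inter (hsum hA)

lemma volume_setOf_sum_smul_mem_le {ι : Type*} [Fintype ι] {t : ι → ℝ} (ht : ∑ j, t j ^ 2 = 1)
    {n : ℕ} {K : ι → Set (Fin n → ℝ)} (hK : ∀ j, IsCompact (K j)) (hKvol : ∀ j, volume (K j) = 1)
    {A : Set (Fin n → ℝ)} (hA : MeasurableSet A) (hAfin : volume A ≠ ∞) :
    volume {x : ι → Fin n → ℝ | (∀ j, x j ∈ K j) ∧ ∑ j, t j • x j ∈ A} ≤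
      ENNReal.ofReal (exp (1 / 2) ^ n) * volume A := by
  have ht0 : ∀ j, 0 ≤ 1 - t j ^ 2 := fun j => by
    have := Finset.single_le_sum (fun j _ => sq_nonneg (t j)) (Finset.mem_univ j)
    linarith
  set S := {x : ι → Fin n → ℝ | (∀ j, x j ∈ K j) ∧ ∑ j, t j • x j ∈ A} with hS
  have hSm : MeasurableSet S :=
    measurableSet_setOf_mem_and_sum_smul_mem t (fun j => (hK j).measurableSet) hA
  have key : ∀ ε : ℝ, 0 < ε → volume S ≤
      ENNReal.ofReal (exp (1 / 2) ^ n * ∏ j, (1 + ε) ^ (1 - t j ^ 2)) * volume A := by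
    intro ε hε
    choose f hf hf1 hfi using fun j => exists_isCauchyDominated_one_le (hK j) (hKvol j) hε
    calc volume S = ∫⁻ x, S.indicator 1 x := (lintegral_indicator_one hSm).symm
      _ ≤ ∫⁻ x : ι → Fin n → ℝ, ENNReal.ofReal (∏ j, f j (x j) ^ (1 - t j ^ 2)) *
            A.indicator 1 (∑ j, t j • x j) := by
          refine lintegral_mono (Set.indicator_le fun x hx => ?_)
          rw [Set.indicator_of_mem hx.2, Pi.one_apply, Pi.one_apply, mul_one, ENNReal.one_le_ofReal]
          exact Finset.one_le_prod fun j _ => one_le_rpow (hf1 j _ (hx.1 j)) (ht0 j)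
      _ ≤ ENNReal.ofReal (exp (1 / 2) ^ n * ∏ j, (∫ y, f j y) ^ (1 - t j ^ 2)) *
            ∫⁻ u, A.indicator 1 u :=
          lintegral_prod_rpow_mul_comp_sum_smul_le ht hf (measurable_one.indicator hA)
      _ ≤ _ := by
          rw [lintegral_indicator_one hA]
          have hi : ∀ j, 0 ≤ ∫ y, f j y := fun j => integral_nonneg fun y => ((hf j).pos y).le
          gcongr with j _
          · exact fun j _ => rpow_nonneg (hi j) _
          · exact hi j
          · exact ht0 j
          · exact hfi j
  have hlim : Filter.Tendsto (fun ε : ℝ =>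
      ENNReal.ofReal (exp (1 / 2) ^ n * ∏ j, (1 + ε) ^ (1 - t j ^ 2)) * volume A)
      (nhdsWithin 0 (Set.Ioi 0)) (nhds (ENNReal.ofReal (exp (1 / 2) ^ n) * volume A)) := by
    refine ENNReal.Tendsto.mul_const (ENNReal.tendsto_ofReal ?_) (Or.inr hAfin)
    have : ContinuousAt (fun ε : ℝ => exp (1 / 2) ^ n * ∏ j, (1 + ε) ^ (1 - t j ^ 2)) 0 := by
      refine continuousAt_const.mul (tendsto_finsetProd _ fun j _ => ?_)
      exact ContinuousAt.rpow_const (by fun_prop) (Or.inl (by norm_num))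
    simpa using this.tendsto.mono_left nhdsWithin_le_nhds
  exact ge_of_tendsto hlim (eventually_nhdsWithin_of_forall key)

lemma volume_setOf_sum_smul_mem_le_euclidean {ι : Type*} [Fintype ι] {t : ι → ℝ}
    (ht : ∑ j, t j ^ 2 = 1) {n : ℕ} {C : ι → Set (EuclideanSpace ℝ (Fin n))}
    (hC : ∀ j, IsCompact (C j)) (hCvol : ∀ j, volume (C j) = 1)
    {A : Set (EuclideanSpace ℝ (Fin n))} (hA : MeasurableSet A) (hAfin : volume A ≠ ∞) :
    volume {x : ι → EuclideanSpace ℝ (Fin n) | (∀ j, x j ∈ C j) ∧ ∑ j, t j • x j ∈ A} ≤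
      ENNReal.ofReal (exp (1 / 2) ^ n) * volume A := by
  have hmp := PiLp.volume_preserving_toLp (Fin n)
  have hmp' := volume_preserving_pi fun _ : ι => hmp
  have hvol {B : Set (EuclideanSpace ℝ (Fin n))} (hB : MeasurableSet B) :
      volume (WithLp.toLp 2 ⁻¹' B) = volume B := hmp.measure_preimage hB.nullMeasurableSet
  have hm := measurableSet_setOf_mem_and_sum_smul_mem t (fun j => (hC j).measurableSet) hA
  have h := volume_setOf_sum_smul_mem_le ht (K := fun j => WithLp.toLp 2 ⁻¹' C j)
    (fun j => (PiLp.homeomorph 2 (fun _ : Fin n => ℝ)).symm.isCompact_preimage.2 (hC j))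
    (fun j => (hvol (hC j).measurableSet).trans (hCvol j))
    (A := WithLp.toLp 2 ⁻¹' A) (hmp.measurable hA) (by rwa [hvol hA])
  rw [hvol hA] at h
  rw [← hmp'.measure_preimage hm.nullMeasurableSet]
  convert h using 2
  ext x
  simp [WithLp.toLp_sum]

end

/-- if `X₁,…,X_s` are independent random vectors uniformly distributed on
centrally symmetric convex bodies `C₁,…,C_s` of volume 1 in `ℝⁿ` (so that the joint
distribution is Lebesgue measure restricted to `C₁ × ⋯ × C_s`), `‖t‖₂ = 1`, and `g` is
the density of `t₁X₁ + ⋯ + t_sX_s`, then `‖g‖_∞ ≤ eⁿ`. -/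
theorem stmt2 {n s : ℕ}
    (C : Fin s → Set (EuclideanSpace ℝ (Fin n)))
    (hC : ∀ j, IsSymmConvexBody (C j)) (hCvol : ∀ j, volume (C j) = 1)
    (t : Fin s → ℝ) (ht : ∑ j, t j ^ 2 = 1)
    (g : EuclideanSpace ℝ (Fin n) → ℝ) (hg : Measurable g) (hg0 : ∀ x, 0 ≤ g x)
    (hdens :
      Measure.map (fun x : Fin s → EuclideanSpace ℝ (Fin n) => ∑ j, t j • x j)
          (volume.restrict (Set.univ.pi C))
        = volume.withDensity fun x => ENNReal.ofReal (g x)) :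
    essSup (fun x => ENNReal.ofReal (g x)) volume ≤ ENNReal.ofReal (Real.exp n) := by
  have hexp : exp (1 / 2) ^ n ≤ exp n := by
    rw [← exp_nat_mul, exp_le_exp]
    have : (0 : ℝ) ≤ n := n.cast_nonneg
    linarith
  have hsum : Measurable fun x : Fin s → EuclideanSpace ℝ (Fin n) => ∑ j, t j • x j := by
    fun_prop
  refine essSup_le_of_ae_le _ (ae_le_of_forall_setLIntegral_le_of_sigmaFinite
    hg.ennreal_ofReal fun A hA hAfin => ?_)
  rw [setLIntegral_const, ← withDensity_apply _ hA, ← hdens, Measure.map_apply hsum hA,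
    Measure.restrict_apply (hsum hA)]
  calc _ = volume {x : Fin s → EuclideanSpace ℝ (Fin n) |
        (∀ j, x j ∈ C j) ∧ ∑ j, t j • x j ∈ A} := by
        congr 1
        ext x
        simp [and_comm]
    _ ≤ ENNReal.ofReal (exp (1 / 2) ^ n) * volume A :=
        volume_setOf_sum_smul_mem_le_euclidean ht (fun j => (hC j).2.1) hCvol hA hAfin.ne
    _ ≤ _ := by gcongr
end
end

section
/- Let X₁,…,X_s be independent random vectors in ℝⁿ with log-concave densities g₁,…,g_s, and let t = (t₁,…,t_s) ∈ ℝˢ with t_j ≥ 0 and ‖t‖₂ = 1. If g_t denotes the density of t₁X₁ + ⋯ + t_sX_s, then ‖g_t‖_∞ ≤ eⁿ · ∏_{j=1}^s ‖g_j‖_∞^{t_j²}. -/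
open MeasureTheory Real
open scoped ENNReal RealInnerProductSpace

noncomputable section

/-- A function `g : ℝⁿ → [0,∞)` is log-concave: `g(ax+by) ≥ g(x)^a g(y)^b` whenever
`g(x), g(y) > 0`, `a, b ≥ 0`, `a + b = 1` (this encodes convexity of the support
together with concavity of `log g` on it). -/
def IsLogConcaveFun {n : ℕ} (g : EuclideanSpace ℝ (Fin n) → ℝ) : Prop :=
  ∀ x y : EuclideanSpace ℝ (Fin n), 0 < g x → 0 < g y →
    ∀ a b : ℝ, 0 ≤ a → 0 ≤ b → a + b = 1 →
      g x ^ a * g y ^ b ≤ g (a • x + b • y)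

section GaussianTransport

lemma lintegral_fin_pi_prod {n : ℕ} {E : Fin n → Type*}
    {mE : ∀ i, MeasurableSpace (E i)} (μ : (i : Fin n) → Measure (E i)) [∀ i, SigmaFinite (μ i)]
    (f : (i : Fin n) → E i → ℝ≥0∞) (hf : ∀ i, Measurable (f i)) :
    ∫⁻ x : (i : Fin n) → E i, ∏ i, f i (x i) ∂(Measure.pi μ) = ∏ i, ∫⁻ x, f i x ∂(μ i) := by
  induction n with
  | zero => simp
  | succ n ih =>
    have hF : Measurable fun z : E 0 × ((i : Fin n) → E i.succ) =>
        f 0 z.1 * ∏ i : Fin n, f i.succ (z.2 i) :=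
      ((hf 0).comp measurable_fst).mul (Finset.measurable_prod _ fun i _ =>
        (hf i.succ).comp ((measurable_pi_apply i).comp measurable_snd))
    have hP : Measurable fun z : (i : Fin n) → E i.succ => ∏ i : Fin n, f i.succ (z i) :=
      Finset.measurable_prod _ fun i _ => (hf i.succ).comp (measurable_pi_apply i)
    calc ∫⁻ x : (i : Fin (n + 1)) → E i, ∏ i, f i (x i) ∂(Measure.pi μ)
        = ∫⁻ z : E 0 × ((i : Fin n) → E i.succ), f 0 z.1 * ∏ i : Fin n, f i.succ (z.2 i)
            ∂((μ 0).prod (Measure.pi fun i => μ i.succ)) := by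
          refine Eq.trans ?_ ((measurePreserving_piFinSuccAbove μ 0).lintegral_comp hF)
          exact lintegral_congr fun x => Fin.prod_univ_succ _
      _ = (∫⁻ x, f 0 x ∂(μ 0)) * ∏ i : Fin n, ∫⁻ x, f i.succ x ∂(μ i.succ) := by
          rw [← ih _ _ fun i => hf i.succ]
          exact lintegral_prod_mul (hf 0).aemeasurable hP.aemeasurable
      _ = ∏ i, ∫⁻ x, f i x ∂(μ i) := (Fin.prod_univ_succ fun i => ∫⁻ x, f i x ∂(μ i)).symm

lemma Measure.pi_withDensity_fin {n : ℕ} {E : Fin n → Type*}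
    {mE : ∀ i, MeasurableSpace (E i)} (μ : (i : Fin n) → Measure (E i)) [∀ i, SigmaFinite (μ i)]
    (f : (i : Fin n) → E i → ℝ≥0∞) (hf : ∀ i, Measurable (f i))
    [∀ i, SigmaFinite ((μ i).withDensity (f i))] :
    Measure.pi (fun i => (μ i).withDensity (f i))
      = (Measure.pi μ).withDensity fun x => ∏ i, f i (x i) := by
  refine Measure.pi_eq fun s hs => ?_
  rw [withDensity_apply _ (MeasurableSet.univ_pi hs), Measure.restrict_pi_pi,
    lintegral_fin_pi_prod _ _ hf]
  exact Finset.prod_congr rfl fun i _ => (withDensity_apply _ (hs i)).symm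

lemma pi_gaussianReal_map_weightedSum {s : ℕ} (t : Fin s → ℝ) (ht : ∑ j, t j ^ 2 = 1) :
    (Measure.pi fun _ : Fin s => ProbabilityTheory.gaussianReal 0 1).map
      (fun x => ∑ j, t j * x j) = ProbabilityTheory.gaussianReal 0 1 := by
  have hm : Measurable fun x : Fin s → ℝ => ∑ j, t j * x j := by fun_prop
  have : IsProbabilityMeasure ((Measure.pi fun _ : Fin s =>
      ProbabilityTheory.gaussianReal 0 1).map (fun x => ∑ j, t j * x j)) :=
    Measure.isProbabilityMeasure_map hm.aemeasurable
  apply Measure.ext_of_charFun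
  ext u
  rw [charFun_apply_real, integral_map hm.aemeasurable (by fun_prop)]
  have : ∀ x : Fin s → ℝ, Complex.exp (u * ((∑ j, t j * x j : ℝ) : ℂ) * Complex.I)
      = ∏ j, Complex.exp (((u * t j : ℝ) : ℂ) * x j * Complex.I) := by
    intro x
    rw [← Complex.exp_sum]
    congr 1
    push_cast
    rw [Finset.mul_sum, Finset.sum_mul]
    exact Finset.sum_congr rfl fun j _ => by ring
  simp_rw [this]
  rw [integral_fintype_prod_eq_prod
    (f := fun j (y : ℝ) => Complex.exp (((u * t j : ℝ) : ℂ) * y * Complex.I))]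
  simp_rw [← charFun_apply_real, ProbabilityTheory.charFun_gaussianReal]
  rw [← Complex.exp_sum]
  congr 1
  have h2 : ∑ j, (t j : ℂ) ^ 2 = 1 := by exact_mod_cast ht
  simp only [Complex.ofReal_zero, mul_zero, zero_mul, zero_sub, NNReal.coe_one,
    Complex.ofReal_one, one_mul, Complex.ofReal_mul, mul_pow]
  rw [Finset.sum_neg_distrib, ← Finset.sum_div, ← Finset.mul_sum, h2, mul_one]

lemma lintegral_weightedSum_gaussian {s : ℕ} (t : Fin s → ℝ) (ht : ∑ j, t j ^ 2 = 1)
    (φ : ℝ → ℝ≥0∞) (hφ : Measurable φ) :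
    ∫⁻ y : Fin s → ℝ, φ (∑ j, t j * y j) / ProbabilityTheory.gaussianPDF 0 1 (∑ j, t j * y j)
        * ∏ j, ProbabilityTheory.gaussianPDF 0 1 (y j) = ∫⁻ w, φ w := by
  have hg := ProbabilityTheory.measurable_gaussianPDF 0 1
  have hgr : ProbabilityTheory.gaussianReal 0 1
      = volume.withDensity (ProbabilityTheory.gaussianPDF 0 1) :=
    ProbabilityTheory.gaussianReal_of_var_ne_zero 0 one_ne_zero
  have : SigmaFinite (volume.withDensity (ProbabilityTheory.gaussianPDF 0 1)) := by
    rw [← hgr]; infer_instance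
  have hpi := Measure.pi_withDensity_fin (fun _ : Fin s => (volume : Measure ℝ))
    (fun _ => ProbabilityTheory.gaussianPDF 0 1) (fun _ => hg)
  have hmap := pi_gaussianReal_map_weightedSum t ht
  rw [hgr, hpi] at hmap
  have hψ : Measurable fun w => φ w / ProbabilityTheory.gaussianPDF 0 1 w := hφ.div hg
  have hsum : Measurable fun x : Fin s → ℝ => ∑ j, t j * x j := by fun_prop
  have hprod : Measurable fun y : Fin s → ℝ => ∏ j, ProbabilityTheory.gaussianPDF 0 1 (y j) := by
    fun_prop
  calc _ = ∫⁻ w, φ w / ProbabilityTheory.gaussianPDF 0 1 w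
        ∂(volume.withDensity (ProbabilityTheory.gaussianPDF 0 1)) := by
        rw [← hmap, lintegral_map hψ hsum,
          lintegral_withDensity_eq_lintegral_mul (Measure.pi fun _ => volume) hprod
            (g := fun y => φ (∑ j, t j * y j) / ProbabilityTheory.gaussianPDF 0 1 (∑ j, t j * y j))
            (hψ.comp hsum)]
        exact lintegral_congr fun y => mul_comm _ _
    _ = _ := by
        rw [lintegral_withDensity_eq_lintegral_mul _ hg hψ]
        refine lintegral_congr fun w => ?_
        exact ENNReal.mul_div_cancel (ProbabilityTheory.gaussianPDF_pos 0 one_ne_zero w).ne'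
          ProbabilityTheory.gaussianPDF_ne_top

open Filter Topology Set ProbabilityTheory

lemma hasDerivAt_cdf_gaussianReal {v : NNReal} (hv : v ≠ 0) (y : ℝ) :
    HasDerivAt (cdf (gaussianReal 0 v)) (gaussianPDFReal 0 v y) y := by
  have hint := integrable_gaussianPDFReal 0 v
  have hcont : Continuous (gaussianPDFReal 0 v) := by
    rw [gaussianPDFReal_def]; fun_prop
  have h1 : ∀ x, cdf (gaussianReal 0 v) x = (∫ t in (0:ℝ)..x, gaussianPDFReal 0 v t)
      + ∫ t in Iic (0:ℝ), gaussianPDFReal 0 v t := by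
    intro x
    rw [cdf_eq_real, measureReal_def, gaussianReal_apply_eq_integral _ hv,
      ENNReal.toReal_ofReal (setIntegral_nonneg measurableSet_Iic fun t _ =>
        gaussianPDFReal_nonneg 0 v t),
      ← intervalIntegral.integral_Iic_sub_Iic hint.integrableOn hint.integrableOn]
    ring
  rw [funext h1]
  exact (hcont.integral_hasStrictDerivAt 0 y).hasDerivAt.add_const _

lemma Monotone.lt_of_hasDerivAt_pos {G : ℝ → ℝ} (hG : Monotone G) {x d : ℝ}
    (h : HasDerivAt G d x) (hd : 0 < d) :
    (∀ y, x < y → G x < G y) ∧ ∀ y, y < x → G y < G x := by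
  have hs := (hasDerivAt_iff_tendsto_slope.1 h).eventually (lt_mem_nhds hd)
  constructor
  · intro y hy
    have h1 : ∀ᶠ z in 𝓝[>] x, 0 < slope G x z :=
      hs.filter_mono (nhdsWithin_mono _ fun z hz => ne_of_gt hz)
    obtain ⟨z, hz, hz2⟩ := (h1.and (Ioo_mem_nhdsGT hy)).exists
    rw [slope_def_field, div_pos_iff_of_pos_right (by linarith [hz2.1])] at hz
    linarith [hG hz2.2.le]
  · intro y hy
    have h1 : ∀ᶠ z in 𝓝[<] x, 0 < slope G x z :=
      hs.filter_mono (nhdsWithin_mono _ fun z hz => ne_of_lt hz)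
    obtain ⟨z, hz, hz2⟩ := (h1.and (Ioo_mem_nhdsLT hy)).exists
    rw [slope_comm, slope_def_field, div_pos_iff_of_pos_right (by linarith [hz2.2])] at hz
    linarith [hG hz2.1.le]

/-- Quantile function of a centred Gaussian. -/
lemma exists_gaussian_quantile {v : NNReal} (hv : v ≠ 0) :
    ∃ q : ℝ → ℝ, StrictMonoOn q (Ioo 0 1) ∧
      ∀ u ∈ Ioo (0:ℝ) 1, HasDerivAt q (gaussianPDFReal 0 v (q u))⁻¹ u := by
  set F : ℝ → ℝ := ⇑(cdf (gaussianReal 0 v)) with hF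
  have hd := hasDerivAt_cdf_gaussianReal hv
  have hmono : StrictMono F := fun x y hxy =>
    ((monotone_cdf (gaussianReal 0 v)).lt_of_hasDerivAt_pos (hd x)
      (gaussianPDFReal_pos 0 v x hv)).1 y hxy
  have hcont : Continuous F := continuous_iff_continuousAt.2 fun x => (hd x).continuousAt
  have hex : ∀ u ∈ Ioo (0:ℝ) 1, ∃ y, F y = u := by
    intro u hu
    obtain ⟨a, ha⟩ := ((tendsto_cdf_atBot (gaussianReal 0 v)).eventually (gt_mem_nhds hu.1)).exists
    obtain ⟨b, hb⟩ := ((tendsto_cdf_atTop (gaussianReal 0 v)).eventually (lt_mem_nhds hu.2)).exists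
    exact mem_range_of_exists_le_of_exists_ge hcont ⟨a, ha.le⟩ ⟨b, hb.le⟩
  have hF01 : ∀ y, F y ∈ Ioo (0:ℝ) 1 := fun y =>
    ⟨(cdf_nonneg _ (y - 1)).trans_lt (hmono (by linarith)),
      (hmono (by linarith)).trans_le (cdf_le_one _ (y + 1))⟩
  choose! q hq using hex
  have hqF : ∀ y, q (F y) = y := fun y => hmono.injective (hq _ (hF01 y))
  have hqm : StrictMonoOn q (Ioo 0 1) := by
    intro a ha b hb hab
    rw [← hmono.lt_iff_lt, hq a ha, hq b hb]
    exact hab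
  have himg : q '' Ioo 0 1 = univ := eq_univ_of_forall fun y => ⟨F y, hF01 y, hqF y⟩
  refine ⟨q, hqm, fun u hu => ?_⟩
  have hn := Ioo_mem_nhds hu.1 hu.2
  have hqc : ContinuousAt q u :=
    hqm.continuousAt_of_image_mem_nhds hn (by rw [himg]; exact univ_mem)
  exact (hd (q u)).of_local_left_inverse hqc (gaussianPDFReal_pos 0 v _ hv).ne'
    (mem_of_superset hn fun z hz => hq z hz)

lemma exists_monotone_transport_gaussian {v : NNReal} (hv : v ≠ 0) (p : ℝ → ℝ≥0∞)
    (hp : Measurable p) (hp1 : ∫⁻ x, p x = 1) :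
    ∃ (T T' : ℝ → ℝ) (S : Set ℝ), MeasurableSet S ∧ StrictMonoOn T S ∧
      (∀ x ∈ S, HasDerivAt T (T' x) x ∧ 0 < T' x ∧
        p x = ENNReal.ofReal (T' x * gaussianPDFReal 0 v (T x))) ∧
      ∀ᵐ x, x ∉ S → p x = 0 := by
  obtain ⟨q, hqm, hqd⟩ := exists_gaussian_quantile hv
  set ν : Measure ℝ := volume.withDensity p with hν
  have : IsProbabilityMeasure ν := ⟨by simp [hν, hp1]⟩
  have hder : ∀ᵐ x, HasDerivAt (cdf ν) (p x).toReal x := by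
    have h1 := (cdf ν).ae_hasDerivAt
    rw [measure_cdf] at h1
    filter_upwards [h1, Measure.rnDeriv_withDensity volume hp] with x hx hx2
    rwa [hx2] at hx
  have hfin : ∀ᵐ x, p x < ∞ := ae_lt_top hp (by simp [hp1])
  set N : Set ℝ := {x | ¬ (HasDerivAt (cdf ν) (p x).toReal x ∧ p x < ∞)} with hN
  have hN0 : volume N = 0 := ae_iff.1 (hder.and hfin)
  set S : Set ℝ := (toMeasurable volume N)ᶜ ∩ {x | 0 < p x} with hS
  have hSprop : ∀ x ∈ S, HasDerivAt (cdf ν) (p x).toReal x ∧ p x < ∞ ∧ 0 < (p x).toReal := by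
    intro x hx
    have h1 : x ∉ N := fun h => hx.1 (subset_toMeasurable _ _ h)
    have h2 : HasDerivAt (cdf ν) (p x).toReal x ∧ p x < ∞ := not_not.1 h1
    exact ⟨h2.1, h2.2, ENNReal.toReal_pos hx.2.ne' h2.2.ne⟩
  have hlt := fun x hx => (monotone_cdf ν).lt_of_hasDerivAt_pos (hSprop x hx).1 (hSprop x hx).2.2
  have h01 : ∀ x ∈ S, cdf ν x ∈ Ioo (0:ℝ) 1 := fun x hx =>
    ⟨(cdf_nonneg _ (x - 1)).trans_lt ((hlt x hx).2 _ (by linarith)),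
      ((hlt x hx).1 _ (by linarith)).trans_le (cdf_le_one _ (x + 1))⟩
  refine ⟨fun x => q (cdf ν x),
    fun x => (gaussianPDFReal 0 v (q (cdf ν x)))⁻¹ * (p x).toReal, S,
    (measurableSet_toMeasurable _ _).compl.inter (measurableSet_lt measurable_const hp),
    fun x hx y hy hxy => hqm (h01 x hx) (h01 y hy) ((hlt x hx).1 y hxy), fun x hx => ?_, ?_⟩
  · have hpos := gaussianPDFReal_pos 0 v (q (cdf ν x)) hv
    obtain ⟨h1, h2, h3⟩ := hSprop x hx
    refine ⟨(hqd _ (h01 x hx)).comp x h1, by positivity, ?_⟩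
    rw [mul_right_comm, inv_mul_cancel₀ hpos.ne', one_mul, ENNReal.ofReal_toReal h2.ne]
  · have : ∀ᵐ x, x ∉ toMeasurable volume N := by
      rw [ae_iff]; simpa [measure_toMeasurable] using hN0
    filter_upwards [this] with x hx hxS
    by_contra h
    exact hxS ⟨hx, pos_iff_ne_zero.2 h⟩

lemma prod_rpow_le_det_diagonal_add_vecMulVec {s : ℕ} (t lam : Fin s → ℝ)
    (ht : ∑ j, t j ^ 2 = 1) (hl : ∀ j, 0 < lam j) :
    ∏ j, lam j ^ (1 - t j ^ 2)
      ≤ (Matrix.diagonal lam + Matrix.vecMulVec t fun j => t j * (1 - lam j)).det := by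
  have hdet : (Matrix.diagonal lam).det = ∏ j, lam j := Matrix.det_diagonal
  have hpos : 0 < ∏ j, lam j := Finset.prod_pos fun j _ => hl j
  have hinv : (Matrix.diagonal lam)⁻¹ = Matrix.diagonal fun j => (lam j)⁻¹ := by
    refine Matrix.inv_eq_right_inv ?_
    rw [Matrix.diagonal_mul_diagonal, ← Matrix.diagonal_one]
    congr 1
    ext j
    exact mul_inv_cancel₀ (hl j).ne'
  have hkey : (Matrix.diagonal lam + Matrix.vecMulVec t fun j => t j * (1 - lam j)).det
      = (∏ j, lam j) * ∑ j, t j ^ 2 * (lam j)⁻¹ := by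
    rw [Matrix.vecMulVec_eq Unit, Matrix.det_add_replicateCol_mul_replicateRow
      (by rw [hdet]; exact hpos.ne'.isUnit), hdet, hinv, Matrix.det_unique]
    congr 1
    rw [Matrix.add_apply, Matrix.mul_apply]
    simp only [Matrix.one_apply_eq, Matrix.mul_diagonal, Matrix.replicateRow_apply,
      Matrix.replicateCol_apply]
    have hterm : ∀ j, t j * (1 - lam j) * (lam j)⁻¹ * t j = t j ^ 2 * (lam j)⁻¹ - t j ^ 2 := by
      intro j
      have := (hl j).ne'
      field_simp
    simp_rw [hterm]
    rw [Finset.sum_sub_distrib, ht]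
    ring
  have hamgm := Real.geom_mean_le_arith_mean_weighted Finset.univ (fun j => t j ^ 2)
    (fun j => (lam j)⁻¹) (fun j _ => sq_nonneg _) ht fun j _ => (inv_pos.2 (hl j)).le
  rw [hkey]
  refine le_trans (le_of_eq ?_) (mul_le_mul_of_nonneg_left hamgm hpos.le)
  rw [← Finset.prod_mul_distrib]
  refine Finset.prod_congr rfl fun j _ => ?_
  rw [Real.rpow_sub (hl j), Real.rpow_one, Real.inv_rpow (hl j).le, div_eq_mul_inv]

lemma gaussianPDFReal_rpow_le {τ : ℝ} (hτ : τ ^ 2 < 1) (y : ℝ) :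
    gaussianPDFReal 0 (1 - τ ^ 2).toNNReal y ^ (1 - τ ^ 2)
      ≤ (exp (1 / 2) * √(2 * π)) ^ (τ ^ 2) * gaussianPDFReal 0 1 y := by
  set c := 1 - τ ^ 2 with hc
  have hc0 : 0 < c := by linarith
  have hπ : 0 < 2 * π := by positivity
  have hτc : τ ^ 2 = 1 - c := by linarith
  have hlog : -(c * log c) ≤ 1 - c := by
    have h := Real.log_le_sub_one_of_pos (inv_pos.2 hc0)
    rw [Real.log_inv] at h
    have h2 := mul_le_mul_of_nonneg_left h hc0.le
    rw [mul_sub, mul_inv_cancel₀ hc0.ne'] at h2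
    linarith
  have h1 : 0 < √(2 * π) := Real.sqrt_pos.2 hπ
  rw [hτc, gaussianPDFReal, gaussianPDFReal, Real.coe_toNNReal _ hc0.le]
  have e1 : (√(2 * π * c))⁻¹ = exp (-(log (2 * π) + log c) / 2) := by
    rw [← Real.log_mul hπ.ne' hc0.ne', Real.sqrt_eq_rpow, Real.rpow_def_of_pos (by positivity),
      ← Real.exp_neg]
    congr 1
    ring
  have e2 : (√(2 * π * (1 : NNReal)))⁻¹ = exp (-log (2 * π) / 2) := by
    rw [NNReal.coe_one, mul_one, Real.sqrt_eq_rpow, Real.rpow_def_of_pos (by positivity),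
      ← Real.exp_neg]
    congr 1
    ring
  have e3 : √(2 * π) = exp (log (2 * π) / 2) := by
    rw [Real.sqrt_eq_rpow, Real.rpow_def_of_pos (by positivity)]
    congr 1
    ring
  rw [e1, e2, e3, ← Real.exp_add, ← Real.exp_add, ← Real.exp_add, ← Real.exp_mul, ← Real.exp_mul,
    ← Real.exp_add, Real.exp_le_exp]
  have e4 : (-(y - 0) ^ 2 / (2 * c)) * c = -y ^ 2 / 2 := by
    field_simp
    ring
  rw [add_mul, e4, NNReal.coe_one]
  nlinarith

lemma prod_gaussianPDFReal_le {s : ℕ} (t y : Fin s → ℝ) (ht : ∑ j, t j ^ 2 = 1) (m : ℝ) :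
    √(2 * π) * ∏ j, gaussianPDFReal 0 1 (y j)
      ≤ (gaussianPDFReal 0 1 (∑ j, t j * (y j + t j * m)))⁻¹
        * ∏ j, gaussianPDFReal 0 1 (y j + t j * m) := by
  have hw : ∑ j, t j * (y j + t j * m) = ∑ j, t j * y j + m := by
    have : ∀ j, t j * (y j + t j * m) = t j * y j + t j ^ 2 * m := fun j => by ring
    simp_rw [this]
    rw [Finset.sum_add_distrib, ← Finset.sum_mul, ht, one_mul]
  have hq : ∑ j, (y j + t j * m) ^ 2 = ∑ j, y j ^ 2 + 2 * m * ∑ j, t j * y j + m ^ 2 := by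
    have : ∀ j, (y j + t j * m) ^ 2 = y j ^ 2 + 2 * m * (t j * y j) + t j ^ 2 * m ^ 2 :=
      fun j => by ring
    simp_rw [this]
    rw [Finset.sum_add_distrib, Finset.sum_add_distrib, ← Finset.sum_mul, ht, one_mul,
      ← Finset.mul_sum]
  rw [hw]
  simp only [gaussianPDFReal, NNReal.coe_one, mul_one, sub_zero, Finset.prod_mul_distrib,
    ← Real.exp_sum, mul_inv, inv_inv, ← Real.exp_neg]
  rw [mul_mul_mul_comm, ← Real.exp_add, ← mul_assoc]
  refine mul_le_mul_of_nonneg_left (Real.exp_le_exp.2 ?_) (by positivity)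
  rw [← Finset.sum_div, ← Finset.sum_div, Finset.sum_neg_distrib, Finset.sum_neg_distrib, hq]
  nlinarith [sq_nonneg (∑ j, t j * y j)]

lemma prod_transport_rpow_le {s : ℕ} (t x y lam : Fin s → ℝ) (ht : ∑ j, t j ^ 2 = 1)
    (ht1 : ∀ j, t j ^ 2 < 1) (hl : ∀ j, 0 < lam j) :
    ∏ j, (lam j * gaussianPDFReal 0 (1 - t j ^ 2).toNNReal (y j)) ^ (1 - t j ^ 2)
      ≤ exp (1 / 2) *
        (|(Matrix.diagonal lam + Matrix.vecMulVec t fun j => t j * (1 - lam j)).det| *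
          ((gaussianPDFReal 0 1 (∑ j, t j * x j))⁻¹ *
            ∏ j, gaussianPDFReal 0 1 (y j + t j * ∑ i, t i * (x i - y i)))) := by
  set m := ∑ i, t i * (x i - y i) with hm
  have hw : ∑ j, t j * x j = ∑ j, t j * (y j + t j * m) := by
    have : ∀ j, t j * (y j + t j * m) = t j * y j + t j ^ 2 * m := fun j => by ring
    simp_rw [this]
    rw [Finset.sum_add_distrib, ← Finset.sum_mul, ht, one_mul, hm, ← Finset.sum_add_distrib]
    exact Finset.sum_congr rfl fun j _ => by ring
  have h1 : ∏ j, gaussianPDFReal 0 (1 - t j ^ 2).toNNReal (y j) ^ (1 - t j ^ 2)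
      ≤ exp (1 / 2) * (√(2 * π) * ∏ j, gaussianPDFReal 0 1 (y j)) := by
    refine (Finset.prod_le_prod (fun j _ => Real.rpow_nonneg (gaussianPDFReal_nonneg _ _ _) _)
      fun j _ => gaussianPDFReal_rpow_le (ht1 j) (y j)).trans (le_of_eq ?_)
    rw [Finset.prod_mul_distrib, ← Real.rpow_sum_of_pos (by positivity), ht, Real.rpow_one,
      mul_assoc]
  have h2 := prod_rpow_le_det_diagonal_add_vecMulVec t lam ht hl
  have h3 := prod_gaussianPDFReal_le t y ht m
  simp_rw [fun j => Real.mul_rpow (hl j).le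
    (gaussianPDFReal_nonneg 0 (1 - t j ^ 2).toNNReal (y j)) (z := 1 - t j ^ 2)]
  rw [Finset.prod_mul_distrib, hw]
  calc _ ≤ |(Matrix.diagonal lam + Matrix.vecMulVec t fun j => t j * (1 - lam j)).det| *
        (exp (1 / 2) * ((gaussianPDFReal 0 1 (∑ j, t j * (y j + t j * m)))⁻¹
        * ∏ j, gaussianPDFReal 0 1 (y j + t j * m))) := by
        refine mul_le_mul (h2.trans (le_abs_self _)) (h1.trans ?_)
          (Finset.prod_nonneg fun j _ => Real.rpow_nonneg (gaussianPDFReal_nonneg _ _ _) _)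
          (abs_nonneg _)
        exact mul_le_mul_of_nonneg_left h3 (Real.exp_pos _).le
    _ = _ := by ring

/-- The linear map with matrix `diag(λ) + t ⊗ (t (1 - λ))` is the derivative of the transport. -/
lemma hasFDerivAt_transport {s : ℕ} (t : Fin s → ℝ) (T : Fin s → ℝ → ℝ) (x lam : Fin s → ℝ)
    (h : ∀ j, HasDerivAt (T j) (lam j) (x j)) :
    HasFDerivAt (fun x : Fin s → ℝ => fun i => T i (x i) + t i * ∑ j, t j * (x j - T j (x j)))
      (Matrix.toLin' (Matrix.diagonal lam +
        Matrix.vecMulVec t fun j => t j * (1 - lam j))).toContinuousLinearMap x := by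
  have hT : ∀ j, HasFDerivAt (fun x : Fin s → ℝ => T j (x j))
      (lam j • ContinuousLinearMap.proj (R := ℝ) (φ := fun _ : Fin s => ℝ) j) x := fun j =>
    (h j).comp_hasFDerivAt x (hasFDerivAt_apply j x)
  rw [hasFDerivAt_pi']
  intro i
  have hsum := HasFDerivAt.fun_sum (u := Finset.univ) fun j (_ : j ∈ Finset.univ) =>
    ((hasFDerivAt_apply (𝕜 := ℝ) j x).sub (hT j)).const_mul (t j)
  refine ((hT i).add (hsum.const_mul (t i))).congr_fderiv ?_
  ext v
  simp only [add_apply, smul_apply,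
    ContinuousLinearMap.proj_apply, sum_apply, sub_apply,
    ContinuousLinearMap.comp_apply, LinearMap.coe_toContinuousLinearMap', Matrix.toLin'_apply,
    Matrix.add_mulVec, Matrix.mulVec_diagonal, Matrix.vecMulVec_mulVec, dotProduct, Pi.add_apply,
    Pi.smul_apply, smul_eq_mul, MulOpposite.smul_eq_mul_unop, MulOpposite.unop_op]
  congr 2
  exact Finset.sum_congr rfl fun j _ => by ring

lemma injOn_transport {s : ℕ} (t : Fin s → ℝ) (ht0 : ∀ j, 0 ≤ t j) (ht : ∑ j, t j ^ 2 = 1)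
    (T : Fin s → ℝ → ℝ) (S : Fin s → Set ℝ) (hT : ∀ j, StrictMonoOn (T j) (S j)) :
    InjOn (fun x : Fin s → ℝ => fun i => T i (x i) + t i * ∑ j, t j * (x j - T j (x j)))
      (univ.pi S) := by
  intro x hx z hz hxz
  have hx' : ∀ j, x j ∈ S j := fun j => hx j (mem_univ j)
  have hz' : ∀ j, z j ∈ S j := fun j => hz j (mem_univ j)
  set a := ∑ j, t j * (x j - T j (x j)) with ha
  set b := ∑ j, t j * (z j - T j (z j)) with hb
  have hi : ∀ i, T i (x i) - T i (z i) = t i * (b - a) := by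
    intro i
    have := congrFun hxz i
    simp only at this
    linarith
  have hsum : ∑ j, t j * x j = ∑ j, t j * z j := by
    have h1 : ∑ j, t j * (T j (x j) - T j (z j)) = b - a := by
      simp_rw [hi, ← mul_assoc, ← pow_two]
      rw [← Finset.sum_mul, ht, one_mul]
    rw [ha, hb, ← Finset.sum_sub_distrib] at h1
    have h2 : ∑ j, (t j * x j - t j * z j) = 0 := by
      have h3 : ∀ j, t j * x j - t j * z j = t j * (T j (x j) - T j (z j))
          - (t j * (z j - T j (z j)) - t j * (x j - T j (x j))) := fun j => by ring
      simp_rw [h3]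
      rw [Finset.sum_sub_distrib, h1, sub_self]
    rw [Finset.sum_sub_distrib] at h2
    linarith
  have key : ∀ (x z : Fin s → ℝ), (∀ j, x j ∈ S j) → (∀ j, z j ∈ S j) →
      ∀ d, 0 ≤ d → (∀ i, T i (x i) - T i (z i) = t i * d) →
      ∑ j, t j * x j = ∑ j, t j * z j → x = z := by
    intro x z hx hz d hd hi hsum
    have hle : ∀ i, z i ≤ x i := fun i => by
      rw [← (hT i).le_iff_le (hz i) (hx i)]
      have := mul_nonneg (ht0 i) hd
      linarith [hi i]
    have hz0 : ∀ i, t i * z i = t i * x i := fun i =>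
      (Finset.sum_eq_sum_iff_of_le fun j _ => mul_le_mul_of_nonneg_left (hle j) (ht0 j)).1
        hsum.symm i (Finset.mem_univ i)
    ext i
    rcases eq_or_ne (t i) 0 with h | h
    · have := hi i
      rw [h, zero_mul, sub_eq_zero] at this
      exact (hT i).injOn (hx i) (hz i) this
    · exact (mul_left_cancel₀ h (hz0 i)).symm
  rcases le_total 0 (b - a) with h | h
  · exact key x z hx' hz' _ h hi hsum
  · exact (key z x hz' hx' (-(b - a)) (by linarith) (fun i => by linarith [hi i]) hsum.symm).symm

lemma lintegral_weightedSum_le_of_lintegral_eq_one {s : ℕ} (t : Fin s → ℝ) (ht0 : ∀ j, 0 ≤ t j)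
    (ht : ∑ j, t j ^ 2 = 1) (ht1 : ∀ j, t j ^ 2 < 1) (φ : ℝ → ℝ≥0∞) (hφ : Measurable φ)
    (p : Fin s → ℝ → ℝ≥0∞) (hp : ∀ j, Measurable (p j)) (hp1 : ∀ j, ∫⁻ x, p j x = 1) :
    ∫⁻ x : Fin s → ℝ, φ (∑ j, t j * x j) * ∏ j, p j (x j) ^ (1 - t j ^ 2)
      ≤ ENNReal.ofReal (exp (1 / 2)) * ∫⁻ w, φ w := by
  have hv : ∀ j, (1 - t j ^ 2).toNNReal ≠ 0 := fun j =>
    (Real.toNNReal_pos.2 (by linarith [ht1 j])).ne'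
  choose T T' S hSm hTm hTd hS0 using
    fun j => exists_monotone_transport_gaussian (hv j) (p j) (hp j) (hp1 j)
  set Θ : (Fin s → ℝ) → Fin s → ℝ :=
    fun x => fun i => T i (x i) + t i * ∑ j, t j * (x j - T j (x j)) with hΘ
  set M : (Fin s → ℝ) → Matrix (Fin s) (Fin s) ℝ := fun x =>
    Matrix.diagonal (fun j => T' j (x j)) +
      Matrix.vecMulVec t fun j => t j * (1 - T' j (x j)) with hM
  set H : (Fin s → ℝ) → ℝ≥0∞ := fun y =>
    φ (∑ j, t j * y j) / gaussianPDF 0 1 (∑ j, t j * y j) * ∏ j, gaussianPDF 0 1 (y j) with hH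
  have hSpi : MeasurableSet (univ.pi S) := MeasurableSet.univ_pi hSm
  have hΘd : ∀ x ∈ univ.pi S, HasFDerivWithinAt Θ
      (Matrix.toLin' (M x)).toContinuousLinearMap (univ.pi S) x := fun x hx =>
    (hasFDerivAt_transport t T x _ fun j => (hTd j _ (hx j (mem_univ j))).1).hasFDerivWithinAt
  have hcv := lintegral_image_eq_lintegral_abs_det_fderiv_mul volume hSpi hΘd
    (injOn_transport t ht0 ht T S hTm) H
  have hdet : ∀ x, ((Matrix.toLin' (M x)).toContinuousLinearMap).det = (M x).det := fun x => by
    rw [ContinuousLinearMap.det, LinearMap.coe_toContinuousLinearMap, LinearMap.det_toLin']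
  simp_rw [hdet] at hcv
  have hsumΘ : ∀ x, ∑ j, t j * Θ x j = ∑ j, t j * x j := by
    intro x
    have : ∀ j, t j * Θ x j = t j * T j (x j) + t j ^ 2 * ∑ i, t i * (x i - T i (x i)) :=
      fun j => by simp only [hΘ]; ring
    simp_rw [this]
    rw [Finset.sum_add_distrib, ← Finset.sum_mul, ht, one_mul, ← Finset.sum_add_distrib]
    exact Finset.sum_congr rfl fun j _ => by ring
  have hpt : ∀ x ∈ univ.pi S, φ (∑ j, t j * x j) * ∏ j, p j (x j) ^ (1 - t j ^ 2)
      ≤ ENNReal.ofReal (exp (1 / 2)) * (ENNReal.ofReal |(M x).det| * H (Θ x)) := by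
    intro x hx
    have hx' := fun j => hTd j _ (hx j (mem_univ j))
    have hpos : ∀ j, 0 < T' j (x j) * gaussianPDFReal 0 (1 - t j ^ 2).toNNReal (T j (x j)) :=
      fun j => mul_pos (hx' j).2.1 (gaussianPDFReal_pos _ _ _ (hv j))
    have hreal := prod_transport_rpow_le t x (fun j => T j (x j)) (fun j => T' j (x j)) ht ht1
      fun j => (hx' j).2.1
    have hle : ∏ j, p j (x j) ^ (1 - t j ^ 2) ≤ ENNReal.ofReal (exp (1 / 2)) *
        (ENNReal.ofReal |(M x).det| * ((gaussianPDF 0 1 (∑ j, t j * x j))⁻¹ *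
          ∏ j, gaussianPDF 0 1 (Θ x j))) := by
      have e1 : ∏ j, p j (x j) ^ (1 - t j ^ 2) = ENNReal.ofReal (∏ j,
          (T' j (x j) * gaussianPDFReal 0 (1 - t j ^ 2).toNNReal (T j (x j))) ^ (1 - t j ^ 2)) := by
        rw [ENNReal.ofReal_prod_of_nonneg fun j _ => Real.rpow_nonneg (hpos j).le _]
        exact Finset.prod_congr rfl fun j _ => by
          rw [(hx' j).2.2, ENNReal.ofReal_rpow_of_pos (hpos j)]
      rw [e1]
      refine (ENNReal.ofReal_le_ofReal hreal).trans (le_of_eq ?_)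
      rw [ENNReal.ofReal_mul (Real.exp_pos _).le, ENNReal.ofReal_mul (abs_nonneg _),
        ENNReal.ofReal_mul (inv_nonneg.2 (gaussianPDFReal_nonneg _ _ _)),
        ENNReal.ofReal_inv_of_pos (gaussianPDFReal_pos _ _ _ one_ne_zero),
        ENNReal.ofReal_prod_of_nonneg fun j _ => gaussianPDFReal_nonneg _ _ _]
      rfl
    refine (mul_le_mul_right hle _).trans (le_of_eq ?_)
    simp only [hH, hsumΘ, div_eq_mul_inv]
    ring
  have hae : ∀ᵐ x : Fin s → ℝ, ∀ j, x j ∉ S j → p j (x j) = 0 := by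
    rw [ae_all_iff]
    intro j
    exact (Measure.quasiMeasurePreserving_eval (fun _ : Fin s => (volume : Measure ℝ)) j).ae (hS0 j)
  calc ∫⁻ x : Fin s → ℝ, φ (∑ j, t j * x j) * ∏ j, p j (x j) ^ (1 - t j ^ 2)
      ≤ ∫⁻ x, (univ.pi S).indicator (fun x => ENNReal.ofReal (exp (1 / 2)) *
          (ENNReal.ofReal |(M x).det| * H (Θ x))) x := by
        refine lintegral_mono_ae ?_
        filter_upwards [hae] with x hx
        by_cases hxS : x ∈ univ.pi S
        · rw [indicator_of_mem hxS]
          exact hpt x hxS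
        · obtain ⟨j, hj⟩ : ∃ j, x j ∉ S j := by
            by_contra! h
            exact hxS fun j _ => h j
          have h0 : ∏ j, p j (x j) ^ (1 - t j ^ 2) = 0 :=
            Finset.prod_eq_zero (Finset.mem_univ j) (by
              rw [hx j hj, ENNReal.zero_rpow_of_pos (by linarith [ht1 j])])
          rw [h0, mul_zero]
          exact zero_le
    _ = ENNReal.ofReal (exp (1 / 2)) * ∫⁻ y in Θ '' univ.pi S, H y := by
        rw [lintegral_indicator hSpi, lintegral_const_mul' _ _ ENNReal.ofReal_ne_top, hcv]
    _ ≤ ENNReal.ofReal (exp (1 / 2)) * ∫⁻ y, H y := by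
        gcongr
        exact Measure.restrict_le_self
    _ = ENNReal.ofReal (exp (1 / 2)) * ∫⁻ w, φ w := by
        rw [lintegral_weightedSum_gaussian t ht φ hφ]

/-- The weighted convolution inequality on `E` with constant `K`: if `∑ t_j² = 1`, the integral of
`φ (∑ t_j x_j) ∏ f_j(x_j)^{1 - t_j²}` is at most `K ∫ φ ∏ (∫ f_j)^{1 - t_j²}`. -/
def WeightedYoung {s : ℕ} (t : Fin s → ℝ) (E : Type*) [AddCommMonoid E] [Module ℝ E]
    [MeasureSpace E] (K : ℝ≥0∞) : Prop :=
  ∀ φ : E → ℝ≥0∞, Measurable φ → ∀ f : Fin s → E → ℝ≥0∞, (∀ j, Measurable (f j)) →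
    (∀ j, ∫⁻ x, f j x ≠ ∞) →
    ∫⁻ x : Fin s → E, φ (∑ j, t j • x j) * ∏ j, f j (x j) ^ (1 - t j ^ 2)
      ≤ K * (∫⁻ w, φ w) * ∏ j, (∫⁻ x, f j x) ^ (1 - t j ^ 2)

lemma weightedYoung_real {s : ℕ} (t : Fin s → ℝ) (ht0 : ∀ j, 0 ≤ t j)
    (ht : ∑ j, t j ^ 2 = 1) (ht1 : ∀ j, t j ^ 2 < 1) :
    WeightedYoung t ℝ (ENNReal.ofReal (exp (1 / 2))) := by
  intro φ hφ f hf hfin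
  have hc : ∀ j, 0 < 1 - t j ^ 2 := fun j => by linarith [ht1 j]
  by_cases h0 : ∃ j, ∫⁻ x, f j x = 0
  · obtain ⟨j, hj⟩ := h0
    have hae : ∀ᵐ x : Fin s → ℝ, f j (x j) = 0 :=
      (Measure.quasiMeasurePreserving_eval (fun _ : Fin s => (volume : Measure ℝ)) j).ae
        ((lintegral_eq_zero_iff (hf j)).1 hj)
    refine le_of_eq_of_le ?_ zero_le
    refine (lintegral_congr_ae ?_).trans lintegral_zero
    filter_upwards [hae] with x hx
    rw [Finset.prod_eq_zero (Finset.mem_univ j) (by rw [hx, ENNReal.zero_rpow_of_pos (hc j)]),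
      mul_zero]
  · push Not at h0
    have hmain := lintegral_weightedSum_le_of_lintegral_eq_one t ht0 ht ht1 φ hφ
      (fun j x => (∫⁻ y, f j y)⁻¹ * f j x) (fun j => (hf j).const_mul _) (fun j => by
        rw [lintegral_const_mul _ (hf j), ENNReal.inv_mul_cancel (h0 j) (hfin j)])
    set C : ℝ≥0∞ := ∏ j, (∫⁻ x, f j x) ^ (1 - t j ^ 2) with hC
    have hCtop : C ≠ ∞ := ENNReal.prod_ne_top fun j _ =>
      ENNReal.rpow_ne_top_of_nonneg (hc j).le (hfin j)
    have hpt : ∀ x : Fin s → ℝ, φ (∑ j, t j • x j) * ∏ j, f j (x j) ^ (1 - t j ^ 2)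
        = C * (φ (∑ j, t j * x j) *
          ∏ j, ((∫⁻ y, f j y)⁻¹ * f j (x j)) ^ (1 - t j ^ 2)) := by
      intro x
      rw [mul_left_comm, hC, ← Finset.prod_mul_distrib]
      congr 1
      refine Finset.prod_congr rfl fun j _ => ?_
      rw [← ENNReal.mul_rpow_of_nonneg _ _ (hc j).le, ← mul_assoc,
        ENNReal.mul_inv_cancel (h0 j) (hfin j), one_mul]
    simp_rw [hpt]
    rw [lintegral_const_mul' _ _ hCtop, mul_comm _ C]
    gcongr

lemma WeightedYoung.prod {s : ℕ} {t : Fin s → ℝ} {E F : Type*}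
    [AddCommMonoid E] [Module ℝ E] [MeasureSpace E] [SigmaFinite (volume : Measure E)]
    [MeasurableAdd₂ E] [MeasurableConstSMul ℝ E]
    [AddCommMonoid F] [Module ℝ F] [MeasureSpace F] [SigmaFinite (volume : Measure F)]
    [MeasurableAdd₂ F] [MeasurableConstSMul ℝ F] {K L : ℝ≥0∞} (hL : L ≠ ∞)
    (hE : WeightedYoung t E K) (hF : WeightedYoung t F L) : WeightedYoung t (E × F) (K * L) := by
  intro φ hφ f hf hfin
  have hsE : Measurable fun x : Fin s → E => ∑ j, t j • x j :=
    Finset.measurable_sum _ fun j _ => (measurable_pi_apply j).const_smul _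
  have hsF : Measurable fun x : Fin s → F => ∑ j, t j • x j :=
    Finset.measurable_sum _ fun j _ => (measurable_pi_apply j).const_smul _
  set G : (Fin s → E) × (Fin s → F) → ℝ≥0∞ := fun z =>
    φ (∑ j, t j • z.1 j, ∑ j, t j • z.2 j) * ∏ j, f j (z.1 j, z.2 j) ^ (1 - t j ^ 2) with hG
  have hGm : Measurable G := by
    refine (hφ.comp ((hsE.comp measurable_fst).prodMk (hsF.comp measurable_snd))).mul
      (Finset.measurable_prod _ fun j _ => ((hf j).comp ?_).pow_const _)
    exact ((measurable_pi_apply j).comp measurable_fst).prodMk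
      ((measurable_pi_apply j).comp measurable_snd)
  have hsplit : ∫⁻ x : Fin s → E × F, φ (∑ j, t j • x j) * ∏ j, f j (x j) ^ (1 - t j ^ 2)
      = ∫⁻ a, ∫⁻ b, G (a, b) := by
    rw [← lintegral_prod _ hGm.aemeasurable]
    refine Eq.trans ?_
      ((volume_measurePreserving_arrowProdEquivProdArrow E F (Fin s)).lintegral_comp hGm)
    refine lintegral_congr fun x => ?_
    have : ∑ j, t j • x j = (∑ j, t j • (x j).1, ∑ j, t j • (x j).2) := by
      ext <;> simp [Prod.fst_sum, Prod.snd_sum]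
    rw [this]
    rfl
  have hfubini : ∀ j, ∫⁻ a, ∫⁻ b, f j (a, b) = ∫⁻ z, f j z := fun j =>
    (lintegral_prod _ (hf j).aemeasurable).symm
  have hφfubini : ∫⁻ a, ∫⁻ b, φ (a, b) = ∫⁻ z, φ z := (lintegral_prod _ hφ.aemeasurable).symm
  have hfm : ∀ j, Measurable fun a => ∫⁻ b, f j (a, b) := fun j => (hf j).lintegral_prod_right'
  have hfin' : ∀ᵐ a : Fin s → E, ∀ j, ∫⁻ b, f j (a j, b) ≠ ∞ := by
    rw [ae_all_iff]
    intro j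
    have h1 : ∀ᵐ a, ∫⁻ b, f j (a, b) < ∞ := ae_lt_top (hfm j) (by rw [hfubini]; exact hfin j)
    filter_upwards [(Measure.quasiMeasurePreserving_eval
      (fun _ : Fin s => (volume : Measure E)) j).ae h1] with a ha using ha.ne
  rw [hsplit]
  calc ∫⁻ a, ∫⁻ b, G (a, b)
      ≤ ∫⁻ a : Fin s → E, L * ((∫⁻ w, φ (∑ j, t j • a j, w)) *
          ∏ j, (∫⁻ b, f j (a j, b)) ^ (1 - t j ^ 2)) := by
        refine lintegral_mono_ae ?_
        filter_upwards [hfin'] with a ha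
        rw [← mul_assoc]
        exact hF (fun w => φ (∑ j, t j • a j, w)) (hφ.comp measurable_prodMk_left)
          (fun j b => f j (a j, b)) (fun j => (hf j).comp measurable_prodMk_left) ha
    _ = L * ∫⁻ a : Fin s → E, (∫⁻ w, φ (∑ j, t j • a j, w)) *
          ∏ j, (∫⁻ b, f j (a j, b)) ^ (1 - t j ^ 2) := lintegral_const_mul' _ _ hL
    _ ≤ L * (K * (∫⁻ v, ∫⁻ w, φ (v, w)) * ∏ j, (∫⁻ a, ∫⁻ b, f j (a, b)) ^ (1 - t j ^ 2)) := by
        gcongr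
        exact hE (fun v => ∫⁻ w, φ (v, w)) hφ.lintegral_prod_right'
          (fun j a => ∫⁻ b, f j (a, b)) hfm fun j => by rw [hfubini]; exact hfin j
    _ = _ := by
        rw [hφfubini]
        simp_rw [hfubini]
        ring

lemma WeightedYoung.of_measurePreserving {s : ℕ} {t : Fin s → ℝ} {E F : Type*}
    [AddCommMonoid E] [Module ℝ E] [MeasureSpace E] [SigmaFinite (volume : Measure E)]
    [AddCommMonoid F] [Module ℝ F] [MeasureSpace F] [SigmaFinite (volume : Measure F)]
    [MeasurableAdd₂ F] [MeasurableConstSMul ℝ F] {K : ℝ≥0∞} (hE : WeightedYoung t E K)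
    (e : E → F) (he : MeasurePreserving e)
    (hsum : ∀ x : Fin s → E, e (∑ j, t j • x j) = ∑ j, t j • e (x j)) : WeightedYoung t F K := by
  intro φ hφ f hf hfin
  have hsF : Measurable fun x : Fin s → F => ∑ j, t j • x j :=
    Finset.measurable_sum _ fun j _ => (measurable_pi_apply j).const_smul _
  have hpi : MeasurePreserving (fun (x : Fin s → E) j => e (x j)) :=
    volume_preserving_pi fun _ => he
  have hGm : Measurable fun x : Fin s → F =>
      φ (∑ j, t j • x j) * ∏ j, f j (x j) ^ (1 - t j ^ 2) :=
    (hφ.comp hsF).mul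
      (Finset.measurable_prod _ fun j _ => ((hf j).comp (measurable_pi_apply j)).pow_const _)
  have hmain := hE (φ ∘ e) (hφ.comp he.measurable) (fun j => f j ∘ e)
    (fun j => (hf j).comp he.measurable) fun j => by
      simp only [Function.comp_apply]
      rw [he.lintegral_comp (hf j)]
      exact hfin j
  simp only [Function.comp_apply, hsum] at hmain
  rw [he.lintegral_comp hφ] at hmain
  simp_rw [fun j => he.lintegral_comp (hf j)] at hmain
  rwa [← hpi.lintegral_comp hGm]

lemma weightedYoung_pi {s : ℕ} (t : Fin s → ℝ) (ht0 : ∀ j, 0 ≤ t j)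
    (ht : ∑ j, t j ^ 2 = 1) (ht1 : ∀ j, t j ^ 2 < 1) (n : ℕ) :
    WeightedYoung t (Fin n → ℝ) (ENNReal.ofReal (exp (1 / 2)) ^ n) := by
  induction n with
  | zero =>
    intro φ _ f _ _
    simp only [lintegral_unique, pow_zero, one_mul, volume_pi, Measure.pi_univ]
    simp only [Subsingleton.elim _ (default : Fin 0 → ℝ)]
    simp
  | succ n ih =>
    rw [pow_succ']
    refine ((weightedYoung_real t ht0 ht ht1).prod (ENNReal.pow_ne_top ENNReal.ofReal_ne_top)
      ih).of_measurePreserving (fun z => Fin.cons z.1 z.2) ?_ fun x => ?_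
    · have h : (fun z : ℝ × (Fin n → ℝ) => (Fin.cons z.1 z.2 : Fin (n + 1) → ℝ)) =
          (MeasurableEquiv.piFinSuccAbove (fun _ : Fin (n + 1) => ℝ) 0).symm := by
        ext z i
        simp [MeasurableEquiv.piFinSuccAbove, Fin.insertNthEquiv]
      rw [h]
      exact (volume_preserving_piFinSuccAbove (fun _ : Fin (n + 1) => ℝ) 0).symm
    · ext i
      refine Fin.cases ?_ (fun i => ?_) i <;> simp [Prod.fst_sum, Prod.snd_sum]

lemma weightedYoung_euclideanSpace {s : ℕ} (t : Fin s → ℝ) (ht0 : ∀ j, 0 ≤ t j)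
    (ht : ∑ j, t j ^ 2 = 1) (ht1 : ∀ j, t j ^ 2 < 1) (n : ℕ) :
    WeightedYoung t (EuclideanSpace ℝ (Fin n)) (ENNReal.ofReal (exp (1 / 2)) ^ n) :=
  (weightedYoung_pi t ht0 ht ht1 n).of_measurePreserving (WithLp.toLp 2)
    (PiLp.volume_preserving_toLp (Fin n)) fun x => by simp [WithLp.toLp_sum]

lemma lintegral_ofReal_eq_one {α : Type*} [MeasurableSpace α] {μ : Measure α} {g : α → ℝ}
    (h0 : ∀ x, 0 ≤ g x) (h1 : ∫ x, g x ∂μ = 1) : ∫⁻ x, ENNReal.ofReal (g x) ∂μ = 1 := by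
  have hint : Integrable g μ := not_imp_comm.1 integral_undef (by rw [h1]; exact one_ne_zero)
  rw [← ofReal_integral_eq_lintegral_ofReal hint (ae_of_all _ h0), h1, ENNReal.ofReal_one]

lemma essSup_density_weightedSum_le {n s : ℕ} (f : Fin s → EuclideanSpace ℝ (Fin n) → ℝ≥0∞)
    (hf : ∀ j, Measurable (f j)) (hf1 : ∀ j, ∫⁻ x, f j x = 1)
    (t : Fin s → ℝ) (ht0 : ∀ j, 0 ≤ t j) (ht : ∑ j, t j ^ 2 = 1)
    (F : EuclideanSpace ℝ (Fin n) → ℝ≥0∞) (hF : Measurable F)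
    (hdens : Measure.map (fun x : Fin s → EuclideanSpace ℝ (Fin n) => ∑ j, t j • x j)
        (Measure.pi fun j => volume.withDensity (f j)) = volume.withDensity F) :
    essSup F volume ≤ ENNReal.ofReal (exp (n / 2)) * ∏ j, essSup (f j) volume ^ (t j ^ 2) := by
  have hprob : ∀ j, IsProbabilityMeasure (volume.withDensity (f j)) := fun j =>
    ⟨by simp [hf1 j]⟩
  have hsum : Measurable fun x : Fin s → EuclideanSpace ℝ (Fin n) => ∑ j, t j • x j := by
    fun_prop
  by_cases ht1 : ∀ j, t j ^ 2 < 1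
  · have hM : ∀ᵐ x : Fin s → EuclideanSpace ℝ (Fin n), ∀ j, f j (x j) ≤ essSup (f j) volume := by
      rw [ae_all_iff]
      intro j
      exact (Measure.quasiMeasurePreserving_eval
        (fun _ : Fin s => (volume : Measure (EuclideanSpace ℝ (Fin n)))) j).ae
        (ENNReal.ae_le_essSup (f j))
    have hK : ENNReal.ofReal (exp (1 / 2)) ^ n = ENNReal.ofReal (exp (n / 2)) := by
      rw [← ENNReal.ofReal_pow (Real.exp_pos _).le, ← Real.exp_nat_mul]
      congr 2
      ring
    refine essSup_le_of_ae_le _ (ae_le_of_forall_setLIntegral_le_of_sigmaFinite hF fun A hA _ => ?_)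
    set φ : EuclideanSpace ℝ (Fin n) → ℝ≥0∞ := A.indicator 1 with hφ
    have hφm : Measurable φ := measurable_one.indicator hA
    have hmain := weightedYoung_euclideanSpace t ht0 ht ht1 n φ hφm f hf fun j => by simp [hf1 j]
    simp only [hf1, ENNReal.one_rpow, Finset.prod_const_one, mul_one, hK] at hmain
    have hGm : Measurable fun x : Fin s → EuclideanSpace ℝ (Fin n) =>
        φ (∑ j, t j • x j) * ∏ j, f j (x j) ^ (1 - t j ^ 2) :=
      (hφm.comp hsum).mul
        (Finset.measurable_prod _ fun j _ => ((hf j).comp (measurable_pi_apply j)).pow_const _)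
    have hprodm : Measurable fun x : Fin s → EuclideanSpace ℝ (Fin n) => ∏ j, f j (x j) :=
      Finset.measurable_prod _ fun j _ => (hf j).comp (measurable_pi_apply j)
    calc ∫⁻ x in A, F x
        = ∫⁻ x : Fin s → EuclideanSpace ℝ (Fin n), (∏ j, f j (x j)) * φ (∑ j, t j • x j) := by
          rw [← withDensity_apply _ hA, ← hdens, ← lintegral_indicator_one hA,
            lintegral_map hφm hsum, Measure.pi_withDensity_fin _ f hf,
            lintegral_withDensity_eq_lintegral_mul (Measure.pi fun _ => volume) hprodm
              (g := fun x => φ (∑ j, t j • x j)) (hφm.comp hsum)]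
          rfl
      _ ≤ ∫⁻ x : Fin s → EuclideanSpace ℝ (Fin n), (∏ j, essSup (f j) volume ^ (t j ^ 2)) *
            (φ (∑ j, t j • x j) * ∏ j, f j (x j) ^ (1 - t j ^ 2)) := by
          refine lintegral_mono_ae ?_
          filter_upwards [hM] with x hx
          rw [mul_left_comm, mul_comm, ← Finset.prod_mul_distrib]
          gcongr with j
          calc f j (x j) = f j (x j) ^ (t j ^ 2 + (1 - t j ^ 2)) := by
                rw [add_sub_cancel, ENNReal.rpow_one]
            _ = f j (x j) ^ (t j ^ 2) * f j (x j) ^ (1 - t j ^ 2) :=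
                ENNReal.rpow_add_of_nonneg _ _ (sq_nonneg _) (by linarith [ht1 j])
            _ ≤ _ := by
                gcongr
                exact hx j
      _ = (∏ j, essSup (f j) volume ^ (t j ^ 2)) * ∫⁻ x : Fin s → EuclideanSpace ℝ (Fin n),
            φ (∑ j, t j • x j) * ∏ j, f j (x j) ^ (1 - t j ^ 2) := lintegral_const_mul _ hGm
      _ ≤ (∏ j, essSup (f j) volume ^ (t j ^ 2)) *
            (ENNReal.ofReal (exp (n / 2)) * ∫⁻ w, φ w) := by gcongr
      _ = ∫⁻ x in A, ENNReal.ofReal (exp (n / 2)) * ∏ j, essSup (f j) volume ^ (t j ^ 2) := by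
          rw [setLIntegral_const, hφ, lintegral_indicator_one hA]
          ring
  · push Not at ht1
    obtain ⟨j, hj⟩ := ht1
    have hsplit := Finset.add_sum_erase Finset.univ (fun i => t i ^ 2) (Finset.mem_univ j)
    have hrest : 0 ≤ ∑ i ∈ Finset.univ.erase j, t i ^ 2 :=
      Finset.sum_nonneg fun i _ => sq_nonneg _
    have hzero : ∀ i, i ≠ j → t i = 0 := by
      have h := (Finset.sum_eq_zero_iff_of_nonneg (s := Finset.univ.erase j)
        (f := fun i => t i ^ 2) fun i _ => sq_nonneg _).1 (by linarith)
      exact fun i hi => pow_eq_zero_iff two_ne_zero |>.1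
        (h i (Finset.mem_erase.2 ⟨hi, Finset.mem_univ i⟩))
    have hj2 : t j ^ 2 = 1 := by linarith
    have hj1 : t j = 1 := (pow_eq_one_iff_of_nonneg (ht0 j) two_ne_zero).1 hj2
    have hev : (fun x : Fin s → EuclideanSpace ℝ (Fin n) => ∑ i, t i • x i) =
        Function.eval j := by
      ext1 x
      rw [Finset.sum_eq_single j (fun i _ hi => by rw [hzero i hi, zero_smul])
        fun h => absurd (Finset.mem_univ j) h, hj1, one_smul]
    rw [hev, (measurePreserving_eval _ j).map_eq] at hdens
    have hFf : F =ᵐ[volume] f j := by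
      refine ((withDensity_eq_iff (hf j).aemeasurable hF.aemeasurable ?_).1 hdens).symm
      simp [hf1 j]
    rw [essSup_congr_ae hFf, Finset.prod_eq_single j
      (fun i _ hi => by simp [hzero i hi]) fun h => absurd (Finset.mem_univ j) h, hj2,
      ENNReal.rpow_one]
    refine le_mul_of_one_le_left zero_le ?_
    rw [ENNReal.one_le_ofReal, Real.one_le_exp_iff]
    positivity

end GaussianTransport

/-- if `X₁,…,X_s` are independent random vectors in `ℝⁿ` with log-concave
densities `g₁,…,g_s`, `t_j ≥ 0`, `‖t‖₂ = 1`, and `gt` is the density of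
`t₁X₁ + ⋯ + t_sX_s`, then `‖gt‖_∞ ≤ eⁿ ∏_j ‖g_j‖_∞^{t_j²}`. -/
theorem stmt3 {n s : ℕ}
    (g : Fin s → EuclideanSpace ℝ (Fin n) → ℝ)
    (hgmeas : ∀ j, Measurable (g j)) (hg0 : ∀ j x, 0 ≤ g j x)
    (hgprob : ∀ j, ∫ x, g j x = 1)
    (hglc : ∀ j, IsLogConcaveFun (g j))
    (t : Fin s → ℝ) (ht0 : ∀ j, 0 ≤ t j) (ht : ∑ j, t j ^ 2 = 1)
    (gt : EuclideanSpace ℝ (Fin n) → ℝ) (hgt : Measurable gt) (hgt0 : ∀ x, 0 ≤ gt x)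
    (hdens :
      Measure.map (fun x : Fin s → EuclideanSpace ℝ (Fin n) => ∑ j, t j • x j)
          (Measure.pi fun j => volume.withDensity fun x => ENNReal.ofReal (g j x))
        = volume.withDensity fun x => ENNReal.ofReal (gt x)) :
    essSup (fun x => ENNReal.ofReal (gt x)) volume
      ≤ ENNReal.ofReal (Real.exp n)
          * ∏ j, (essSup (fun x => ENNReal.ofReal (g j x)) volume) ^ (t j ^ 2) := by
  refine (essSup_density_weightedSum_le (fun j x => ENNReal.ofReal (g j x))
    (fun j => (hgmeas j).ennreal_ofReal)
    (fun j => lintegral_ofReal_eq_one (hg0 j) (hgprob j)) t ht0 ht _ hgt.ennreal_ofReal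
    hdens).trans ?_
  gcongr
  linarith [n.cast_nonneg (α := ℝ)]
end
end
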